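/- arXiv:2004.08802 — 3 statements merged into one kernel-verified Lean document; each statement's English description precedes it below -/
import Mathlib

section
/- Assume N ≥ 3 and p > 1 + 4/(N−2). For every c ∈ ℝ there exists a unique function u(·,c) ∈ C²([0,1), ℝ) which solves (PDE) on (0,1) and satisfies u(0,c) = c and u′(0,c) = 0. The functions (ρ,c) ↦ u(ρ,c) and (ρ,c) ↦ u′(ρ,c) are continuous on [0,1) × ℝ; for every c > 0 and every ρ ∈ [0,1), u(ρ,c) > 0; and u extends to a continuous function on [0,1] × ℝ. -/
open Set Filter

noncomputable def alphaP (p : ℝ) : ℝ := 2 / (p - 1)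

noncomputable def b0 (p : ℝ) : ℝ := (2 * (p + 1) / (p - 1) ^ 2) ^ ((1 : ℝ) / (p - 1))

noncomputable def bInf (N : ℕ) (p : ℝ) : ℝ :=
  (alphaP p * ((N : ℝ) - 2 - alphaP p)) ^ (alphaP p / 2)

noncomputable def uInf (N : ℕ) (p : ℝ) (ρ : ℝ) : ℝ := bInf N p * ρ ^ (-(alphaP p))

/-- `u` solves `(1-ρ²)u'' + ((N-1)/ρ - 2(α+1)ρ)u' - α(α+1)u + |u|^{p-1}u = 0` on `s`. -/
def IsSolOn (N : ℕ) (p : ℝ) (u : ℝ → ℝ) (s : Set ℝ) : Prop :=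
  ∀ ρ ∈ s,
    (1 - ρ ^ 2) * deriv (deriv u) ρ
      + (((N : ℝ) - 1) / ρ - 2 * (alphaP p + 1) * ρ) * deriv u ρ
      - alphaP p * (alphaP p + 1) * u ρ + |u ρ| ^ (p - 1) * u ρ = 0


namespace RadialODE

open Real Topology MeasureTheory

/-- The damping coefficient of the profile equation in the angular variable `ρ = sin θ`. -/
noncomputable def damping (n : ℕ) (d θ : ℝ) : ℝ := n * (cos θ / sin θ) + d * (sin θ / cos θ)

/-- The integrating factor of `z' + damping n d * z`. -/
noncomputable def weight (n : ℕ) (d θ : ℝ) : ℝ := sin θ ^ n / cos θ ^ d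

/-- The solution of `z' + damping n d * z = h` vanishing at `0`. -/
noncomputable def dampedPrimitive (n : ℕ) (d : ℝ) (h : ℝ → ℝ) (θ : ℝ) : ℝ :=
  (∫ ψ in (0 : ℝ)..θ, weight n d ψ * h ψ) / weight n d θ

lemma sin_pos_of_mem {θ : ℝ} (h : θ ∈ Ioo 0 (π / 2)) : 0 < sin θ :=
  sin_pos_of_pos_of_lt_pi h.1 (by linarith [h.2, pi_pos])

lemma cos_pos_of_mem {θ : ℝ} (h : θ ∈ Ico 0 (π / 2)) : 0 < cos θ :=
  cos_pos_of_mem_Ioo ⟨by linarith [h.1, pi_pos], h.2⟩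

lemma damping_nonneg {n : ℕ} {d θ : ℝ} (hd : 0 ≤ d) (h : θ ∈ Ioo 0 (π / 2)) :
    0 ≤ damping n d θ := by
  have := sin_pos_of_mem h
  have := cos_pos_of_mem ⟨h.1.le, h.2⟩
  unfold damping
  positivity

lemma weight_pos {n : ℕ} {d θ : ℝ} (h : θ ∈ Ioo 0 (π / 2)) : 0 < weight n d θ := by
  have := sin_pos_of_mem h
  have := cos_pos_of_mem ⟨h.1.le, h.2⟩
  unfold weight
  positivity

lemma hasDerivAt_weight {n : ℕ} {d θ : ℝ} (h : θ ∈ Ioo 0 (π / 2)) :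
    HasDerivAt (weight n d) (weight n d θ * damping n d θ) θ := by
  have hs := sin_pos_of_mem h
  have hc := cos_pos_of_mem ⟨h.1.le, h.2⟩
  have h1 : HasDerivAt (fun x => cos x ^ d) (-sin θ * d * cos θ ^ (d - 1)) θ :=
    (hasDerivAt_cos θ).rpow_const (Or.inl hc.ne')
  have h2 := ((hasDerivAt_sin θ).pow n).div h1 (by positivity)
  refine h2.congr_deriv ?_
  rw [rpow_sub_one hc.ne']
  have hcd : 0 < cos θ ^ d := by positivity
  unfold weight damping
  rcases n with _ | n
  · simp
    field_simp
  · simp only [Nat.add_sub_cancel, Pi.pow_apply]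
    field_simp
    ring

lemma continuousOn_weight (n : ℕ) (d : ℝ) : ContinuousOn (weight n d) (Ico 0 (π / 2)) := by
  intro θ hθ
  have hc := cos_pos_of_mem hθ
  refine ContinuousAt.continuousWithinAt ?_
  exact (continuous_sin.continuousAt.pow n).div
    (continuous_cos.continuousAt.rpow_const (Or.inl hc.ne')) (by positivity)

lemma weight_mono {n : ℕ} {d : ℝ} (hd : 0 ≤ d) {ψ θ : ℝ} (h0 : 0 ≤ ψ) (h1 : ψ ≤ θ)
    (h2 : θ < π / 2) : weight n d ψ ≤ weight n d θ := by
  have hc := cos_pos_of_mem ⟨h0.trans h1, h2⟩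
  have hs : sin ψ ≤ sin θ := sin_le_sin_of_le_of_le_pi_div_two (by linarith [pi_pos]) h2.le h1
  have hcc : cos θ ≤ cos ψ := cos_le_cos_of_nonneg_of_le_pi h0 (by linarith [pi_pos]) h1
  have hs0 : 0 ≤ sin ψ := sin_nonneg_of_nonneg_of_le_pi h0 (by linarith [pi_pos])
  unfold weight
  have hs1 := hs0.trans hs
  have : 0 < cos θ ^ d := by positivity
  gcongr

lemma weight_nonneg {n : ℕ} {d ψ : ℝ} (hψ : ψ ∈ Ico 0 (π / 2)) : 0 ≤ weight n d ψ := by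
  have hc := cos_pos_of_mem hψ
  have hs0 : 0 ≤ sin ψ := sin_nonneg_of_nonneg_of_le_pi hψ.1 (by linarith [pi_pos, hψ.2])
  unfold weight
  positivity

lemma intervalIntegrable_weight_mul (n : ℕ) (d : ℝ) {h : ℝ → ℝ} (hh : Continuous h) {θ : ℝ}
    (hθ : θ ∈ Ico 0 (π / 2)) :
    IntervalIntegrable (fun ψ => weight n d ψ * h ψ) volume 0 θ := by
  refine ContinuousOn.intervalIntegrable ?_
  rw [uIcc_of_le hθ.1]
  exact ((continuousOn_weight n d).mono fun x hx => ⟨hx.1, hx.2.trans_lt hθ.2⟩).mul hh.continuousOn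

lemma dampedPrimitive_zero (n : ℕ) (d : ℝ) (h : ℝ → ℝ) : dampedPrimitive n d h 0 = 0 := by
  simp [dampedPrimitive]

lemma dampedPrimitive_pi_div_two (n : ℕ) {d : ℝ} (hd : 0 < d) (h : ℝ → ℝ) :
    dampedPrimitive n d h (π / 2) = 0 := by
  simp [dampedPrimitive, weight, zero_rpow hd.ne']

lemma abs_dampedPrimitive_le {n : ℕ} {d : ℝ} (hd : 0 < d) {h : ℝ → ℝ} {B θ : ℝ} (hB : 0 ≤ B)
    (hθ : θ ∈ Icc 0 (π / 2)) (hb : ∀ ψ ∈ Icc 0 θ, |h ψ| ≤ B) :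
    |dampedPrimitive n d h θ| ≤ B * θ := by
  have h0 : 0 ≤ B * θ := mul_nonneg hB hθ.1
  rcases hθ.1.eq_or_lt with h1 | h1
  · rw [← h1, dampedPrimitive_zero]; simp
  rcases hθ.2.eq_or_lt with h2 | h2
  · rw [h2] at h0 ⊢
    rw [dampedPrimitive_pi_div_two n hd]; simpa using h0
  have hw := weight_pos (n := n) (d := d) ⟨h1, h2⟩
  unfold dampedPrimitive
  rw [abs_div, abs_of_pos hw, div_le_iff₀ hw]
  have := intervalIntegral.norm_integral_le_of_norm_le_const (a := 0) (b := θ)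
    (C := weight n d θ * B) (f := fun ψ => weight n d ψ * h ψ) (by
      intro x hx
      rw [uIoc_of_le h1.le] at hx
      rw [norm_mul, norm_eq_abs, norm_eq_abs,
        abs_of_nonneg (weight_nonneg ⟨hx.1.le, hx.2.trans_lt h2⟩)]
      exact mul_le_mul (weight_mono hd.le hx.1.le hx.2 h2) (hb x ⟨hx.1.le, hx.2⟩) (abs_nonneg _)
        hw.le)
  rw [norm_eq_abs, sub_zero, abs_of_pos h1] at this
  linarith

lemma dampedPrimitive_sub {n : ℕ} {d : ℝ} (hd : 0 < d) {h k : ℝ → ℝ} (hh : Continuous h)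
    (hk : Continuous k) {θ : ℝ} (hθ : θ ∈ Icc 0 (π / 2)) :
    dampedPrimitive n d h θ - dampedPrimitive n d k θ =
      dampedPrimitive n d (fun ψ => h ψ - k ψ) θ := by
  rcases hθ.2.eq_or_lt with h2 | h2
  · simp [h2, dampedPrimitive_pi_div_two n hd]
  unfold dampedPrimitive
  rw [← sub_div, ← intervalIntegral.integral_sub (intervalIntegrable_weight_mul n d hh ⟨hθ.1, h2⟩)
    (intervalIntegrable_weight_mul n d hk ⟨hθ.1, h2⟩)]
  simp only [mul_sub]

lemma hasDerivAt_dampedPrimitive {n : ℕ} {d : ℝ} {h : ℝ → ℝ} (hh : Continuous h)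
    {θ : ℝ} (hθ : θ ∈ Ioo 0 (π / 2)) :
    HasDerivAt (dampedPrimitive n d h) (h θ - damping n d θ * dampedPrimitive n d h θ) θ := by
  have hw := weight_pos (n := n) (d := d) hθ
  have hcont : ContinuousOn (fun ψ => weight n d ψ * h ψ) (Ioo 0 (π / 2)) :=
    ((continuousOn_weight n d).mono Ioo_subset_Ico_self).mul hh.continuousOn
  have h1 : HasDerivAt (fun x => ∫ ψ in (0 : ℝ)..x, weight n d ψ * h ψ) (weight n d θ * h θ) θ :=
    intervalIntegral.integral_hasDerivAt_right
      (intervalIntegrable_weight_mul n d hh ⟨hθ.1.le, hθ.2⟩)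
      (hcont.stronglyMeasurableAtFilter isOpen_Ioo θ hθ)
      (hcont.continuousAt (isOpen_Ioo.mem_nhds hθ))
  refine (h1.div (hasDerivAt_weight hθ) hw.ne').congr_deriv ?_
  unfold dampedPrimitive
  field_simp

lemma exists_bound {h : ℝ → ℝ} (hh : Continuous h) :
    ∃ B, 0 ≤ B ∧ ∀ ψ ∈ Icc 0 (π / 2), |h ψ| ≤ B := by
  obtain ⟨B, hB⟩ := isCompact_Icc.exists_bound_of_continuousOn (s := Icc 0 (π / 2)) hh.continuousOn
  exact ⟨|B|, abs_nonneg _, fun ψ hψ => (hB ψ hψ).trans (le_abs_self _)⟩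

lemma integrableOn_dampedPrimitive {n : ℕ} {d : ℝ} (hd : 0 < d) {h : ℝ → ℝ} (hh : Continuous h) :
    IntegrableOn (dampedPrimitive n d h) (Icc 0 (π / 2)) := by
  obtain ⟨B, hB, hb⟩ := exists_bound hh
  rw [integrableOn_Icc_iff_integrableOn_Ioo]
  have hc : ContinuousOn (dampedPrimitive n d h) (Ioo 0 (π / 2)) := fun θ hθ =>
    (hasDerivAt_dampedPrimitive hh hθ).continuousAt.continuousWithinAt
  refine Integrable.mono' (g := fun _ => B * (π / 2)) (integrable_const _)
    (hc.aestronglyMeasurable measurableSet_Ioo) ?_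
  refine (ae_restrict_iff' measurableSet_Ioo).2 (Eventually.of_forall fun θ hθ => ?_)
  have := abs_dampedPrimitive_le (n := n) hd hB ⟨hθ.1.le, hθ.2.le⟩
    (fun ψ hψ => hb ψ ⟨hψ.1, hψ.2.trans hθ.2.le⟩)
  rw [norm_eq_abs]
  exact this.trans (mul_le_mul_of_nonneg_left hθ.2.le hB)

lemma intervalIntegrable_dampedPrimitive {n : ℕ} {d : ℝ} (hd : 0 < d) {h : ℝ → ℝ}
    (hh : Continuous h) {θ : ℝ} (hθ : θ ∈ Icc 0 (π / 2)) :
    IntervalIntegrable (dampedPrimitive n d h) volume 0 θ := by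
  rw [intervalIntegrable_iff_integrableOn_Ioc_of_le hθ.1]
  exact (integrableOn_dampedPrimitive hd hh).mono_set fun x hx => ⟨hx.1.le, hx.2.trans hθ.2⟩

/-- The Picard map of the damped equation `y'' + damping n d * y' = g y`, conjugated by
`exp (L * θ)`. -/
noncomputable def picard (n : ℕ) (d c L : ℝ) (g : ℝ → ℝ) (y : ℝ → ℝ) (θ : ℝ) : ℝ :=
  exp (-(L * θ)) *
    (c + ∫ φ in (0 : ℝ)..θ, dampedPrimitive n d (fun ψ => g (exp (L * ψ) * y ψ)) φ)

lemma continuousOn_primitive {n : ℕ} {d : ℝ} (hd : 0 < d) {h : ℝ → ℝ} (hh : Continuous h) :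
    ContinuousOn (fun θ => ∫ φ in (0 : ℝ)..θ, dampedPrimitive n d h φ) (Icc 0 (π / 2)) := by
  have hp : (0 : ℝ) ≤ π / 2 := by positivity
  have := intervalIntegral.continuousOn_primitive_interval (a := 0) (b := π / 2) (μ := volume)
    (f := dampedPrimitive n d h) (by
      rw [uIcc_of_le hp]; exact integrableOn_dampedPrimitive hd hh)
  rwa [uIcc_of_le hp] at this

lemma continuousOn_picard {n : ℕ} {d c L : ℝ} (hd : 0 < d) {g y : ℝ → ℝ} (hg : Continuous g)
    (hy : Continuous y) : ContinuousOn (picard n d c L g y) (Icc 0 (π / 2)) := by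
  unfold picard
  exact (by fun_prop : Continuous fun θ : ℝ => exp (-(L * θ))).continuousOn.mul
    (continuousOn_const.add (continuousOn_primitive hd (by fun_prop)))

lemma abs_picard_sub_le {n : ℕ} {d c L K δ : ℝ} (hd : 0 < d) (hL : 0 < L) (hK : 0 ≤ K)
    {g y₁ y₂ : ℝ → ℝ} (hg : ∀ x y, |g x - g y| ≤ K * |x - y|) (hgc : Continuous g)
    (h1 : Continuous y₁) (h2 : Continuous y₂) (hδ : ∀ ψ, |y₁ ψ - y₂ ψ| ≤ δ)
    {θ : ℝ} (hθ : θ ∈ Icc 0 (π / 2)) :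
    |picard n d c L g y₁ θ - picard n d c L g y₂ θ| ≤ K * (π / 2) / L * δ := by
  have hδ0 : 0 ≤ δ := (abs_nonneg _).trans (hδ 0)
  set k₁ : ℝ → ℝ := fun ψ => g (exp (L * ψ) * y₁ ψ) with hk₁
  set k₂ : ℝ → ℝ := fun ψ => g (exp (L * ψ) * y₂ ψ) with hk₂
  have hc1 : Continuous k₁ := by fun_prop
  have hc2 : Continuous k₂ := by fun_prop
  have hbound : ∀ φ ∈ Icc 0 (π / 2),
      |dampedPrimitive n d k₁ φ - dampedPrimitive n d k₂ φ| ≤ K * (π / 2) * δ * exp (L * φ) := by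
    intro φ hφ
    rw [dampedPrimitive_sub hd hc1 hc2 hφ]
    have := abs_dampedPrimitive_le (n := n) (d := d) (h := fun ψ => k₁ ψ - k₂ ψ)
      (B := K * δ * exp (L * φ)) hd (by positivity) hφ (by
        intro ψ hψ
        refine (hg _ _).trans ?_
        rw [← mul_sub, abs_mul, abs_of_pos (exp_pos _), mul_assoc]
        refine mul_le_mul_of_nonneg_left ?_ hK
        rw [mul_comm δ]
        have : exp (L * ψ) ≤ exp (L * φ) := exp_le_exp.2 (mul_le_mul_of_nonneg_left hψ.2 hL.le)
        exact mul_le_mul this (hδ ψ) (abs_nonneg _) (exp_pos _).le)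
    refine this.trans ?_
    have h3 : K * δ * exp (L * φ) * φ ≤ K * δ * exp (L * φ) * (π / 2) :=
      mul_le_mul_of_nonneg_left hφ.2 (by positivity)
    linarith
  have hint : ∫ φ in (0 : ℝ)..θ, K * (π / 2) * δ * exp (L * φ)
      = K * (π / 2) * δ * ((exp (L * θ) - 1) / L) := by
    have hder : ∀ x ∈ uIcc 0 θ, HasDerivAt (fun φ => K * (π / 2) * δ * (exp (L * φ) / L))
        (K * (π / 2) * δ * exp (L * x)) x := by
      intro x _
      have : HasDerivAt (fun φ => exp (L * φ)) (exp (L * x) * (L * 1)) x :=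
        ((hasDerivAt_id x).const_mul L).exp
      refine ((this.div_const L).const_mul (K * (π / 2) * δ)).congr_deriv ?_
      field_simp
    rw [intervalIntegral.integral_eq_sub_of_hasDerivAt hder
      (Continuous.intervalIntegrable (by fun_prop) _ _)]
    simp
    ring
  have hmain : |(∫ φ in (0 : ℝ)..θ, dampedPrimitive n d k₁ φ)
      - ∫ φ in (0 : ℝ)..θ, dampedPrimitive n d k₂ φ| ≤ K * (π / 2) * δ * (exp (L * θ) / L) := by
    rw [← intervalIntegral.integral_sub (intervalIntegrable_dampedPrimitive hd hc1 hθ)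
      (intervalIntegrable_dampedPrimitive hd hc2 hθ)]
    refine (intervalIntegral.norm_integral_le_of_norm_le
      (f := fun φ => dampedPrimitive n d k₁ φ - dampedPrimitive n d k₂ φ)
      (g := fun φ => K * (π / 2) * δ * exp (L * φ)) hθ.1 (Eventually.of_forall fun t ht =>
        hbound t ⟨ht.1.le, ht.2.trans hθ.2⟩)
      (Continuous.intervalIntegrable (by fun_prop) _ _)).trans ?_
    rw [hint]
    gcongr
    linarith
  unfold picard
  rw [← mul_sub, add_sub_add_left_eq_sub, abs_mul, abs_of_pos (exp_pos _)]
  refine (mul_le_mul_of_nonneg_left hmain (exp_pos _).le).trans (le_of_eq ?_)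
  rw [exp_neg]
  have := exp_pos (L * θ)
  field_simp

/-- A classical solution `(y, z = y')` of `y'' + damping n d * y' = g y` on `[0, π / 2)` with
`y 0 = c` and `y' 0 = 0`. -/
structure IsAngularSol (n : ℕ) (d : ℝ) (g : ℝ → ℝ) (c : ℝ) (y z : ℝ → ℝ) : Prop where
  continuousOn_fst : ContinuousOn y (Ico 0 (π / 2))
  continuousOn_snd : ContinuousOn z (Ico 0 (π / 2))
  fst_zero : y 0 = c
  snd_zero : z 0 = 0
  hasDerivAt_fst : ∀ θ ∈ Ioo 0 (π / 2), HasDerivAt y (z θ) θ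
  hasDerivAt_snd : ∀ θ ∈ Ioo 0 (π / 2), HasDerivAt z (g (y θ) - damping n d θ * z θ) θ

theorem exists_isAngularSol_of_lipschitz {n : ℕ} {d K : ℝ} (hd : 0 < d) (hK : 0 ≤ K)
    {g : ℝ → ℝ} (hg : ∀ x y, |g x - g y| ≤ K * |x - y|) (c : ℝ) :
    ∃ y z : ℝ → ℝ, IsAngularSol n d g c y z ∧ ContinuousOn y (Icc 0 (π / 2)) := by
  have hp : (0 : ℝ) ≤ π / 2 := by positivity
  have hgc : Continuous g := (LipschitzWith.of_dist_le_mul (K := K.toNNReal) (fun x y => by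
    rw [dist_eq, dist_eq, coe_toNNReal _ hK]; exact hg x y)).continuous
  set L : ℝ := K * π + 1 with hLdef
  have hL : 0 < L := by positivity
  let T : C(Icc 0 (π / 2), ℝ) → C(Icc 0 (π / 2), ℝ) := fun y =>
    ⟨fun θ => picard n d c L g (IccExtend hp y) θ,
      (continuousOn_picard hd hgc y.continuous.Icc_extend').domRestrict⟩
  have hT : ContractingWith (1 / 2) T := by
    refine ⟨by norm_num, LipschitzWith.of_dist_le_mul fun y₁ y₂ => ?_⟩
    rw [ContinuousMap.dist_le (by positivity)]
    intro θ
    have := abs_picard_sub_le (n := n) (c := c) (δ := dist y₁ y₂) hd hL hK hg hgc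
      (y₁.continuous.Icc_extend' (h := hp)) (y₂.continuous.Icc_extend' (h := hp)) (fun ψ => by
        have := ContinuousMap.dist_apply_le_dist (f := y₁) (g := y₂) (projIcc 0 (π / 2) hp ψ)
        simpa [IccExtend, dist_eq] using this) θ.2
    rw [dist_eq]
    refine this.trans (mul_le_mul_of_nonneg_right ?_ dist_nonneg)
    rw [div_le_iff₀ hL]
    simp
    linarith
  set y₀ := ContractingWith.fixedPoint T hT with hy₀
  have hfix : T y₀ = y₀ := hT.fixedPoint_isFixedPt
  set v : ℝ → ℝ := IccExtend hp y₀ with hv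
  have hvc : Continuous v := y₀.continuous.Icc_extend'
  set h : ℝ → ℝ := fun ψ => g (exp (L * ψ) * v ψ) with hh
  have hhc : Continuous h := by fun_prop
  have hy : ∀ θ ∈ Icc 0 (π / 2),
      c + ∫ φ in (0 : ℝ)..θ, dampedPrimitive n d h φ = exp (L * θ) * v θ := by
    intro θ hθ
    have h1 : v θ = picard n d c L g v θ := by
      have := congrArg (fun f : C(Icc 0 (π / 2), ℝ) => f ⟨θ, hθ⟩) hfix
      simp only [hv, IccExtend_of_mem hp y₀ hθ]
      exact this.symm
    rw [h1, picard, ← mul_assoc, ← exp_add]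
    simp [hh]
  have hYc : ContinuousOn (fun θ => c + ∫ φ in (0 : ℝ)..θ, dampedPrimitive n d h φ)
      (Icc 0 (π / 2)) := continuousOn_const.add (continuousOn_primitive hd hhc)
  have hder : ∀ θ ∈ Ioo 0 (π / 2), HasDerivAt (dampedPrimitive n d h)
      (h θ - damping n d θ * dampedPrimitive n d h θ) θ := fun θ hθ =>
    hasDerivAt_dampedPrimitive hhc hθ
  have hIoo : ContinuousOn (dampedPrimitive n d h) (Ioo 0 (π / 2)) := fun θ hθ =>
    (hder θ hθ).continuousAt.continuousWithinAt
  refine ⟨fun θ => c + ∫ φ in (0 : ℝ)..θ, dampedPrimitive n d h φ, dampedPrimitive n d h,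
    ⟨hYc.mono Ico_subset_Icc_self, ?_, by simp, dampedPrimitive_zero _ _ _, ?_, ?_⟩, hYc⟩
  · intro θ hθ
    rcases hθ.1.eq_or_lt with h0 | h0
    · subst h0
      obtain ⟨B, hB, hb⟩ := exists_bound hhc
      unfold ContinuousWithinAt
      rw [dampedPrimitive_zero]
      have hlim : Tendsto (fun θ : ℝ => B * θ) (𝓝[Ico 0 (π / 2)] 0) (𝓝 0) := by
        have : Continuous fun θ : ℝ => B * θ := by fun_prop
        simpa using (this.tendsto 0).mono_left nhdsWithin_le_nhds
      refine squeeze_zero_norm' ?_ hlim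
      filter_upwards [self_mem_nhdsWithin] with θ hθ
      exact abs_dampedPrimitive_le hd hB ⟨hθ.1, hθ.2.le⟩
        fun ψ hψ => hb ψ ⟨hψ.1, hψ.2.trans hθ.2.le⟩
    · exact (hder θ ⟨h0, hθ.2⟩).continuousAt.continuousWithinAt
  · intro θ hθ
    exact (intervalIntegral.integral_hasDerivAt_right
      (intervalIntegrable_dampedPrimitive hd hhc ⟨hθ.1.le, hθ.2.le⟩)
      (hIoo.stronglyMeasurableAtFilter isOpen_Ioo θ hθ)
      (hder θ hθ).continuousAt).const_add c
  · intro θ hθ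
    have := hder θ hθ
    simp only [hy θ ⟨hθ.1.le, hθ.2.le⟩]
    exact this

namespace IsAngularSol

variable {n : ℕ} {d c : ℝ} {g y z : ℝ → ℝ}

lemma tendsto_fst (h : IsAngularSol n d g c y z) : Tendsto y (𝓝[>] 0) (𝓝 c) := by
  have hp : (0 : ℝ) < π / 2 := by positivity
  rw [← nhdsWithin_Ioo_eq_nhdsGT hp, ← h.fst_zero]
  exact (h.continuousOn_fst 0 ⟨le_rfl, hp⟩).mono_left (nhdsWithin_mono _ Ioo_subset_Ico_self)

lemma tendsto_snd (h : IsAngularSol n d g c y z) : Tendsto z (𝓝[>] 0) (𝓝 0) := by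
  have hp : (0 : ℝ) < π / 2 := by positivity
  rw [← nhdsWithin_Ioo_eq_nhdsGT hp]
  have := (h.continuousOn_snd 0 ⟨le_rfl, hp⟩).mono_left (nhdsWithin_mono _ Ioo_subset_Ico_self)
  rwa [h.snd_zero] at this

lemma tendsto_div_sin (h : IsAngularSol n d g c y z) (hg : Continuous g) :
    Tendsto (fun θ => z θ / sin θ) (𝓝[>] 0) (𝓝 (g c / (n + 1))) := by
  have hp : (0 : ℝ) < π / 2 := by positivity
  have hs0 : Tendsto sin (𝓝[>] 0) (𝓝 0) := by
    simpa using (continuous_sin.tendsto 0).mono_left nhdsWithin_le_nhds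
  have hc0 : Tendsto cos (𝓝[>] 0) (𝓝 1) := by
    simpa using (continuous_cos.tendsto 0).mono_left nhdsWithin_le_nhds
  have key := HasDerivAt.lhopital_zero_right_on_Ico (a := 0) (b := π / 2) (l := 𝓝 (g c / (n + 1)))
    (f := fun θ => sin θ ^ n * z θ) (g := fun θ => sin θ ^ (n + 1))
    (f' := fun θ => sin θ ^ n * (g (y θ) - d * (sin θ / cos θ) * z θ))
    (g' := fun θ => (n + 1) * sin θ ^ n * cos θ) hp
    (by
      intro θ hθ
      have hs := sin_pos_of_mem hθ
      have hc := cos_pos_of_mem ⟨hθ.1.le, hθ.2⟩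
      refine (((hasDerivAt_sin θ).fun_pow n).mul (h.hasDerivAt_snd θ hθ)).congr_deriv ?_
      unfold damping
      rcases n with _ | n
      · simp
      · simp only [Nat.add_sub_cancel]
        field_simp
        ring)
    (by
      intro θ hθ
      refine ((hasDerivAt_sin θ).fun_pow (n + 1)).congr_deriv ?_
      simp)
    ((continuous_sin.pow n).continuousOn.mul h.continuousOn_snd)
    (continuous_sin.pow (n + 1)).continuousOn
    (by
      intro θ hθ
      have hs := sin_pos_of_mem hθ
      have hc := cos_pos_of_mem ⟨hθ.1.le, hθ.2⟩
      positivity)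
    (by simp [h.snd_zero]) (by simp)
    (by
      have hlim : Tendsto (fun θ => (g (y θ) - d * (sin θ / cos θ) * z θ) / ((n + 1) * cos θ))
          (𝓝[>] 0) (𝓝 ((g c - d * (0 / 1) * 0) / ((n + 1) * 1))) := by
        refine Tendsto.div ?_ (hc0.const_mul _) (by positivity)
        exact ((hg.tendsto c).comp h.tendsto_fst).sub (((hs0.div hc0 one_ne_zero).const_mul d).mul h.tendsto_snd)
      simp only [mul_zero, sub_zero, mul_one] at hlim
      refine hlim.congr' ?_
      filter_upwards [Ioo_mem_nhdsGT hp] with θ hθ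
      have hs := sin_pos_of_mem hθ
      have hc := cos_pos_of_mem ⟨hθ.1.le, hθ.2⟩
      field_simp)
  refine key.congr' ?_
  filter_upwards [Ioo_mem_nhdsGT hp] with θ hθ
  have hs := sin_pos_of_mem hθ
  rw [pow_succ]
  field_simp

lemma tendsto_deriv_snd (h : IsAngularSol n d g c y z) (hg : Continuous g) :
    Tendsto (fun θ => g (y θ) - damping n d θ * z θ) (𝓝[>] 0) (𝓝 (g c / (n + 1))) := by
  have hs0 : Tendsto sin (𝓝[>] 0) (𝓝 0) := by
    simpa using (continuous_sin.tendsto 0).mono_left nhdsWithin_le_nhds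
  have hc0 : Tendsto cos (𝓝[>] 0) (𝓝 1) := by
    simpa using (continuous_cos.tendsto 0).mono_left nhdsWithin_le_nhds
  have hlim : Tendsto (fun θ => g (y θ) - (n * (cos θ * (z θ / sin θ)) + d * (sin θ / cos θ) * z θ))
      (𝓝[>] 0) (𝓝 (g c - (n * (1 * (g c / (n + 1))) + d * (0 / 1) * 0))) :=
    ((hg.tendsto c).comp h.tendsto_fst).sub
      (((hc0.mul (h.tendsto_div_sin hg)).const_mul _).add
        (((hs0.div hc0 one_ne_zero).const_mul d).mul h.tendsto_snd))
  have he : g c - (n * (1 * (g c / (n + 1))) + d * (0 / 1) * 0) = g c / (n + 1) := by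
    field_simp
    ring
  rw [he] at hlim
  refine hlim.congr fun θ => ?_
  unfold damping
  ring

lemma hasDerivWithinAt_fst (h : IsAngularSol n d g c y z) {θ : ℝ} (hθ : θ ∈ Ico 0 (π / 2)) :
    HasDerivWithinAt y (z θ) (Ici 0) θ := by
  have hp : (0 : ℝ) < π / 2 := by positivity
  rcases hθ.1.eq_or_lt with h0 | h0
  · subst h0
    rw [h.snd_zero]
    refine hasDerivWithinAt_Ici_of_tendsto_deriv (s := Ioo 0 (π / 2))
      (fun x hx => (h.hasDerivAt_fst x hx).differentiableAt.differentiableWithinAt)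
      ((h.continuousOn_fst 0 ⟨le_rfl, hp⟩).mono Ioo_subset_Ico_self) (Ioo_mem_nhdsGT hp) ?_
    refine h.tendsto_snd.congr' ?_
    filter_upwards [Ioo_mem_nhdsGT hp] with x hx
    exact (h.hasDerivAt_fst x hx).deriv.symm
  · exact (h.hasDerivAt_fst θ ⟨h0, hθ.2⟩).hasDerivWithinAt

lemma contDiffOn_two (h : IsAngularSol n d g c y z) (hg : Continuous g) :
    ContDiffOn ℝ 2 y (Ico 0 (π / 2)) := by
  classical
  have hp : (0 : ℝ) < π / 2 := by positivity
  have hu : UniqueDiffOn ℝ (Ico 0 (π / 2)) := uniqueDiffOn_Ico 0 (π / 2)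
  set w : ℝ → ℝ := fun θ => if θ = 0 then g c / (n + 1) else g (y θ) - damping n d θ * z θ with hw
  have hy : ∀ θ ∈ Ico 0 (π / 2), HasDerivWithinAt y (z θ) (Ico 0 (π / 2)) θ := fun θ hθ =>
    (h.hasDerivWithinAt_fst hθ).mono Ico_subset_Ici_self
  have hz : ∀ θ ∈ Ico 0 (π / 2), HasDerivWithinAt z (w θ) (Ico 0 (π / 2)) θ := by
    intro θ hθ
    rcases hθ.1.eq_or_lt with h0 | h0
    · subst h0
      simp only [hw, if_true]
      refine HasDerivWithinAt.mono (t := Ici 0) ?_ fun x hx => hx.1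
      refine hasDerivWithinAt_Ici_of_tendsto_deriv (s := Ioo 0 (π / 2))
        (fun x hx => (h.hasDerivAt_snd x hx).differentiableAt.differentiableWithinAt)
        ((h.continuousOn_snd 0 ⟨le_rfl, hp⟩).mono Ioo_subset_Ico_self) (Ioo_mem_nhdsGT hp) ?_
      refine (h.tendsto_deriv_snd hg).congr' ?_
      filter_upwards [Ioo_mem_nhdsGT hp] with x hx
      exact (h.hasDerivAt_snd x hx).deriv.symm
    · simp only [hw, if_neg h0.ne']
      exact (h.hasDerivAt_snd θ ⟨h0, hθ.2⟩).hasDerivWithinAt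
  have hwc : ContinuousOn w (Ico 0 (π / 2)) := by
    intro θ hθ
    rcases hθ.1.eq_or_lt with h0 | h0
    · subst h0
      have h1 : Ico 0 (π / 2) = insert 0 (Ioo 0 (π / 2)) := (Ioo_insert_left hp).symm
      rw [h1, continuousWithinAt_insert_self]
      unfold ContinuousWithinAt
      rw [nhdsWithin_Ioo_eq_nhdsGT hp]
      simp only [hw, if_true]
      refine (h.tendsto_deriv_snd hg).congr' ?_
      filter_upwards [self_mem_nhdsWithin] with x hx
      rw [if_neg ((mem_Ioi.1 hx).ne')]
    · have hθ' : θ ∈ Ioo 0 (π / 2) := ⟨h0, hθ.2⟩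
      have hs := sin_pos_of_mem hθ'
      have hc := cos_pos_of_mem hθ
      refine ContinuousAt.continuousWithinAt ?_
      have : ContinuousAt (fun θ => g (y θ) - damping n d θ * z θ) θ := by
        refine (hg.continuousAt.comp (h.hasDerivAt_fst θ hθ').continuousAt).sub
          (ContinuousAt.mul ?_ (h.hasDerivAt_snd θ hθ').continuousAt)
        unfold damping
        exact (continuousAt_const.mul
          (continuous_cos.continuousAt.div continuous_sin.continuousAt hs.ne')).add
          (continuousAt_const.mul
            (continuous_sin.continuousAt.div continuous_cos.continuousAt hc.ne'))
      refine this.congr ?_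
      filter_upwards [Ioi_mem_nhds h0] with x hx
      simp only [hw, if_neg ((mem_Ioi.1 hx).ne')]
  have h2 : (2 : WithTop ℕ∞) = 1 + 1 := by norm_num
  rw [h2, contDiffOn_succ_iff_derivWithin hu]
  refine ⟨fun θ hθ => (hy θ hθ).differentiableWithinAt, by simp, ?_⟩
  have h1 : ContDiffOn ℝ 1 z (Ico 0 (π / 2)) := by
    rw [← zero_add (1 : WithTop ℕ∞), contDiffOn_succ_iff_derivWithin hu]
    refine ⟨fun θ hθ => (hz θ hθ).differentiableWithinAt, by simp, ?_⟩
    exact (contDiffOn_zero.2 hwc).congr fun θ hθ => (hz θ hθ).derivWithin (hu θ hθ)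
  exact h1.congr fun θ hθ => (hy θ hθ).derivWithin (hu θ hθ)

/-- The energy `z ^ 2 / 2 + Φ y` is nonincreasing as long as `Φ' = -g` along the solution. -/
lemma potential_le (h : IsAngularSol n d g c y z) (hd : 0 ≤ d) {G Φ : ℝ → ℝ}
    (hΦ : ∀ x, HasDerivAt Φ (-G x) x) {τ : ℝ} (hτ : τ ∈ Ico 0 (π / 2))
    (hG : ∀ θ ∈ Ioo 0 τ, g (y θ) = G (y θ)) : Φ (y τ) ≤ Φ c := by
  have hsub : Icc 0 τ ⊆ Ico 0 (π / 2) := fun x hx => ⟨hx.1, hx.2.trans_lt hτ.2⟩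
  have hΦc : Continuous Φ := continuous_iff_continuousAt.2 fun x => (hΦ x).continuousAt
  have hder : ∀ θ ∈ Ioo 0 τ, HasDerivAt (fun θ => z θ ^ 2 / 2 + Φ (y θ))
      (-(damping n d θ * z θ ^ 2)) θ := by
    intro θ hθ
    have hθ' : θ ∈ Ioo 0 (π / 2) := ⟨hθ.1, hθ.2.trans hτ.2⟩
    refine ((((h.hasDerivAt_snd θ hθ').fun_pow 2).div_const 2).add
      ((hΦ (y θ)).comp θ (h.hasDerivAt_fst θ hθ'))).congr_deriv ?_
    rw [← hG θ hθ]
    norm_num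
    ring
  have hanti : AntitoneOn (fun θ => z θ ^ 2 / 2 + Φ (y θ)) (Icc 0 τ) := by
    refine antitoneOn_of_deriv_nonpos (convex_Icc 0 τ) ?_ ?_ ?_
    · exact (((h.continuousOn_snd.mono hsub).pow 2).div_const 2).add
        (hΦc.comp_continuousOn (h.continuousOn_fst.mono hsub))
    · rw [interior_Icc]
      exact fun θ hθ => (hder θ hθ).differentiableAt.differentiableWithinAt
    · rw [interior_Icc]
      intro θ hθ
      rw [(hder θ hθ).deriv]
      have := damping_nonneg (n := n) hd (θ := θ) ⟨hθ.1, hθ.2.trans hτ.2⟩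
      have : 0 ≤ damping n d θ * z θ ^ 2 := by positivity
      linarith
  have := hanti ⟨le_rfl, hτ.1⟩ ⟨hτ.1, le_rfl⟩ hτ.1
  simp only [h.snd_zero, h.fst_zero] at this
  nlinarith [sq_nonneg (z τ)]

/-- Continuous dependence on the initial value. -/
lemma sq_add_sq_le {c' : ℝ} {y' z' : ℝ → ℝ} (h : IsAngularSol n d g c y z)
    (h' : IsAngularSol n d g c' y' z') (hd : 0 ≤ d) {K : ℝ} (hK : 0 ≤ K)
    {τ : ℝ} (hτ : τ ∈ Ico 0 (π / 2))
    (hg : ∀ θ ∈ Ioo 0 τ, |g (y θ) - g (y' θ)| ≤ K * |y θ - y' θ|) :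
    (y τ - y' τ) ^ 2 + (z τ - z' τ) ^ 2 ≤ exp ((1 + K) * τ) * (c - c') ^ 2 := by
  have hsub : Icc 0 τ ⊆ Ico 0 (π / 2) := fun x hx => ⟨hx.1, hx.2.trans_lt hτ.2⟩
  set F : ℝ → ℝ := fun θ => exp (-((1 + K) * θ)) * ((y θ - y' θ) ^ 2 + (z θ - z' θ) ^ 2) with hF
  have hder : ∀ θ ∈ Ioo 0 τ, HasDerivAt F (exp (-((1 + K) * θ)) *
      (-(1 + K) * ((y θ - y' θ) ^ 2 + (z θ - z' θ) ^ 2) + 2 * (z θ - z' θ) *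
        (y θ - y' θ + (g (y θ) - g (y' θ)) - damping n d θ * (z θ - z' θ)))) θ := by
    intro θ hθ
    have hθ' : θ ∈ Ioo 0 (π / 2) := ⟨hθ.1, hθ.2.trans hτ.2⟩
    have e1 : HasDerivAt (fun θ => exp (-((1 + K) * θ))) (exp (-((1 + K) * θ)) * -((1 + K) * 1)) θ :=
      (((hasDerivAt_id θ).const_mul (1 + K)).neg).exp
    refine (e1.mul ((((h.hasDerivAt_fst θ hθ').sub (h'.hasDerivAt_fst θ hθ')).fun_pow 2).add
      (((h.hasDerivAt_snd θ hθ').sub (h'.hasDerivAt_snd θ hθ')).fun_pow 2))).congr_deriv ?_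
    simp
    ring
  have hanti : AntitoneOn F (Icc 0 τ) := by
    refine antitoneOn_of_deriv_nonpos (convex_Icc 0 τ) ?_ ?_ ?_
    · refine ContinuousOn.mul (by fun_prop) ?_
      exact (((h.continuousOn_fst.mono hsub).sub (h'.continuousOn_fst.mono hsub)).pow 2).add
        (((h.continuousOn_snd.mono hsub).sub (h'.continuousOn_snd.mono hsub)).pow 2)
    · rw [interior_Icc]
      exact fun θ hθ => (hder θ hθ).differentiableAt.differentiableWithinAt
    · rw [interior_Icc]
      intro θ hθ
      rw [(hder θ hθ).deriv]
      have hA := damping_nonneg (n := n) hd (θ := θ) ⟨hθ.1, hθ.2.trans hτ.2⟩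
      refine mul_nonpos_of_nonneg_of_nonpos (exp_pos _).le ?_
      set a := y θ - y' θ
      set b := z θ - z' θ
      set e := g (y θ) - g (y' θ)
      have he : |e| ≤ K * |a| := hg θ hθ
      have h1 : b * e ≤ K * (|a| * |b|) := by
        calc b * e ≤ |b * e| := le_abs_self _
          _ = |b| * |e| := abs_mul _ _
          _ ≤ |b| * (K * |a|) := mul_le_mul_of_nonneg_left he (abs_nonneg _)
          _ = _ := by ring
      have h2 : 2 * (|a| * |b|) ≤ a ^ 2 + b ^ 2 := by
        nlinarith [sq_nonneg (|a| - |b|), sq_abs a, sq_abs b]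
      have h3 : 0 ≤ damping n d θ * b ^ 2 := by positivity
      have h4 : b * a ≤ |a| * |b| := by
        rw [mul_comm, ← abs_mul]; exact le_abs_self _
      nlinarith [mul_le_mul_of_nonneg_left h2 hK]
  have := hanti ⟨le_rfl, hτ.1⟩ ⟨hτ.1, le_rfl⟩ hτ.1
  simp only [hF, h.snd_zero, h.fst_zero, h'.snd_zero, h'.fst_zero] at this
  rw [exp_neg, inv_mul_le_iff₀ (exp_pos _)] at this
  simpa using this

end IsAngularSol

/-- The nonlinearity of the profile equation, moved to the right-hand side. -/
noncomputable def source (κ p x : ℝ) : ℝ := κ * x - |x| ^ (p - 1) * x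

/-- The primitive of `-source κ p` vanishing at `0`. -/
noncomputable def potential (κ p x : ℝ) : ℝ := |x| ^ (p + 1) / (p + 1) - κ * x ^ 2 / 2

lemma hasDerivAt_potential {p : ℝ} (κ : ℝ) (hp : 1 < p) (x : ℝ) :
    HasDerivAt (potential κ p) (-source κ p x) x := by
  have h1 := (hasDerivAt_abs_rpow x (p := p + 1) (by linarith)).div_const (p + 1)
  have h2 := (((hasDerivAt_id x).fun_pow 2).const_mul κ).div_const 2
  refine (h1.sub h2).congr_deriv ?_
  have : p + 1 - 2 = p - 1 := by ring
  rw [this]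
  unfold source
  simp
  field_simp

lemma hasDerivAt_source {p : ℝ} (κ : ℝ) (hp : 1 < p) (x : ℝ) :
    HasDerivAt (source κ p) (κ - p * |x| ^ (p - 1)) x := by
  have h2 : HasDerivAt (fun x => κ * x) (κ * 1) x := (hasDerivAt_id x).const_mul κ
  have h1 : HasDerivAt (fun x : ℝ => |x| ^ (p - 1) * x) (p * |x| ^ (p - 1)) x := by
    rcases eq_or_ne x 0 with rfl | hx
    · rw [hasDerivAt_iff_tendsto_slope]
      have hc : Continuous fun x : ℝ => |x| ^ (p - 1) :=
        continuous_abs.rpow_const fun x => Or.inr (by linarith)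
      have := (hc.tendsto 0).mono_left (nhdsWithin_le_nhds (s := {0}ᶜ))
      simp only [abs_zero, zero_rpow (by linarith : p - 1 ≠ 0)] at this ⊢
      rw [mul_zero]
      refine this.congr' ?_
      filter_upwards [self_mem_nhdsWithin] with y hy
      have hy : y ≠ 0 := hy
      simp [slope_def_field]
      field_simp
    · have := ((hasDerivAt_abs hx).rpow_const (p := p - 1) (Or.inl (abs_pos.2 hx).ne')).mul
        (hasDerivAt_id x)
      refine this.congr_deriv ?_
      have h3 : 0 < |x| := abs_pos.2 hx
      rw [rpow_sub_one h3.ne' (p - 1)]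
      have h4 : (SignType.sign x : ℝ) * x = |x| := sign_mul_self x
      have h5 : ((SignType.sign x : ℝ) * (p - 1) * (|x| ^ (p - 1) / |x|)) * x
          = (p - 1) * (|x| ^ (p - 1) / |x|) * ((SignType.sign x : ℝ) * x) := by ring
      simp only [id, mul_one]
      rw [h5, h4]
      field_simp
      ring
  refine (h2.sub h1).congr_deriv (by ring)

lemma continuous_source {p : ℝ} (κ : ℝ) (hp : 1 < p) : Continuous (source κ p) :=
  continuous_iff_continuousAt.2 fun x => (hasDerivAt_source κ hp x).continuousAt

lemma exists_source_lipschitz {p : ℝ} (κ : ℝ) (hp : 1 < p) (M : ℝ) :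
    ∃ K, 0 ≤ K ∧ ∀ x ∈ Icc (-M) M, ∀ y ∈ Icc (-M) M,
      |source κ p x - source κ p y| ≤ K * |x - y| := by
  have hc : Continuous fun x : ℝ => κ - p * |x| ^ (p - 1) :=
    continuous_const.sub (continuous_const.mul
      (continuous_abs.rpow_const fun x => Or.inr (by linarith)))
  obtain ⟨B, hB⟩ := isCompact_Icc.exists_bound_of_continuousOn (s := Icc (-M) M) hc.continuousOn
  refine ⟨|B|, abs_nonneg _, fun x hx y hy => ?_⟩
  have := (convex_Icc (-M) M).norm_image_sub_le_of_norm_hasDerivWithin_le (C := |B|)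
    (fun z _ => (hasDerivAt_source κ hp z).hasDerivWithinAt)
    (fun z hz => (hB z hz).trans (le_abs_self B)) hy hx
  simpa using this

lemma exists_potential_barrier {κ p : ℝ} (hκ : 0 ≤ κ) (hp : 1 < p) {C : ℝ} (hC : 0 ≤ C) :
    ∃ M, C < M ∧ ∀ c x : ℝ, |c| ≤ C → M ≤ |x| → potential κ p c < potential κ p x := by
  have h1 : Tendsto (fun x : ℝ => x ^ (p - 1)) atTop atTop := tendsto_rpow_atTop (by linarith)
  obtain ⟨M, hM1, hM2⟩ := ((h1.eventually_ge_atTop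
    ((p + 1) * (C ^ (p + 1) + 1 + κ / 2))).and (eventually_ge_atTop (C + 1))).exists
  refine ⟨M, by linarith, fun c x hc hx => ?_⟩
  have hx1 : 1 ≤ |x| := by linarith
  have hp1 : 0 < p + 1 := by linarith
  have h2 : potential κ p c ≤ C ^ (p + 1) := by
    have h3 : |c| ^ (p + 1) ≤ C ^ (p + 1) := rpow_le_rpow (abs_nonneg _) hc hp1.le
    have h4 : |c| ^ (p + 1) / (p + 1) ≤ |c| ^ (p + 1) :=
      div_le_self (by positivity) (by linarith)
    have h5 : 0 ≤ κ * c ^ 2 / 2 := by positivity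
    unfold potential
    linarith
  have h6 : (p + 1) * (C ^ (p + 1) + 1 + κ / 2) ≤ |x| ^ (p - 1) :=
    hM1.trans (rpow_le_rpow (by linarith) hx (by linarith))
  have h7 : |x| ^ (p + 1) = |x| ^ (p - 1) * x ^ 2 := by
    rw [← sq_abs, ← rpow_natCast, ← rpow_add (by linarith)]
    congr 1
    push_cast
    ring
  have h8 : C ^ (p + 1) + 1 + κ / 2 ≤ |x| ^ (p - 1) / (p + 1) := by
    rw [le_div_iff₀ hp1]; linarith
  have hx2 : 1 ≤ x ^ 2 := by rw [← sq_abs]; nlinarith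
  have h9 : potential κ p x = x ^ 2 * (|x| ^ (p - 1) / (p + 1) - κ / 2) := by
    unfold potential
    rw [h7]
    ring
  have h10 : 0 ≤ C ^ (p + 1) := by positivity
  rw [h9]
  nlinarith

lemma IsAngularSol.abs_lt {n : ℕ} {d κ p c C M : ℝ} {y z : ℝ → ℝ} (hd : 0 ≤ d) (hp : 1 < p)
    (h : IsAngularSol n d (source κ p) c y z) (hc : |c| ≤ C)
    (hM : ∀ c x : ℝ, |c| ≤ C → M ≤ |x| → potential κ p c < potential κ p x)
    {θ : ℝ} (hθ : θ ∈ Ico 0 (π / 2)) : |y θ| < M := by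
  by_contra hcon
  have := h.potential_le hd (hasDerivAt_potential κ hp) hθ fun _ _ => rfl
  exact absurd this (not_le.2 (hM c (y θ) hc (not_lt.1 hcon)))

theorem exists_isAngularSol_source {n : ℕ} {d κ p : ℝ} (hd : 0 < d) (hκ : 0 ≤ κ) (hp : 1 < p)
    (c : ℝ) :
    ∃ y z : ℝ → ℝ, IsAngularSol n d (source κ p) c y z ∧ ContinuousOn y (Icc 0 (π / 2)) := by
  obtain ⟨M, hcM, hM⟩ := exists_potential_barrier hκ hp (abs_nonneg c)
  have hM0 : 0 < M := (abs_nonneg c).trans_lt hcM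
  obtain ⟨K, hK, hlip⟩ := exists_source_lipschitz κ hp M
  have hMM : -M ≤ M := by linarith
  set t : ℝ → ℝ := fun x => projIcc (-M) M hMM x with ht
  have htl : ∀ x y, |t x - t y| ≤ |x - y| := by
    intro x y
    have := (LipschitzWith.projIcc hMM).dist_le_mul x y
    simpa [Subtype.dist_eq, dist_eq] using this
  have hg : ∀ x y, |source κ p (t x) - source κ p (t y)| ≤ K * |x - y| := fun x y =>
    (hlip _ (projIcc (-M) M hMM x).2 _ (projIcc (-M) M hMM y).2).trans
      (mul_le_mul_of_nonneg_left (htl x y) hK)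
  have htM : ∀ x, |x| ≤ M → t x = x := fun x hx => by
    simp [ht, projIcc_of_mem hMM (abs_le.1 hx)]
  obtain ⟨y, z, h, hy⟩ := exists_isAngularSol_of_lipschitz (n := n) hd hK
    (g := fun x => source κ p (t x)) hg c
  have hlt : ∀ θ ∈ Ico 0 (π / 2), |y θ| < M := by
    by_contra! hcon
    obtain ⟨θ₁, hθ₁, hbad⟩ := hcon
    set S : Set ℝ := Icc 0 θ₁ ∩ (fun θ => |y θ|) ⁻¹' Ici M with hS
    have hcl : IsClosed S := ContinuousOn.preimage_isClosed_of_isClosed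
      (hy.mono fun x hx => ⟨hx.1, hx.2.trans hθ₁.2.le⟩).abs isClosed_Icc isClosed_Ici
    have hcomp : IsCompact S := isCompact_Icc.of_isClosed_subset hcl inter_subset_left
    obtain ⟨τ, hτS, hτ⟩ := hcomp.exists_isLeast ⟨θ₁, ⟨hθ₁.1, le_rfl⟩, hbad⟩
    have := h.potential_le hd.le (hasDerivAt_potential κ hp) (τ := τ)
      ⟨hτS.1.1, hτS.1.2.trans_lt hθ₁.2⟩ (by
        intro θ hθ
        have : |y θ| < M := by
          by_contra hge
          exact absurd (hτ ⟨⟨hθ.1.le, hθ.2.le.trans hτS.1.2⟩, not_lt.1 hge⟩) (not_le.2 hθ.2)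
        simp only [htM _ this.le])
    exact absurd this (not_le.2 (hM c (y τ) le_rfl hτS.2))
  refine ⟨y, z, ⟨h.continuousOn_fst, h.continuousOn_snd, h.fst_zero, h.snd_zero,
    h.hasDerivAt_fst, fun θ hθ => ?_⟩, hy⟩
  have := h.hasDerivAt_snd θ hθ
  rwa [htM _ (hlt θ ⟨hθ.1.le, hθ.2⟩).le] at this

/-- Solutions with positive initial value stay positive; the proof uses a Pohozaev-type functional,
the energy of `ρ ^ α * y` in the variable `log ρ`, `ρ = sin θ`. -/
theorem IsAngularSol.pos {n : ℕ} {d α p c : ℝ} {y z : ℝ → ℝ} (hα : 0 < α) (hd : 0 < d)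
    (hn : (n : ℝ) = d + 1 + 2 * α) (hpα : p = 1 + 2 / α)
    (h : IsAngularSol n d (source (α * (α + 1)) p) c y z) (hc : 0 < c)
    {θ : ℝ} (hθ : θ ∈ Ico 0 (π / 2)) : 0 < y θ := by
  have hp1 : 1 < p := by
    have : 0 < 2 / α := by positivity
    linarith
  set Q : ℝ → ℝ := fun x => |x| ^ (p + 1) / (p + 1) with hQ
  have hQd : ∀ x, HasDerivAt Q (|x| ^ (p - 1) * x) x := by
    intro x
    refine ((hasDerivAt_abs_rpow x (p := p + 1) (by linarith)).div_const (p + 1)).congr_deriv ?_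
    have : p + 1 - 2 = p - 1 := by ring
    rw [this]
    field_simp
  have hQe : ∀ x, Q x = α / (2 * (α + 1)) * (|x| ^ (p - 1) * x ^ 2) := by
    intro x
    have h7 : |x| ^ (p + 1) = |x| ^ (p - 1) * x ^ 2 := by
      rw [← sq_abs, ← rpow_natCast, ← rpow_add_of_nonneg (abs_nonneg _) (by linarith) (by simp)]
      congr 1
      push_cast
      ring
    simp only [hQ, h7]
    have : p + 1 = 2 * (α + 1) / α := by rw [hpα]; field_simp; ring
    rw [this]
    field_simp
  have hQc : Continuous Q := continuous_iff_continuousAt.2 fun x => (hQd x).continuousAt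
  set B : ℝ → ℝ := fun θ => (sin θ * z θ + α * (cos θ * y θ)) ^ 2 / 2
    - α * (α + d) * y θ ^ 2 / 2 + sin θ ^ 2 * Q (y θ) with hB
  have hder : ∀ θ ∈ Ioo 0 (π / 2), HasDerivAt (fun θ => sin θ ^ (2 * α) * B θ)
      (-(d * sin θ ^ (2 * α) / (sin θ * cos θ) * (sin θ * z θ + α * (cos θ * y θ)) ^ 2)) θ := by
    intro θ hθ
    have hs := sin_pos_of_mem hθ
    have hcs := cos_pos_of_mem ⟨hθ.1.le, hθ.2⟩
    have dy := h.hasDerivAt_fst θ hθ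
    have dz := h.hasDerivAt_snd θ hθ
    have dw := ((hasDerivAt_sin θ).mul dz).add (((hasDerivAt_cos θ).mul dy).const_mul α)
    have dB := ((((dw.fun_pow 2).div_const 2).sub
      (((dy.fun_pow 2).const_mul (α * (α + d))).div_const 2)).add
      (((hasDerivAt_sin θ).fun_pow 2).mul ((hQd (y θ)).comp θ dy)))
    have dS := (hasDerivAt_sin θ).rpow_const (p := 2 * α) (Or.inl hs.ne')
    refine (dS.mul dB).congr_deriv ?_
    have hQy := hQe (y θ)
    have hsc := sin_sq_add_cos_sq θ
    rw [rpow_sub_one hs.ne']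
    simp only [Pi.add_apply, Pi.sub_apply, Pi.mul_apply, Nat.cast_ofNat,
      Nat.add_one_sub_one, pow_one, Function.comp_apply, hQy, source, damping, hn]
    generalize |y θ| ^ (p - 1) = q
    generalize sin θ ^ (2 * α) = R
    generalize y θ = Y
    generalize z θ = Z at *
    generalize sin θ = S at *
    generalize cos θ = C at *
    have hC : C ^ 2 = 1 - S ^ 2 := by linarith
    clear dy dz dw dB dS
    field_simp
    grind
  have hanti : AntitoneOn (fun θ => sin θ ^ (2 * α) * B θ) (Ioo 0 (π / 2)) := by
    refine antitoneOn_of_deriv_nonpos (convex_Ioo 0 (π / 2)) ?_ ?_ ?_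
    · exact fun θ hθ => (hder θ hθ).continuousAt.continuousWithinAt
    · rw [interior_Ioo]
      exact fun θ hθ => (hder θ hθ).differentiableAt.differentiableWithinAt
    · rw [interior_Ioo]
      intro θ hθ
      rw [(hder θ hθ).deriv]
      have hs := sin_pos_of_mem hθ
      have hcs := cos_pos_of_mem ⟨hθ.1.le, hθ.2⟩
      rw [neg_nonpos]
      positivity
  have hlim : Tendsto B (𝓝[>] 0) (𝓝 (-(α * d * c ^ 2 / 2))) := by
    have hs0 : Tendsto sin (𝓝[>] 0) (𝓝 0) := by
      simpa using (continuous_sin.tendsto 0).mono_left nhdsWithin_le_nhds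
    have hc0 : Tendsto cos (𝓝[>] 0) (𝓝 1) := by
      simpa using (continuous_cos.tendsto 0).mono_left nhdsWithin_le_nhds
    have hy := h.tendsto_fst
    have := (((((hs0.mul h.tendsto_snd).add ((hc0.mul hy).const_mul α)).pow 2).div_const 2).sub
      (((hy.pow 2).const_mul (α * (α + d))).div_const 2)).add
      ((hs0.pow 2).mul ((hQc.tendsto c).comp hy))
    have he : (0 * 0 + α * (1 * c)) ^ 2 / 2 - α * (α + d) * c ^ 2 / 2 + 0 ^ 2 * Q c
        = -(α * d * c ^ 2 / 2) := by ring
    rwa [he] at this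
  have hneg : ∀ θ ∈ Ioo 0 (π / 2), B θ < 0 := by
    intro θ hθ
    have h1 : ∀ᶠ ε in 𝓝[>] 0, B ε < 0 :=
      hlim.eventually_lt_const (neg_lt_zero.2 (by positivity))
    obtain ⟨ε, hε, hεθ⟩ := (h1.and (Ioo_mem_nhdsGT hθ.1)).exists
    have hε' : ε ∈ Ioo 0 (π / 2) := ⟨hεθ.1, hεθ.2.trans hθ.2⟩
    have h2 := hanti hε' hθ hεθ.2.le
    have h3 : 0 < sin ε ^ (2 * α) := rpow_pos_of_pos (sin_pos_of_mem hε') _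
    have h4 : 0 < sin θ ^ (2 * α) := rpow_pos_of_pos (sin_pos_of_mem hθ) _
    have h5 : sin θ ^ (2 * α) * B θ < 0 := h2.trans_lt (mul_neg_of_pos_of_neg h3 hε)
    exact (pos_iff_neg_of_mul_neg h5).1 h4
  by_contra hcon
  have hsub : Icc 0 θ ⊆ Ico 0 (π / 2) := fun x hx => ⟨hx.1, hx.2.trans_lt hθ.2⟩
  obtain ⟨τ, hτ, hτ0⟩ := intermediate_value_Icc' hθ.1 (h.continuousOn_fst.mono hsub)
    (show (0 : ℝ) ∈ Icc (y θ) (y 0) from ⟨not_lt.1 hcon, by rw [h.fst_zero]; exact hc.le⟩)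
  have hτpos : 0 < τ := by
    rcases hτ.1.eq_or_lt with h0 | h0
    · rw [← h0, h.fst_zero] at hτ0
      exact absurd hτ0 hc.ne'
    · exact h0
  have := hneg τ ⟨hτpos, (hsub hτ).2⟩
  simp only [hB, hQe, hτ0] at this
  simp at this
  nlinarith [sq_nonneg (sin τ * z τ)]

/-- A solution of the profile equation with `u' 0 = 0`, read in the variable `ρ = sin θ`. -/
lemma isAngularSol_of_isSolOn {N n : ℕ} {p d c : ℝ} {f : ℝ → ℝ} (hn : (n : ℝ) = N - 1)
    (hd : d = N - 2 - 2 * alphaP p) (hf : ContDiffOn ℝ 2 f (Ico 0 1))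
    (hsol : IsSolOn N p f (Ioo 0 1)) (h0 : f 0 = c) (h1 : derivWithin f (Ici 0) 0 = 0) :
    IsAngularSol n d (source (alphaP p * (alphaP p + 1)) p) c (fun θ => f (sin θ))
      (fun θ => derivWithin f (Ico 0 1) (sin θ) * cos θ) := by
  have hu : UniqueDiffOn ℝ (Ico (0 : ℝ) 1) := uniqueDiffOn_Ico 0 1
  have hmaps : MapsTo sin (Ico 0 (π / 2)) (Ico 0 1) := fun θ hθ =>
    ⟨sin_nonneg_of_nonneg_of_le_pi hθ.1 (by linarith [hθ.2, pi_pos]), by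
      rw [← sin_pi_div_two]
      exact sin_lt_sin_of_lt_of_le_pi_div_two (by linarith [hθ.1, pi_pos]) le_rfl hθ.2⟩
  have hIoo : ∀ θ ∈ Ioo 0 (π / 2), sin θ ∈ Ioo (0 : ℝ) 1 := fun θ hθ =>
    ⟨sin_pos_of_mem hθ, (hmaps ⟨hθ.1.le, hθ.2⟩).2⟩
  have hder : ∀ ρ ∈ Ioo (0 : ℝ) 1, derivWithin f (Ico 0 1) ρ = deriv f ρ := fun ρ hρ =>
    derivWithin_of_mem_nhds (Ico_mem_nhds hρ.1 hρ.2)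
  have hdiff := (contDiffOn_succ_iff_deriv_of_isOpen (n := 1) isOpen_Ioo).1
    ((hf.mono Ioo_subset_Ico_self).of_le (by norm_num))
  refine ⟨hf.continuousOn.comp continuous_sin.continuousOn hmaps, ?_, by simpa using h0, ?_, ?_, ?_⟩
  · exact ((hf.continuousOn_derivWithin hu (by norm_num)).comp continuous_sin.continuousOn
      hmaps).mul continuous_cos.continuousOn
  · have : derivWithin f (Ico 0 1) 0 = derivWithin f (Ici 0) 0 := by
      refine derivWithin_congr_set ?_
      filter_upwards [Iio_mem_nhds (zero_lt_one (α := ℝ))] with x hx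
      exact propext ⟨fun h => h.1, fun h => ⟨h, hx⟩⟩
    simp [this, h1]
  · intro θ hθ
    have hρ := hIoo θ hθ
    have hfd : HasDerivAt f (deriv f (sin θ)) (sin θ) :=
      (hdiff.1.differentiableAt (isOpen_Ioo.mem_nhds hρ)).hasDerivAt
    simp only [hder _ hρ]
    exact hfd.comp θ (hasDerivAt_sin θ)
  · intro θ hθ
    have hρ := hIoo θ hθ
    have hs := sin_pos_of_mem hθ
    have hc := cos_pos_of_mem ⟨hθ.1.le, hθ.2⟩
    have hfd : HasDerivAt (deriv f) (deriv (deriv f) (sin θ)) (sin θ) :=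
      ((hdiff.2.2.differentiableOn (by norm_num)).differentiableAt
        (isOpen_Ioo.mem_nhds hρ)).hasDerivAt
    have hfd' : HasDerivAt (derivWithin f (Ico 0 1)) (deriv (deriv f) (sin θ)) (sin θ) := by
      refine hfd.congr_of_eventuallyEq ?_
      filter_upwards [isOpen_Ioo.mem_nhds hρ] with x hx
      exact hder x hx
    refine ((hfd'.comp θ (hasDerivAt_sin θ)).mul (hasDerivAt_cos θ)).congr_deriv ?_
    have hode := hsol _ hρ
    have hsc := sin_sq_add_cos_sq θ
    simp only [Function.comp_apply, hder _ hρ, source, damping, hn, hd]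
    generalize |f (sin θ)| ^ (p - 1) * f (sin θ) = q at *
    generalize f (sin θ) = y at *
    generalize deriv f (sin θ) = y1 at *
    generalize deriv (deriv f) (sin θ) = y2 at *
    generalize alphaP p = α at *
    generalize sin θ = S at *
    generalize cos θ = C at *
    clear hfd hfd'
    field_simp at hode ⊢
    grind

section

variable {N n : ℕ} {p d c : ℝ} {y z : ℝ → ℝ}

lemma arcsin_mem_Ico {ρ : ℝ} (hρ : ρ ∈ Ico (0 : ℝ) 1) : arcsin ρ ∈ Ico 0 (π / 2) :=
  ⟨arcsin_nonneg.2 hρ.1, arcsin_lt_pi_div_two.2 hρ.2⟩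

lemma arcsin_mem_Ioo {ρ : ℝ} (hρ : ρ ∈ Ioo (0 : ℝ) 1) : arcsin ρ ∈ Ioo 0 (π / 2) :=
  ⟨arcsin_pos.2 hρ.1, arcsin_lt_pi_div_two.2 hρ.2⟩

namespace IsAngularSol

lemma hasDerivWithinAt_comp_arcsin {g : ℝ → ℝ} (h : IsAngularSol n d g c y z) {ρ : ℝ}
    (hρ : ρ ∈ Ico (0 : ℝ) 1) :
    HasDerivWithinAt (fun ρ => y (arcsin ρ)) (z (arcsin ρ) * (1 / √(1 - ρ ^ 2))) (Ici 0) ρ :=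
  (h.hasDerivWithinAt_fst (arcsin_mem_Ico hρ)).comp ρ
    (hasDerivAt_arcsin (by linarith [hρ.1]) hρ.2.ne).hasDerivWithinAt
    fun _ hx => arcsin_nonneg.2 hx

lemma derivWithin_comp_arcsin {g : ℝ → ℝ} (h : IsAngularSol n d g c y z) {ρ : ℝ}
    (hρ : ρ ∈ Ico (0 : ℝ) 1) :
    derivWithin (fun ρ => y (arcsin ρ)) (Ici 0) ρ = z (arcsin ρ) * (1 / √(1 - ρ ^ 2)) :=
  (h.hasDerivWithinAt_comp_arcsin hρ).derivWithin (uniqueDiffOn_Ici 0 ρ hρ.1)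

lemma contDiffOn_comp_arcsin {g : ℝ → ℝ} (h : IsAngularSol n d g c y z) (hg : Continuous g) :
    ContDiffOn ℝ 2 (fun ρ => y (arcsin ρ)) (Ico 0 1) :=
  (h.contDiffOn_two hg).comp (fun _ hρ =>
    (contDiffAt_arcsin (by linarith [hρ.1]) hρ.2.ne).contDiffWithinAt) fun _ hρ => arcsin_mem_Ico hρ

lemma isSolOn_comp_arcsin (hn : (n : ℝ) = N - 1) (hd : d = N - 2 - 2 * alphaP p)
    (h : IsAngularSol n d (source (alphaP p * (alphaP p + 1)) p) c y z) :
    IsSolOn N p (fun ρ => y (arcsin ρ)) (Ioo 0 1) := by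
  intro ρ hρ
  have hder : ∀ ρ ∈ Ioo (0 : ℝ) 1, HasDerivAt (fun ρ => y (arcsin ρ))
      (z (arcsin ρ) * (1 / √(1 - ρ ^ 2))) ρ := fun ρ hρ =>
    (h.hasDerivWithinAt_comp_arcsin ⟨hρ.1.le, hρ.2⟩).hasDerivAt (Ici_mem_nhds hρ.1)
  have hpos : 0 < 1 - ρ ^ 2 := by nlinarith [hρ.1, hρ.2]
  have hC : 0 < √(1 - ρ ^ 2) := sqrt_pos.2 hpos
  have hsq : √(1 - ρ ^ 2) ^ 2 = 1 - ρ ^ 2 := sq_sqrt hpos.le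
  have hdd : HasDerivAt (deriv fun ρ => y (arcsin ρ))
      ((source (alphaP p * (alphaP p + 1)) p (y (arcsin ρ))
          - damping n d (arcsin ρ) * z (arcsin ρ)) * (1 / √(1 - ρ ^ 2)) * (1 / √(1 - ρ ^ 2))
        + z (arcsin ρ) * (ρ / √(1 - ρ ^ 2) ^ 3)) ρ := by
    have e1 := (h.hasDerivAt_snd _ (arcsin_mem_Ioo hρ)).comp ρ
      (hasDerivAt_arcsin (by linarith [hρ.1]) hρ.2.ne)
    have e2 : HasDerivAt (fun ρ : ℝ => 1 / √(1 - ρ ^ 2)) (ρ / √(1 - ρ ^ 2) ^ 3) ρ := by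
      refine ((hasDerivAt_const ρ (1 : ℝ)).div
        ((((hasDerivAt_id ρ).fun_pow 2).const_sub 1).sqrt hpos.ne') hC.ne').congr_deriv ?_
      simp
      field_simp
    refine (e1.mul e2).congr_of_eventuallyEq ?_
    filter_upwards [isOpen_Ioo.mem_nhds hρ] with x hx
    exact (hder x hx).deriv
  rw [hdd.deriv, (hder ρ hρ).deriv]
  have hρ0 := hρ.1
  simp only [source, damping, sin_arcsin (by linarith : -1 ≤ ρ) hρ.2.le, cos_arcsin, hn, hd]
  generalize |y (arcsin ρ)| ^ (p - 1) = q
  generalize y (arcsin ρ) = y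
  generalize z (arcsin ρ) = z
  generalize alphaP p = α
  generalize √(1 - ρ ^ 2) = C at *
  clear hdd hder
  field_simp
  grind

/-- Solutions with initial values in a bounded set depend on them in a Lipschitz way. -/
lemma exists_lipschitz_const (hd : 0 ≤ d) {κ : ℝ} (hκ : 0 ≤ κ) (hp : 1 < p) {C : ℝ}
    (hC : 0 ≤ C) :
    ∃ Λ, 0 ≤ Λ ∧ ∀ c c' : ℝ, |c| ≤ C → |c'| ≤ C → ∀ y z y' z' : ℝ → ℝ,
      IsAngularSol n d (source κ p) c y z → IsAngularSol n d (source κ p) c' y' z' →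
      ∀ θ ∈ Ico 0 (π / 2), |y θ - y' θ| ≤ Λ * |c - c'| ∧ |z θ - z' θ| ≤ Λ * |c - c'| := by
  obtain ⟨M, -, hM⟩ := exists_potential_barrier hκ hp hC
  obtain ⟨K, hK, hlip⟩ := exists_source_lipschitz κ hp M
  refine ⟨exp ((1 + K) * (π / 2)), (exp_pos _).le, fun c c' hc hc' y z y' z' h h' θ hθ => ?_⟩
  have hb := h.sq_add_sq_le h' hd hK hθ fun φ hφ =>
    hlip _ (abs_le.1 (h.abs_lt hd hp hc hM ⟨hφ.1.le, hφ.2.trans hθ.2⟩).le)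
      _ (abs_le.1 (h'.abs_lt hd hp hc' hM ⟨hφ.1.le, hφ.2.trans hθ.2⟩).le)
  set Λ := exp ((1 + K) * (π / 2)) with hΛ
  have h1 : exp ((1 + K) * θ) ≤ Λ :=
    exp_le_exp.2 (mul_le_mul_of_nonneg_left hθ.2.le (by linarith))
  have h2 : 1 ≤ Λ := one_le_exp (by positivity)
  have h3 : exp ((1 + K) * θ) * (c - c') ^ 2 ≤ (Λ * |c - c'|) ^ 2 := by
    rw [mul_pow, sq_abs]
    exact mul_le_mul_of_nonneg_right (by nlinarith) (sq_nonneg _)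
  have h4 : 0 ≤ Λ * |c - c'| := by positivity
  constructor
  · exact abs_le_of_sq_le_sq (by nlinarith [sq_nonneg (z θ - z' θ)]) h4
  · exact abs_le_of_sq_le_sq (by nlinarith [sq_nonneg (y θ - y' θ)]) h4

end IsAngularSol

end

lemma continuousOn_uncurry_of_lipschitz {F : ℝ → ℝ → ℝ} {s : Set ℝ}
    (hF : ∀ c, ContinuousOn (F c) s)
    (hlip : ∀ C, 0 ≤ C → ∃ Λ, 0 ≤ Λ ∧ ∀ c c' : ℝ, |c| ≤ C → |c'| ≤ C → ∀ x ∈ s,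
      |F c x - F c' x| ≤ Λ * |c - c'|) :
    ContinuousOn (fun q : ℝ × ℝ => F q.2 q.1) (s ×ˢ univ) := by
  rintro ⟨x₀, c₀⟩ ⟨hx₀, -⟩
  obtain ⟨Λ, hΛ, hl⟩ := hlip (|c₀| + 1) (by positivity)
  have hc₀ : |c₀| < |c₀| + 1 := by linarith
  have h1 : ContinuousOn (fun q : ℝ × ℝ => F q.1 q.2) (Icc (-(|c₀| + 1)) (|c₀| + 1) ×ˢ s) := by
    refine continuousOn_prod_of_continuousOn_lipschitzOnWith _ Λ.toNNReal (fun c _ => hF c)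
      fun x hx => LipschitzOnWith.of_dist_le_mul fun c hc c' hc' => ?_
    rw [dist_eq, dist_eq, coe_toNNReal _ hΛ]
    exact hl c c' (abs_le.2 hc) (abs_le.2 hc') x hx
  have h2 : ContinuousOn (fun q : ℝ × ℝ => F q.2 q.1) (s ×ˢ Icc (-(|c₀| + 1)) (|c₀| + 1)) :=
    h1.comp continuous_swap.continuousOn fun q hq => ⟨hq.2, hq.1⟩
  refine (h2 (x₀, c₀) ⟨hx₀, abs_le.1 hc₀.le⟩).mono_of_mem_nhdsWithin ?_
  rw [nhdsWithin_prod_eq, nhdsWithin_univ]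
  exact prod_mem_prod self_mem_nhdsWithin
    (Icc_mem_nhds (abs_lt.1 hc₀).1 (abs_lt.1 hc₀).2)

end RadialODE

theorem stmt3 (N : ℕ) (p : ℝ) (hN : 3 ≤ N) (hp : 1 + 4 / ((N : ℝ) - 2) < p) :
    ∃ u : ℝ → ℝ → ℝ,
      (∀ c : ℝ,
        ContDiffOn ℝ 2 (u c) (Ico 0 1) ∧
        IsSolOn N p (u c) (Ioo 0 1) ∧
        u c 0 = c ∧
        derivWithin (u c) (Ici 0) 0 = 0) ∧
      -- uniqueness
      (∀ c : ℝ, ∀ f : ℝ → ℝ,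
        ContDiffOn ℝ 2 f (Ico 0 1) → IsSolOn N p f (Ioo 0 1) →
        f 0 = c → derivWithin f (Ici 0) 0 = 0 →
        EqOn f (u c) (Ico 0 1)) ∧
      -- continuity of u and u' on [0,1) × ℝ
      ContinuousOn (fun q : ℝ × ℝ => u q.2 q.1) (Ico 0 1 ×ˢ univ) ∧
      ContinuousOn (fun q : ℝ × ℝ => derivWithin (u q.2) (Ici 0) q.1)
        (Ico 0 1 ×ˢ univ) ∧
      -- positivity
      (∀ c : ℝ, 0 < c → ∀ ρ ∈ Ico (0 : ℝ) 1, 0 < u c ρ) ∧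
      -- continuous extension to [0,1] × ℝ
      (∃ U : ℝ × ℝ → ℝ, ContinuousOn U (Icc 0 1 ×ˢ univ) ∧
        ∀ c : ℝ, ∀ ρ ∈ Ico (0 : ℝ) 1, U (ρ, c) = u c ρ) := by
  obtain ⟨n, hn⟩ : ∃ n : ℕ, (n : ℝ) = N - 1 :=
    ⟨N - 1, by rw [Nat.cast_sub (by omega), Nat.cast_one]⟩
  have hN' : (3 : ℝ) ≤ N := by exact_mod_cast hN
  have hN2 : 0 < (N : ℝ) - 2 := by linarith
  have h4 : 0 < 4 / ((N : ℝ) - 2) := by positivity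
  have hp1 : 1 < p := by linarith
  have hp0 : 0 < p - 1 := by linarith
  have hα : 0 < alphaP p := by unfold alphaP; positivity
  obtain ⟨d, hd⟩ : ∃ d : ℝ, d = N - 2 - 2 * alphaP p := ⟨_, rfl⟩
  have hd0 : 0 < d := by
    have h5 : 4 < (p - 1) * (N - 2) := (div_lt_iff₀ hN2).1 (by linarith)
    have h6 : 2 * alphaP p = 4 / (p - 1) := by unfold alphaP; ring
    have h7 : 4 / (p - 1) < N - 2 := (div_lt_iff₀ hp0).2 (by linarith)
    linarith
  have hpα : p = 1 + 2 / alphaP p := by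
    unfold alphaP
    field_simp
    ring
  have hκ : 0 ≤ alphaP p * (alphaP p + 1) := by positivity
  choose Y Z hsol hYc using fun c =>
    RadialODE.exists_isAngularSol_source (n := n) hd0 hκ hp1 c
  have hg := RadialODE.continuous_source (alphaP p * (alphaP p + 1)) hp1
  have hpi : (0 : ℝ) < Real.pi / 2 := by positivity
  have hlip : ∀ C, 0 ≤ C → ∃ Λ, 0 ≤ Λ ∧ ∀ c c' : ℝ, |c| ≤ C → |c'| ≤ C →
      ∀ θ ∈ Ico 0 (Real.pi / 2),
        |Y c θ - Y c' θ| ≤ Λ * |c - c'| ∧ |Z c θ - Z c' θ| ≤ Λ * |c - c'| := by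
    intro C hC
    obtain ⟨Λ, hΛ, h⟩ :=
      RadialODE.IsAngularSol.exists_lipschitz_const (n := n) hd0.le hκ hp1 hC
    exact ⟨Λ, hΛ, fun c c' hc hc' => h c c' hc hc' _ _ _ _ (hsol c) (hsol c')⟩
  have hY : ContinuousOn (fun q : ℝ × ℝ => Y q.2 q.1) (Icc 0 (Real.pi / 2) ×ˢ univ) := by
    refine RadialODE.continuousOn_uncurry_of_lipschitz hYc fun C hC => ?_
    obtain ⟨Λ, hΛ, h⟩ := hlip C hC
    refine ⟨Λ, hΛ, fun c c' hc hc' θ hθ => ?_⟩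
    have hcl := closure_Ico hpi.ne
    exact le_on_closure (s := Ico 0 (Real.pi / 2)) (f := fun θ => |Y c θ - Y c' θ|)
      (fun x hx => (h c c' hc hc' x hx).1)
      (by rw [hcl]; exact ((hYc c).sub (hYc c')).abs) continuousOn_const (by rwa [hcl])
  have hZ : ContinuousOn (fun q : ℝ × ℝ => Z q.2 q.1) (Ico 0 (Real.pi / 2) ×ˢ univ) := by
    refine RadialODE.continuousOn_uncurry_of_lipschitz (fun c => (hsol c).continuousOn_snd)
      fun C hC => ?_
    obtain ⟨Λ, hΛ, h⟩ := hlip C hC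
    exact ⟨Λ, hΛ, fun c c' hc hc' θ hθ => (h c c' hc hc' θ hθ).2⟩
  have harc : Continuous fun q : ℝ × ℝ => (Real.arcsin q.1, q.2) :=
    (Real.continuous_arcsin.comp continuous_fst).prodMk continuous_snd
  have hU : ContinuousOn (fun q : ℝ × ℝ => Y q.2 (Real.arcsin q.1)) (Icc 0 1 ×ˢ univ) :=
    hY.comp harc.continuousOn fun q hq =>
      ⟨⟨Real.arcsin_nonneg.2 hq.1.1, Real.arcsin_le_pi_div_two _⟩, trivial⟩
  refine ⟨fun c ρ => Y c (Real.arcsin ρ), fun c => ⟨(hsol c).contDiffOn_comp_arcsin hg,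
    (hsol c).isSolOn_comp_arcsin hn hd, by simp [(hsol c).fst_zero], ?_⟩, ?_, ?_, ?_, ?_,
    _, hU, fun _ _ _ => rfl⟩
  · rw [(hsol c).derivWithin_comp_arcsin ⟨le_rfl, zero_lt_one⟩]
    simp [(hsol c).snd_zero]
  · intro c f hf hfs hf0 hf1 ρ hρ
    have hang := RadialODE.isAngularSol_of_isSolOn hn hd hf hfs hf0 hf1
    obtain ⟨Λ, -, h⟩ := RadialODE.IsAngularSol.exists_lipschitz_const (n := n) hd0.le hκ hp1
      (abs_nonneg c)
    have := (h c c le_rfl le_rfl _ _ _ _ hang (hsol c) _ (RadialODE.arcsin_mem_Ico hρ)).1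
    rw [Real.sin_arcsin (by linarith [hρ.1]) hρ.2.le, sub_self, abs_zero, mul_zero] at this
    exact sub_eq_zero.1 (abs_nonpos_iff.1 this)
  · exact hU.mono (prod_mono Ico_subset_Icc_self subset_rfl)
  · have h1 : ContinuousOn (fun q : ℝ × ℝ => Z q.2 (Real.arcsin q.1) * (1 / √(1 - q.1 ^ 2)))
        (Ico 0 1 ×ˢ univ) := by
      refine ContinuousOn.mul (hZ.comp harc.continuousOn fun q hq =>
        ⟨RadialODE.arcsin_mem_Ico hq.1, trivial⟩) ?_
      refine continuousOn_const.div (by fun_prop) fun q hq => ?_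
      have : 0 < 1 - q.1 ^ 2 := by nlinarith [hq.1.1, hq.1.2]
      exact (Real.sqrt_pos.2 this).ne'
    exact h1.congr fun q hq => (hsol q.2).derivWithin_comp_arcsin hq.1
  · intro c hc ρ hρ
    exact (hsol c).pos hα hd0 (by rw [hn, hd]; ring) hpα hc (RadialODE.arcsin_mem_Ico hρ)
end

section
/- Assume N ≥ 3 and p > 1 + 4/(N−2). Let 0 < σ₀ < σ₁ < 1. Then sup_{σ₀ ≤ ρ ≤ 1} |v(ρ,c) − 1| → 0 and sup_{σ₀ < ρ ≤ σ₁} |∂_ρ v(ρ,c)| → 0 as c → +∞. In particular, u(1,c) → b_∞ as c → +∞. -/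
open Set Filter

/-- The potential of the conservative part of the equation satisfied by `u / u_∞`. -/
noncomputable def potential (p x : ℝ) : ℝ := |x| ^ (p + 1) / (p + 1) - x ^ 2 / 2

theorem hasDerivAt_potential {p : ℝ} (hp : 1 < p) (x : ℝ) :
    HasDerivAt (potential p) (|x| ^ (p - 1) * x - x) x := by
  have h := ((hasDerivAt_abs_rpow x (p := p + 1) (by linarith)).div_const (p + 1)).sub
    ((hasDerivAt_pow 2 x).div_const 2)
  refine h.congr_deriv ?_
  have : p + 1 ≠ 0 := by linarith
  rw [show p + 1 - 2 = p - 1 by ring]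
  push_cast
  field_simp

theorem continuous_potential {p : ℝ} (hp : 1 < p) : Continuous (potential p) :=
  continuous_iff_continuousAt.2 fun x => (hasDerivAt_potential hp x).continuousAt

theorem potential_one_lt {p x : ℝ} (hp : 1 < p) (hx : 0 ≤ x) (hx1 : x ≠ 1) :
    potential p 1 < potential p x := by
  have h := one_add_mul_self_lt_rpow_one_add (s := x ^ 2 - 1) (by nlinarith)
    (fun h => hx1 (by nlinarith)) (p := (p + 1) / 2) (by linarith)
  have e : (1 + (x ^ 2 - 1)) ^ ((p + 1) / 2) = x ^ (p + 1) := by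
    rw [show 1 + (x ^ 2 - 1) = x ^ (2 : ℝ) by norm_num, ← Real.rpow_mul hx]
    congr 1; ring
  rw [e] at h
  unfold potential
  rw [abs_one, abs_of_nonneg hx, Real.one_rpow]
  have hp' : 0 < p + 1 := by linarith
  have : (1 + (p + 1) / 2 * (x ^ 2 - 1)) / (p + 1) < x ^ (p + 1) / (p + 1) := by gcongr
  have e2 : (1 + (p + 1) / 2 * (x ^ 2 - 1)) / (p + 1) = 1 / (p + 1) + (x ^ 2 - 1) / 2 := by
    field_simp
  linarith

theorem potential_eq {p x : ℝ} (hx : 0 < x) :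
    potential p x = x ^ 2 * (x ^ (p - 1) / (p + 1) - 1 / 2) := by
  unfold potential
  rw [abs_of_pos hx, show p + 1 = (p - 1) + 2 by ring, Real.rpow_add hx]
  norm_num
  ring

theorem neg_half_sq_le_potential {p : ℝ} (hp : 1 < p) (x : ℝ) : -(x ^ 2 / 2) ≤ potential p x := by
  unfold potential
  have : 0 ≤ |x| ^ (p + 1) / (p + 1) := by have := abs_nonneg x; positivity
  linarith

theorem potential_one_neg {p : ℝ} (hp : 1 < p) : potential p 1 < 0 := by
  rw [potential_eq one_pos, Real.one_rpow]
  have : 1 / (p + 1) < 1 / 2 := by gcongr; linarith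
  linarith

theorem rpow_sub_one_le_of_potential_nonpos {p x : ℝ} (hp : 1 < p) (hx : 0 < x)
    (h : potential p x ≤ 0) : x ^ (p - 1) ≤ (p + 1) / 2 := by
  rw [potential_eq hx] at h
  have h1 : x ^ (p - 1) / (p + 1) - 1 / 2 ≤ 0 := by
    by_contra! h2
    have : 0 < x ^ 2 := by positivity
    nlinarith
  have h3 : x ^ (p - 1) / (p + 1) ≤ 1 / 2 := by linarith
  rw [div_le_iff₀ (by linarith)] at h3
  linarith

theorem le_of_potential_nonpos {p x : ℝ} (hp : 1 < p) (hx : 0 < x) (h : potential p x ≤ 0) :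
    x ≤ ((p + 1) / 2) ^ (1 / (p - 1)) := by
  have h1 := rpow_sub_one_le_of_potential_nonpos hp hx h
  have hp' : 0 < p - 1 := by linarith
  calc x = (x ^ (p - 1)) ^ (1 / (p - 1)) := by
        rw [← Real.rpow_mul hx.le, mul_one_div_cancel hp'.ne', Real.rpow_one]
    _ ≤ _ := by gcongr

/-- The minimum `1` of the potential on the half line is stable. -/
theorem exists_potential_lt_imp_abs_sub_one_lt {p ε : ℝ} (hp : 1 < p) (hε : 0 < ε) :
    ∃ δ > 0, ∀ x > 0, potential p x < potential p 1 + δ → |x - 1| < ε := by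
  set M := ((p + 1) / 2) ^ (1 / (p - 1))
  have hc : IsCompact (Icc 0 M ∩ {x | ε ≤ |x - 1|}) :=
    isCompact_Icc.inter_right (isClosed_le continuous_const (by fun_prop))
  obtain ⟨a, ha, hmin⟩ := hc.exists_forall_le' (continuous_potential hp).continuousOn
    (a := potential p 1) (fun x hx => potential_one_lt hp hx.1.1 (by
      rintro rfl
      have := hx.2
      simp at this
      linarith))
  have h1 := potential_one_neg hp
  refine ⟨min (a - potential p 1) (-potential p 1), by
    apply lt_min <;> linarith, fun x hx hlt => ?_⟩
  by_contra! hge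
  have h2 := min_le_left (a - potential p 1) (-potential p 1)
  have h3 := min_le_right (a - potential p 1) (-potential p 1)
  have := hmin x ⟨⟨hx.le, le_of_potential_nonpos hp hx (by linarith)⟩, hge⟩
  linarith

/-- A point away from `0` that is nearly critical for the potential nearly minimizes it. -/
theorem exists_sq_lt_imp_potential_lt {p η ε : ℝ} (hp : 1 < p) (hη : 0 < η) (hε : 0 < ε) :
    ∃ δ > 0, ∀ x > 0, potential p x ≤ -η → (x ^ p - x) ^ 2 < δ →
      potential p x < potential p 1 + ε := by
  set M := ((p + 1) / 2) ^ (1 / (p - 1))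
  have hcont := continuous_potential hp
  have hc : IsCompact (Icc 0 M ∩ {x | potential p x ≤ -η ∧ potential p 1 + ε ≤ potential p x}) :=
    isCompact_Icc.inter_right ((isClosed_le hcont continuous_const).inter
      (isClosed_le continuous_const hcont))
  have hg : ContinuousOn (fun x : ℝ => (x ^ p - x) ^ 2)
      (Icc 0 M ∩ {x | potential p x ≤ -η ∧ potential p 1 + ε ≤ potential p x}) :=
    (((Real.continuous_rpow_const (by linarith)).sub continuous_id).pow 2).continuousOn
  obtain ⟨a, ha, hmin⟩ := hc.exists_forall_le' hg (a := 0) (by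
    rintro x ⟨⟨hx0, -⟩, hx1, hx2⟩
    have hx0' : 0 < x := by
      rcases hx0.eq_or_lt with h | h
      · have := neg_half_sq_le_potential hp x
        rw [← h] at this hx1
        norm_num at this
        linarith
      · exact h
    apply sq_pos_of_ne_zero
    intro h
    have e : x ^ p = x ^ (p - 1) * x := by
      rw [← Real.rpow_add_one hx0'.ne']; congr 1; ring
    have h3 : x ^ (p - 1) = 1 := by
      have : (x ^ (p - 1) - 1) * x = 0 := by rw [← h, e]; ring
      rcases mul_eq_zero.1 this with h | h
      · linarith
      · exact absurd h hx0'.ne'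
    rcases lt_trichotomy x 1 with hlt | heq | hgt
    · have := Real.rpow_lt_one hx0 hlt (z := p - 1) (by linarith)
      linarith
    · rw [heq] at hx2
      linarith
    · have := Real.one_lt_rpow hgt (z := p - 1) (by linarith)
      linarith)
  refine ⟨a, ha, fun x hx hx1 hlt => ?_⟩
  by_contra! hge
  have := hmin x ⟨⟨hx.le, le_of_potential_nonpos hp hx (by linarith)⟩, hx1, hge⟩
  linarith

/-- The equation `(1-ρ²)D²v + (m-ρ²)Dv + K(|v|^{p-1}v - v) = 0` with `D = ρ d/dρ`, written in the
logarithmic variable `t = log ρ` as a first order system on `[t₀, 0)`. -/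
structure IsLogOrbit (p m K : ℝ) (V W : ℝ → ℝ) (t₀ : ℝ) : Prop where
  hasDerivAt : ∀ t ∈ Ico t₀ 0, HasDerivAt V (W t) t
  exists_hasDerivAt : ∀ t ∈ Ico t₀ 0, ∃ A, HasDerivAt W A t ∧
    (1 - Real.exp (2 * t)) * A + (m - Real.exp (2 * t)) * W t
      + K * (|V t| ^ (p - 1) * V t - V t) = 0

/-- The energy of the logarithmic system; its time derivative is `-m W²`. -/
noncomputable def logEnergy (p K : ℝ) (V W : ℝ → ℝ) (t : ℝ) : ℝ :=
  (1 - Real.exp (2 * t)) * W t ^ 2 / 2 + K * potential p (V t)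

theorem hasDerivAt_one_sub_exp (t : ℝ) :
    HasDerivAt (fun t => 1 - Real.exp (2 * t)) (-(2 * Real.exp (2 * t))) t := by
  have h := ((hasDerivAt_id t).const_mul 2).exp.const_sub 1
  refine h.congr_deriv ?_
  simp; ring

theorem exp_two_mul_lt_one {t : ℝ} (ht : t < 0) : Real.exp (2 * t) < 1 := by
  rw [Real.exp_lt_one_iff]; linarith

namespace IsLogOrbit

variable {p m K t₀ : ℝ} {V W : ℝ → ℝ}

theorem hasDerivAt_logEnergy (hp : 1 < p) (h : IsLogOrbit p m K V W t₀) {t : ℝ}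
    (ht : t ∈ Ico t₀ 0) : HasDerivAt (logEnergy p K V W) (-(m * W t ^ 2)) t := by
  obtain ⟨A, hA, hode⟩ := h.exists_hasDerivAt t ht
  have h1 := (((hasDerivAt_one_sub_exp t).mul (hA.pow 2)).div_const 2).add
    (((hasDerivAt_potential hp (V t)).comp t (h.hasDerivAt t ht)).const_mul K)
  refine h1.congr_deriv ?_
  simp
  linear_combination W t * hode

theorem antitoneOn_logEnergy (hp : 1 < p) (hm : 0 < m) (h : IsLogOrbit p m K V W t₀) :
    AntitoneOn (logEnergy p K V W) (Ico t₀ 0) := by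
  refine antitoneOn_of_hasDerivWithinAt_nonpos (f' := fun t => -(m * W t ^ 2)) (convex_Ico _ _)
    (fun t ht => (h.hasDerivAt_logEnergy hp ht).continuousAt.continuousWithinAt)
    (fun t ht => (h.hasDerivAt_logEnergy hp (interior_subset ht)).hasDerivWithinAt)
    (fun t _ => ?_)
  have : 0 ≤ m * W t ^ 2 := by positivity
  linarith

theorem logEnergy_le (hp : 1 < p) (hm : 0 < m) (h : IsLogOrbit p m K V W t₀) {s t : ℝ}
    (hs : t₀ ≤ s) (hst : s ≤ t) (ht : t < 0) : logEnergy p K V W t ≤ logEnergy p K V W s :=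
  h.antitoneOn_logEnergy hp hm ⟨hs, hst.trans_lt ht⟩ ⟨hs.trans hst, ht⟩ hst

end IsLogOrbit

theorem kinetic_nonneg {W : ℝ → ℝ} {t : ℝ} (ht : t < 0) :
    0 ≤ (1 - Real.exp (2 * t)) * W t ^ 2 / 2 := by
  have := exp_two_mul_lt_one ht
  have : 0 < 1 - Real.exp (2 * t) := by linarith
  positivity

namespace IsLogOrbit

variable {p m K t₀ : ℝ} {V W : ℝ → ℝ}

theorem mul_potential_le_neg {η : ℝ} (hp : 1 < p) (hm : 0 < m) (h : IsLogOrbit p m K V W t₀)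
    (hE : logEnergy p K V W t₀ ≤ -η) {t : ℝ} (ht : t ∈ Ico t₀ 0) :
    K * potential p (V t) ≤ -η := by
  have h1 := h.logEnergy_le hp hm le_rfl ht.1 ht.2
  have h2 := kinetic_nonneg (W := W) ht.2
  unfold logEnergy at h1 hE
  linarith

theorem pos {η : ℝ} (hp : 1 < p) (hm : 0 < m) (hη : 0 < η)
    (h : IsLogOrbit p m K V W t₀) (hE : logEnergy p K V W t₀ ≤ -η) (hV : 0 < V t₀)
    {t : ℝ} (ht : t ∈ Ico t₀ 0) : 0 < V t := by
  by_contra! hle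
  have hc : ContinuousOn V (Icc t₀ t) := fun s hs =>
    (h.hasDerivAt s ⟨hs.1, hs.2.trans_lt ht.2⟩).continuousAt.continuousWithinAt
  obtain ⟨s, hs, hs0⟩ := intermediate_value_Icc' ht.1 hc ⟨hle, hV.le⟩
  have h1 := h.mul_potential_le_neg hp hm hE ⟨hs.1, hs.2.trans_lt ht.2⟩
  rw [hs0] at h1
  have h2 : potential p 0 = 0 := by
    unfold potential
    rw [abs_zero, Real.zero_rpow (by linarith)]
    norm_num
  rw [h2] at h1
  linarith

/-- The time derivative of the cross term `(1-e^{2t})W(V^p-V)`. -/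
theorem hasDerivAt_cross (h : IsLogOrbit p m K V W t₀) {t : ℝ} (ht : t ∈ Ico t₀ 0)
    (hV : 0 < V t) :
    HasDerivAt (fun t => (1 - Real.exp (2 * t)) * W t * (V t ^ p - V t))
      (-((m + Real.exp (2 * t)) * W t * (V t ^ p - V t)) - K * (V t ^ p - V t) ^ 2
        + (1 - Real.exp (2 * t)) * W t ^ 2 * (p * V t ^ (p - 1) - 1)) t := by
  obtain ⟨A, hA, hode⟩ := h.exists_hasDerivAt t ht
  have hd := h.hasDerivAt t ht
  have h1 := ((hasDerivAt_one_sub_exp t).mul hA).mul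
    ((hd.rpow_const (p := p) (Or.inl hV.ne')).sub hd)
  refine h1.congr_deriv ?_
  have e : V t ^ p = V t ^ (p - 1) * V t := by
    rw [← Real.rpow_add_one hV.ne']; congr 1; ring
  rw [abs_of_pos hV] at hode
  simp only [Pi.mul_apply, Pi.sub_apply, e]
  linear_combination (V t ^ (p - 1) * V t - V t) * hode

end IsLogOrbit

theorem abs_lyapunov_le {p K B t : ℝ} {V W : ℝ → ℝ} (hp : 1 < p) (hK : 0 < K) (hB : 0 < B)
    (ht : t < 0) (hv : 0 < V t) (hE : logEnergy p K V W t ≤ 0) :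
    |(1 - Real.exp (2 * t)) * W t * (V t ^ p - V t) + B * logEnergy p K V W t|
      ≤ (K * (((p + 1) / 2) ^ (1 / (p - 1))) ^ 2
          + (((p + 1) / 2) ^ (1 / (p - 1)) * ((p + 1) / 2 + 1)) ^ 2) / 2
        + B * (K * (((p + 1) / 2) ^ (1 / (p - 1))) ^ 2 / 2) := by
  set M := ((p + 1) / 2) ^ (1 / (p - 1)) with hM
  set H := (M * ((p + 1) / 2 + 1)) ^ 2 with hH
  have hM0 : 0 < M := by positivity
  have hkin := kinetic_nonneg (W := W) ht
  have hpot : potential p (V t) ≤ 0 := by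
    unfold logEnergy at hE
    by_contra! hc
    have := mul_pos hK hc
    linarith
  have hsubpow := rpow_sub_one_le_of_potential_nonpos hp hv hpot
  have hVM := le_of_potential_nonpos hp hv hpot
  have hsq : V t ^ 2 ≤ M ^ 2 := by gcongr
  have hKsq : K * V t ^ 2 ≤ K * M ^ 2 := by gcongr
  have hF : -(K * M ^ 2 / 2) ≤ K * potential p (V t) := by
    have := mul_le_mul_of_nonneg_left (neg_half_sq_le_potential hp (V t)) hK.le
    linarith
  have hE' : -(K * M ^ 2 / 2) ≤ logEnergy p K V W t := by
    unfold logEnergy; linarith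
  have hWt : (1 - Real.exp (2 * t)) * W t ^ 2 ≤ K * M ^ 2 := by
    unfold logEnergy at hE; linarith
  have hht : (V t ^ p - V t) ^ 2 ≤ H := by
    have e : V t ^ p - V t = V t * (V t ^ (p - 1) - 1) := by
      have : V t ^ p = V t ^ (p - 1) * V t := by
        rw [← Real.rpow_add_one hv.ne']; congr 1; ring
      rw [this]; ring
    rw [e, hH, ← sq_abs, abs_mul, abs_of_pos hv]
    have h1 : |V t ^ (p - 1) - 1| ≤ (p + 1) / 2 + 1 := by
      have := Real.rpow_pos_of_pos hv (p - 1)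
      rw [abs_le]; constructor <;> linarith
    gcongr
  have ha := exp_two_mul_lt_one ht
  have ha' := Real.exp_pos (2 * t)
  have hcross : |(1 - Real.exp (2 * t)) * W t * (V t ^ p - V t)| ≤ (K * M ^ 2 + H) / 2 := by
    have q1 := mul_nonneg (sub_nonneg.2 ha.le) (sq_nonneg (W t + (V t ^ p - V t)))
    have q2 := mul_nonneg (sub_nonneg.2 ha.le) (sq_nonneg (W t - (V t ^ p - V t)))
    have q3 := mul_nonneg ha'.le (sq_nonneg (V t ^ p - V t))
    rw [abs_le]; constructor <;> linarith
  have hen : |B * logEnergy p K V W t| ≤ B * (K * M ^ 2 / 2) := by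
    rw [abs_mul, abs_of_pos hB]
    refine mul_le_mul_of_nonneg_left (abs_le.2 ⟨hE', ?_⟩) hB.le
    have : 0 ≤ K * M ^ 2 / 2 := by positivity
    linarith
  exact (abs_add_le _ _).trans (add_le_add hcross hen)

theorem dissipation_le {p m K a y W x : ℝ} (hp : 1 < p) (hm : 0 < m) (hK : 0 < K) (ha : 0 ≤ a)
    (ha1 : a ≤ 1) (hy : y ≤ (p + 1) / 2) :
    -((m + a) * W * x) - K * x ^ 2 + (1 - a) * W ^ 2 * (p * y - 1)
      ≤ ((m + 1) ^ 2 / (2 * K) + p * ((p + 1) / 2)) * W ^ 2 - K * x ^ 2 / 2 := by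
  have b1 : (1 - a) * W ^ 2 * (p * y - 1) ≤ p * ((p + 1) / 2) * W ^ 2 := by
    have h1 : p * y - 1 ≤ p * ((p + 1) / 2) := by
      have := mul_le_mul_of_nonneg_left hy (by linarith : 0 ≤ p)
      linarith
    have h2 : 0 ≤ (1 - a) * W ^ 2 := mul_nonneg (by linarith) (sq_nonneg _)
    have h3 : (1 - a) * W ^ 2 ≤ W ^ 2 := by nlinarith [sq_nonneg W]
    have h4 : 0 ≤ p * ((p + 1) / 2) := by positivity
    calc _ ≤ (1 - a) * W ^ 2 * (p * ((p + 1) / 2)) := mul_le_mul_of_nonneg_left h1 h2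
      _ ≤ W ^ 2 * (p * ((p + 1) / 2)) := mul_le_mul_of_nonneg_right h3 h4
      _ = _ := by ring
  have b2 : -((m + a) * W * x) ≤ (m + 1) ^ 2 / (2 * K) * W ^ 2 + K * x ^ 2 / 2 := by
    have h1 : (m + a) ^ 2 / (2 * K) * W ^ 2 ≤ (m + 1) ^ 2 / (2 * K) * W ^ 2 := by gcongr
    have h2 : 0 ≤ ((m + a) * W + K * x) ^ 2 / (2 * K) := by positivity
    have h3 : ((m + a) * W + K * x) ^ 2 / (2 * K)
        = (m + a) ^ 2 / (2 * K) * W ^ 2 + (m + a) * W * x + K * x ^ 2 / 2 := by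
      field_simp; ring
    linarith
  linarith

/-- An orbit with energy at most `-η` comes close to the minimal energy within a time that depends
only on the parameters. -/
theorem exists_forall_logEnergy_le {p m K η ε : ℝ} (hp : 1 < p) (hm : 0 < m) (hK : 0 < K)
    (hη : 0 < η) (hε : 0 < ε) :
    ∃ L > 0, ∀ (t₀ : ℝ) (V W : ℝ → ℝ), t₀ + L < 0 → IsLogOrbit p m K V W t₀ → 0 < V t₀ →
      logEnergy p K V W t₀ ≤ -η →
      ∀ t ∈ Ico (t₀ + L) 0, logEnergy p K V W t ≤ K * potential p 1 + ε := by
  obtain ⟨δ, hδ, hstab⟩ := exists_sq_lt_imp_potential_lt (p := p) (η := η / K) (ε := ε / (2 * K))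
    hp (by positivity) (by positivity)
  set M := ((p + 1) / 2) ^ (1 / (p - 1)) with hM
  set C := (m + 1) ^ 2 / (2 * K) + p * ((p + 1) / 2) with hC
  set H := (M * ((p + 1) / 2 + 1)) ^ 2 with hH
  set R := (K * M ^ 2 + H) / 2 + (C + 1) / m * (K * M ^ 2 / 2) with hR
  set κ := min (K * δ / 2) ε with hκ
  have hκ0 : 0 < κ := by positivity
  have hM0 : 0 < M := by positivity
  have hC0 : 0 < C := by positivity
  have hH0 : 0 ≤ H := by positivity
  have hR0 : 0 < R := by positivity
  refine ⟨(2 * R + 1) / κ, by positivity, fun t₀ V W hL h hV hE t ht => ?_⟩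
  set L := (2 * R + 1) / κ with hL'
  have hL0 : 0 < L := by positivity
  have hsub : ∀ {s}, s ∈ Icc t₀ (t₀ + L) → s ∈ Ico t₀ 0 := fun hs => ⟨hs.1, by linarith [hs.2]⟩
  have hpos : ∀ {s}, s ∈ Ico t₀ 0 → 0 < V s := fun hs => h.pos hp hm hη hE hV hs
  have hpot : ∀ {s}, s ∈ Ico t₀ 0 → potential p (V s) ≤ -(η / K) := fun hs => by
    have := h.mul_potential_le_neg hp hm hE hs
    rw [← neg_div, le_div_iff₀ hK]
    linarith
  have hηK : 0 < η / K := by positivity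
  suffices hs : ∃ s ∈ Icc t₀ (t₀ + L),
      W s ^ 2 + K * (V s ^ p - V s) ^ 2 / 2 < κ by
    obtain ⟨s, hs, hlt⟩ := hs
    have h1 := h.logEnergy_le hp hm hs.1 (hs.2.trans ht.1) ht.2
    have hk1 : κ ≤ K * δ / 2 := min_le_left _ _
    have hk2 : κ ≤ ε := min_le_right _ _
    have h2 := hstab (V s) (hpos (hsub hs)) (hpot (hsub hs)) (by
      have : K * (V s ^ p - V s) ^ 2 < K * δ := by linarith [sq_nonneg (W s)]
      exact lt_of_mul_lt_mul_left this hK.le)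
    have h3 : K * potential p (V s) ≤ K * potential p 1 + ε / 2 := by
      have := mul_le_mul_of_nonneg_left h2.le hK.le
      have e : K * (ε / (2 * K)) = ε / 2 := by field_simp
      linarith
    have h4 : (1 - Real.exp (2 * s)) * W s ^ 2 / 2 ≤ ε / 2 := by
      have h5 := mul_nonneg hK.le (sq_nonneg (V s ^ p - V s))
      have h6 := mul_nonneg (Real.exp_pos (2 * s)).le (sq_nonneg (W s))
      linarith
    unfold logEnergy at h1 ⊢
    linarith
  by_contra! hcon
  set Ψ : ℝ → ℝ := fun s => (1 - Real.exp (2 * s)) * W s * (V s ^ p - V s)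
    + (C + 1) / m * logEnergy p K V W s with hΨ
  have hsubpow : ∀ {s}, s ∈ Ico t₀ 0 → V s ^ (p - 1) ≤ (p + 1) / 2 := fun hs =>
    rpow_sub_one_le_of_potential_nonpos hp (hpos hs) (by linarith [hpot hs])
  have hbound : ∀ {s}, s ∈ Ico t₀ 0 → |Ψ s| ≤ R := by
    intro s hs
    exact abs_lyapunov_le hp hK (by positivity) hs.2 (hpos hs)
      ((h.logEnergy_le hp hm le_rfl hs.1 hs.2).trans (by linarith))
  have hder : ∀ s ∈ Icc t₀ (t₀ + L), ∃ D, HasDerivAt (fun s => Ψ s + κ * s) D s ∧ D ≤ 0 := by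
    intro s hs
    have hs' := hsub hs
    have hd := ((h.hasDerivAt_cross hs' (hpos hs')).add
      ((h.hasDerivAt_logEnergy hp hs').const_mul ((C + 1) / m))).add
      ((hasDerivAt_id s).const_mul κ)
    refine ⟨_, hd, ?_⟩
    have hk := hcon s hs
    have ha := exp_two_mul_lt_one hs'.2
    have ha' := Real.exp_pos (2 * s)
    have e : (C + 1) / m * -(m * W s ^ 2) = -((C + 1) * W s ^ 2) := by field_simp
    rw [e]
    have := dissipation_le hp hm hK ha'.le ha.le (hsubpow hs') (W := W s)
      (x := V s ^ p - V s)
    rw [← hC] at this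
    linarith
  choose! D hD hD0 using hder
  have hanti : AntitoneOn (fun s => Ψ s + κ * s) (Icc t₀ (t₀ + L)) :=
    antitoneOn_of_hasDerivWithinAt_nonpos (convex_Icc _ _)
      (fun s hs => (hD s hs).continuousAt.continuousWithinAt)
      (fun s hs => (hD s (interior_subset hs)).hasDerivWithinAt)
      (fun s hs => hD0 s (interior_subset hs))
  have hfin := hanti (left_mem_Icc.2 (by linarith)) (right_mem_Icc.2 (by linarith))
    (by linarith : t₀ ≤ t₀ + L)
  have e1 := abs_le.1 (hbound (hsub (left_mem_Icc.2 (by linarith : t₀ ≤ t₀ + L))))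
  have e2 := abs_le.1 (hbound (hsub (right_mem_Icc.2 (by linarith : t₀ ≤ t₀ + L))))
  have e3 : κ * L = 2 * R + 1 := by rw [hL']; field_simp
  simp only at hfin
  linarith

section Profile

variable {N : ℕ} {p : ℝ} {u : ℝ → ℝ}

theorem hasDerivAt_of_contDiffOn (hu : ContDiffOn ℝ 2 u (Ico 0 1)) {ρ : ℝ} (hρ : ρ ∈ Ioo 0 1) :
    HasDerivAt u (deriv u ρ) ρ ∧ HasDerivAt (deriv u) (deriv (deriv u) ρ) ρ := by
  have h : ContDiffAt ℝ 2 u ρ := hu.contDiffAt (Ico_mem_nhds hρ.1 hρ.2)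
  have h1 : ContDiffAt ℝ 1 (deriv u) ρ := h.derivWithin (by norm_num)
  exact ⟨(h.differentiableAt (by norm_num)).hasDerivAt,
    (h1.differentiableAt (by norm_num)).hasDerivAt⟩

theorem exists_neg_le_rpow_sub_sq {A : ℝ} (hp : 1 < p) (hA : 0 < A) :
    ∃ C ≥ 0, ∀ x : ℝ, -C ≤ |x| ^ (p + 1) / (p + 1) - A * x ^ 2 / 2 := by
  have hp' : 0 < p - 1 := by linarith
  set R := (A * (p + 1) / 2) ^ (1 / (p - 1)) with hR
  refine ⟨A * R ^ 2 / 2, by positivity, fun x => ?_⟩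
  have h0 := abs_nonneg x
  rcases le_total |x| R with h | h
  · have h1 : x ^ 2 ≤ R ^ 2 := by rw [← sq_abs x]; gcongr
    have h2 : 0 ≤ |x| ^ (p + 1) / (p + 1) := by positivity
    have := mul_le_mul_of_nonneg_left h1 hA.le
    linarith
  · have hR0 : 0 < R := by positivity
    have hx : 0 < |x| := hR0.trans_le h
    have h1 : A * (p + 1) / 2 ≤ |x| ^ (p - 1) := by
      calc A * (p + 1) / 2 = R ^ (p - 1) := by
            rw [hR, ← Real.rpow_mul (by positivity), one_div_mul_cancel hp'.ne', Real.rpow_one]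
        _ ≤ _ := by gcongr
    have e : |x| ^ (p + 1) = |x| ^ (p - 1) * x ^ 2 := by
      rw [show p + 1 = (p - 1) + 2 by ring, Real.rpow_add hx]
      norm_num
    have h2 : A * x ^ 2 / 2 ≤ |x| ^ (p + 1) / (p + 1) := by
      rw [e, div_le_div_iff₀ (by norm_num) (by linarith)]
      nlinarith [mul_le_mul_of_nonneg_right h1 (sq_nonneg x)]
    have : 0 ≤ A * R ^ 2 / 2 := by positivity
    linarith

/-- Up to `ρ = 1/2` the slope of a solution with `u 0 = c` is at most of order `c^{(p+1)/2}`. -/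
theorem exists_forall_deriv_le (hp : 1 < p) (hα : 2 * alphaP p < N - 2) :
    ∃ B > 0, ∀ (u : ℝ → ℝ), ∀ c ≥ 1, ContDiffOn ℝ 2 u (Ico 0 1) → IsSolOn N p u (Ioo 0 1) →
      u 0 = c → derivWithin u (Ici 0) 0 = 0 → ∀ ρ ∈ Ioc (0 : ℝ) (1 / 2),
        |deriv u ρ| ≤ B * c ^ ((p + 1) / 2) ∧ |u ρ - c| ≤ B * c ^ ((p + 1) / 2) * ρ := by
  have hα0 : 0 < alphaP p := div_pos two_pos (by linarith)
  set α := alphaP p with hαdef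
  obtain ⟨C, hC, hlow⟩ := exists_neg_le_rpow_sub_sq (A := α * (α + 1)) hp (by positivity)
  set B := Real.sqrt (8 / 3 * (1 / (p + 1) + C)) with hB
  have hB2 : B ^ 2 = 8 / 3 * (1 / (p + 1) + C) := Real.sq_sqrt (by positivity)
  refine ⟨B, by positivity, fun u c hc hu hsol h0 hd0 => ?_⟩
  set u₁ := derivWithin u (Ico 0 1) with hu₁
  have hcont : ContinuousOn u₁ (Ico 0 1) :=
    hu.continuousOn_derivWithin (uniqueDiffOn_Ico 0 1) (by norm_num)
  have hu₁0 : u₁ 0 = 0 := by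
    rw [hu₁, ← Ici_inter_Iio, derivWithin_inter (Iio_mem_nhds one_pos), hd0]
  have hu₁eq : ∀ ρ ∈ Ioo (0 : ℝ) 1, u₁ ρ = deriv u ρ := fun ρ hρ =>
    derivWithin_of_mem_nhds (Ico_mem_nhds hρ.1 hρ.2)
  set G : ℝ → ℝ := fun ρ => (1 - ρ ^ 2) * u₁ ρ ^ 2 / 2
    + (|u ρ| ^ (p + 1) / (p + 1) - α * (α + 1) * u ρ ^ 2 / 2) with hG
  have hGc : ContinuousOn G (Ico 0 1) := by
    have huc := hu.continuousOn
    have h1 : ContinuousOn (fun ρ => |u ρ| ^ (p + 1)) (Ico 0 1) :=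
      huc.abs.rpow_const (fun _ _ => Or.inr (by linarith))
    fun_prop
  have hGd : ∀ ρ ∈ Ioo (0 : ℝ) 1,
      HasDerivAt G (-((((N : ℝ) - 1) / ρ - (2 * α + 1) * ρ) * deriv u ρ ^ 2)) ρ := by
    intro ρ hρ
    obtain ⟨d1, d2⟩ := hasDerivAt_of_contDiffOn hu hρ
    have d2' : HasDerivAt u₁ (deriv (deriv u) ρ) ρ :=
      d2.congr_of_eventuallyEq (by
        filter_upwards [Ioo_mem_nhds hρ.1 hρ.2] with x hx using hu₁eq x hx)
    have h1 := (((((hasDerivAt_pow 2 ρ).const_sub 1).mul (d2'.pow 2)).div_const 2)).add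
      ((((hasDerivAt_abs_rpow (u ρ) (p := p + 1) (by linarith)).comp ρ d1).div_const (p + 1)).sub
        (((d1.pow 2).const_mul (α * (α + 1))).div_const 2))
    refine h1.congr_deriv ?_
    have hode := hsol ρ hρ
    rw [← hαdef] at hode
    rw [show p + 1 - 2 = p - 1 by ring, hu₁eq ρ hρ]
    have e : (p + 1) * |u ρ| ^ (p - 1) * u ρ * deriv u ρ / (p + 1)
        = |u ρ| ^ (p - 1) * u ρ * deriv u ρ := by field_simp
    rw [e]
    simp [hu₁eq ρ hρ]
    linear_combination deriv u ρ * hode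
  have hGanti : AntitoneOn G (Ico 0 1) := by
    refine antitoneOn_of_hasDerivWithinAt_nonpos (convex_Ico _ _) hGc
      (fun ρ hρ => (hGd ρ (by rwa [interior_Ico] at hρ)).hasDerivWithinAt) (fun ρ hρ => ?_)
    rw [interior_Ico] at hρ
    have h1 : (N : ℝ) - 1 ≤ ((N : ℝ) - 1) / ρ := by
      rw [le_div_iff₀ hρ.1]
      nlinarith [hρ.2]
    have h2 : (2 * α + 1) * ρ ≤ 2 * α + 1 := by nlinarith [hρ.2]
    have : 0 ≤ (((N : ℝ) - 1) / ρ - (2 * α + 1) * ρ) * deriv u ρ ^ 2 :=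
      mul_nonneg (by linarith) (sq_nonneg _)
    linarith
  have hc0 : 0 < c := by linarith
  have hcp : 1 ≤ c ^ (p + 1) := Real.one_le_rpow hc (by linarith)
  have hcsq : (c ^ ((p + 1) / 2)) ^ 2 = c ^ (p + 1) := by
    rw [← Real.rpow_natCast, ← Real.rpow_mul hc0.le]; congr 1; push_cast; ring
  have hbd : ∀ ρ ∈ Icc (0 : ℝ) (1 / 2), |u₁ ρ| ≤ B * c ^ ((p + 1) / 2) := by
    intro ρ hρ
    have h1 := hGanti (left_mem_Ico.2 one_pos) ⟨hρ.1, by linarith [hρ.2]⟩ hρ.1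
    simp only [hG, hu₁0, h0, abs_of_pos hc0] at h1
    have h2 := hlow (u ρ)
    have h3 : 0 ≤ α * (α + 1) * c ^ 2 / 2 := by positivity
    have h4 : (3 / 8) * u₁ ρ ^ 2 ≤ (1 - ρ ^ 2) * u₁ ρ ^ 2 / 2 := by
      have : ρ ^ 2 ≤ 1 / 4 := by nlinarith [hρ.1, hρ.2]
      nlinarith [sq_nonneg (u₁ ρ)]
    have h5 : C ≤ C * c ^ (p + 1) := le_mul_of_one_le_right hC hcp
    have h6 : u₁ ρ ^ 2 ≤ (B * c ^ ((p + 1) / 2)) ^ 2 := by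
      rw [mul_pow, hB2, hcsq]
      have e : c ^ (p + 1) / (p + 1) = 1 / (p + 1) * c ^ (p + 1) := by ring
      rw [e] at h1
      linarith
    exact abs_le_of_sq_le_sq h6 (by positivity)
  intro ρ hρ
  refine ⟨?_, ?_⟩
  · rw [← hu₁eq ρ ⟨hρ.1, by linarith [hρ.2]⟩]
    exact hbd ρ ⟨hρ.1.le, hρ.2⟩
  · have hsub : Icc (0 : ℝ) (1 / 2) ⊆ Ico 0 1 := fun x hx => ⟨hx.1, by linarith [hx.2]⟩
    have h1 := Convex.norm_image_sub_le_of_norm_hasDerivWithin_le (s := Icc (0 : ℝ) (1 / 2))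
      (f := u) (f' := u₁) (x := 0) (y := ρ) (C := B * c ^ ((p + 1) / 2))
      (fun x hx => ((hu.differentiableOn (by norm_num)) x (hsub hx)).hasDerivWithinAt.mono hsub)
      hbd (convex_Icc _ _) (by norm_num) ⟨hρ.1.le, hρ.2⟩
    rwa [h0, sub_zero, Real.norm_eq_abs, Real.norm_eq_abs, abs_of_pos hρ.1] at h1

/-- The quotient `u / u_∞` as a function of `t = log ρ`. -/
noncomputable def logV (N : ℕ) (p : ℝ) (u : ℝ → ℝ) (t : ℝ) : ℝ :=
  u (Real.exp t) * Real.exp (alphaP p * t) / bInf N p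

/-- The derivative of `logV`. -/
noncomputable def logW (N : ℕ) (p : ℝ) (u : ℝ → ℝ) (t : ℝ) : ℝ :=
  (Real.exp t * deriv u (Real.exp t) + alphaP p * u (Real.exp t)) * Real.exp (alphaP p * t)
    / bInf N p

theorem bInf_pos (hp : 1 < p) (hα : 2 * alphaP p < N - 2) : 0 < bInf N p := by
  have hα0 : 0 < alphaP p := div_pos two_pos (by linarith)
  exact Real.rpow_pos_of_pos (mul_pos hα0 (by linarith)) _

theorem alphaP_mul (hp : 1 < p) : alphaP p * (p - 1) = 2 :=
  div_mul_cancel₀ _ (by linarith)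

theorem bInf_rpow (hp : 1 < p) (hα : 2 * alphaP p < N - 2) :
    bInf N p ^ (p - 1) = alphaP p * (N - 2 - alphaP p) := by
  have hα0 : 0 < alphaP p := div_pos two_pos (by linarith)
  rw [bInf, ← Real.rpow_mul (mul_pos hα0 (by linarith)).le,
    show alphaP p / 2 * (p - 1) = 1 by linarith [alphaP_mul hp], Real.rpow_one]

theorem isLogOrbit_logV (hp : 1 < p) (hα : 2 * alphaP p < N - 2)
    (hu : ContDiffOn ℝ 2 u (Ico 0 1)) (hsol : IsSolOn N p u (Ioo 0 1)) (t₀ : ℝ) :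
    IsLogOrbit p (N - 2 - 2 * alphaP p) (alphaP p * (N - 2 - alphaP p))
      (logV N p u) (logW N p u) t₀ := by
  have hb := bInf_pos hp hα
  have key : ∀ t ∈ Ico t₀ 0, Real.exp t ∈ Ioo (0 : ℝ) 1 := fun t ht =>
    ⟨Real.exp_pos t, Real.exp_lt_one_iff.2 ht.2⟩
  have hlin : ∀ t, HasDerivAt (fun t => Real.exp (alphaP p * t))
      (alphaP p * Real.exp (alphaP p * t)) t := fun t => by
    refine ((hasDerivAt_id t).const_mul (alphaP p)).exp.congr_deriv ?_
    simp; ring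
  refine ⟨fun t ht => ?_, fun t ht => ?_⟩
  · obtain ⟨d1, -⟩ := hasDerivAt_of_contDiffOn hu (key t ht)
    refine (((d1.comp t (Real.hasDerivAt_exp t)).mul (hlin t)).div_const _).congr_deriv ?_
    simp only [logW, Function.comp]
    ring
  · obtain ⟨d1, d2⟩ := hasDerivAt_of_contDiffOn hu (key t ht)
    have he := Real.hasDerivAt_exp t
    refine ⟨_, ((((he.mul (d2.comp t he)).add ((d1.comp t he).const_mul (alphaP p))).mul
      (hlin t)).div_const (bInf N p)), ?_⟩
    have hode := hsol _ (key t ht)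
    have e2 : Real.exp (2 * t) = Real.exp t ^ 2 := by
      rw [← Real.exp_nat_mul]; norm_num
    have e3 : |logV N p u t| ^ (p - 1) * (alphaP p * (N - 2 - alphaP p))
        = |u (Real.exp t)| ^ (p - 1) * Real.exp t ^ 2 := by
      rw [← bInf_rpow hp hα, ← Real.mul_rpow (abs_nonneg _) hb.le, logV, abs_div, abs_of_pos hb,
        div_mul_cancel₀ _ hb.ne', abs_mul, abs_of_pos (Real.exp_pos _),
        Real.mul_rpow (abs_nonneg _) (Real.exp_pos _).le, ← Real.exp_mul,
        show alphaP p * t * (p - 1) = 2 * t by linear_combination t * alphaP_mul hp, e2]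
    have e4 : alphaP p * (N - 2 - alphaP p) * (|logV N p u t| ^ (p - 1) * logV N p u t
        - logV N p u t) = (|u (Real.exp t)| ^ (p - 1) * Real.exp t ^ 2) * logV N p u t
          - alphaP p * (N - 2 - alphaP p) * logV N p u t := by
      rw [← e3]; ring
    rw [e4, e2]
    simp only [logV, logW, Pi.mul_apply, Pi.add_apply, Function.comp]
    have hx := Real.exp_pos t
    generalize Real.exp t = x at *
    generalize Real.exp (alphaP p * t) = y at *
    field_simp at hode ⊢
    linear_combination x * y * hode

/-- In the limit `ε → 0` the energy at scale `ε c^{-1/α}` is governed by a negative quadratic. -/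
theorem exists_scale {α K B b : ℝ} (hp : 1 < p) (hα : 0 < α) (hK : α ^ 2 < K) :
    ∃ ε, 0 < ε ∧ ε < 1 / 2 ∧ B * ε < 1 / 2 ∧
      (B * ε + α * (1 + B * ε)) ^ 2 / 2 - K * (1 - B * ε) ^ 2 / 2
        + K * ((ε ^ α / b) ^ (p - 1) * (1 + B * ε) ^ (p + 1) / (p + 1)) < 0 := by
  have hc : Continuous fun ε : ℝ => (B * ε + α * (1 + B * ε)) ^ 2 / 2
      - K * (1 - B * ε) ^ 2 / 2
        + K * ((ε ^ α / b) ^ (p - 1) * (1 + B * ε) ^ (p + 1) / (p + 1)) := by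
    have h1 : Continuous fun ε : ℝ => (ε ^ α / b) ^ (p - 1) :=
      ((Real.continuous_rpow_const hα.le).div_const b).rpow_const
        (fun _ => Or.inr (by linarith))
    have h2 : Continuous fun ε : ℝ => (1 + B * ε) ^ (p + 1) :=
      (by fun_prop : Continuous fun ε : ℝ => 1 + B * ε).rpow_const
        (fun _ => Or.inr (by linarith))
    fun_prop
  have e1 : ∀ᶠ ε in nhds (0 : ℝ), (B * ε + α * (1 + B * ε)) ^ 2 / 2
      - K * (1 - B * ε) ^ 2 / 2
        + K * ((ε ^ α / b) ^ (p - 1) * (1 + B * ε) ^ (p + 1) / (p + 1)) < 0 := by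
    refine hc.continuousAt.eventually_lt continuousAt_const ?_
    rw [Real.zero_rpow hα.ne', zero_div, Real.zero_rpow (by linarith)]
    simp
    linarith
  have e2 : ∀ᶠ ε in nhds (0 : ℝ), B * ε < 1 / 2 :=
    (by fun_prop : Continuous fun ε : ℝ => B * ε).continuousAt.eventually_lt
      continuousAt_const (by norm_num)
  have e3 : ∀ᶠ ε in nhds (0 : ℝ), ε < 1 / 2 := Iio_mem_nhds (by norm_num)
  obtain ⟨ε, h, h0⟩ := ((((e1.and e2).and e3).filter_mono nhdsWithin_le_nhds).and
    (self_mem_nhdsWithin : Ioi (0 : ℝ) ∈ nhdsWithin 0 (Ioi 0))).exists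
  exact ⟨ε, h0, h.2, h.1.2, h.1.1⟩

theorem exists_logEnergy_le_neg (hp : 1 < p) (hα : 2 * alphaP p < N - 2) :
    ∃ ε > 0, ∃ η > 0, ∀ (u : ℝ → ℝ), ∀ c ≥ 1, ContDiffOn ℝ 2 u (Ico 0 1) →
      IsSolOn N p u (Ioo 0 1) → u 0 = c → derivWithin u (Ici 0) 0 = 0 →
      0 < logV N p u (Real.log (ε * c ^ (-((p - 1) / 2)))) ∧
      logEnergy p (alphaP p * (N - 2 - alphaP p)) (logV N p u) (logW N p u)
        (Real.log (ε * c ^ (-((p - 1) / 2)))) ≤ -η := by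
  have hα0 : 0 < alphaP p := div_pos two_pos (by linarith)
  have hαp := alphaP_mul hp
  have hb := bInf_pos hp hα
  obtain ⟨B, hB, hbound⟩ := exists_forall_deriv_le hp hα
  set K := alphaP p * (N - 2 - alphaP p) with hK
  have hK0 : 0 < K := mul_pos hα0 (by linarith)
  obtain ⟨ε, hε0, hε1, hBε, hneg⟩ := exists_scale (α := alphaP p) (K := K) (B := B)
    (b := bInf N p) hp hα0 (by nlinarith)
  set z := ε ^ alphaP p / bInf N p with hz
  have hz0 : 0 < z := by positivity
  set φ := (B * ε + alphaP p * (1 + B * ε)) ^ 2 / 2 - K * (1 - B * ε) ^ 2 / 2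
        + K * (z ^ (p - 1) * (1 + B * ε) ^ (p + 1) / (p + 1)) with hφ
  refine ⟨ε, hε0, -(z ^ 2 * φ), by nlinarith [sq_pos_of_pos hz0], fun u c hc hu hsol h0 hd => ?_⟩
  have hc0 : 0 < c := by linarith
  set r := ε * c ^ (-((p - 1) / 2)) with hr
  have hcr : c ^ (-((p - 1) / 2)) ≤ 1 := Real.rpow_le_one_of_one_le_of_nonpos hc (by linarith)
  have hr0 : 0 < r := by positivity
  have hr1 : r ≤ 1 / 2 := by
    calc r ≤ ε * 1 := mul_le_mul_of_nonneg_left hcr hε0.le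
      _ ≤ 1 / 2 := by linarith
  obtain ⟨b1, b2⟩ := hbound u c hc hu hsol h0 hd r ⟨hr0, hr1⟩
  have hscale : c ^ ((p + 1) / 2) * r = ε * c := by
    rw [hr, mul_left_comm, ← Real.rpow_add hc0, show (p + 1) / 2 + -((p - 1) / 2) = 1 by ring,
      Real.rpow_one]
  have hrα : Real.exp (alphaP p * Real.log r) = ε ^ alphaP p / c := by
    rw [mul_comm, ← Real.rpow_def_of_pos hr0, hr,
      Real.mul_rpow hε0.le (by positivity), ← Real.rpow_mul hc0.le,
      show -((p - 1) / 2) * alphaP p = -1 by linarith, Real.rpow_neg_one]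
    rfl
  set x := u r / c with hx
  set y := r * deriv u r / c with hy
  have hBc : B * c ^ ((p + 1) / 2) * r = B * ε * c := by rw [mul_assoc, hscale]; ring
  have hxb : |x - 1| ≤ B * ε := by
    have : x - 1 = (u r - c) / c := by rw [hx]; field_simp
    rw [this, abs_div, abs_of_pos hc0, div_le_iff₀ hc0, ← hBc]
    exact b2
  have hyb : |y| ≤ B * ε := by
    rw [hy, abs_div, abs_of_pos hc0, div_le_iff₀ hc0, ← hBc, abs_mul, abs_of_pos hr0]
    linarith [mul_le_mul_of_nonneg_right b1 hr0.le]
  have hVx : logV N p u (Real.log r) = z * x := by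
    rw [logV, hrα, Real.exp_log hr0, hz, hx]; ring
  have hWx : logW N p u (Real.log r) = z * (y + alphaP p * x) := by
    rw [logW, hrα, Real.exp_log hr0, hz, hx, hy]; ring
  obtain ⟨hx1, hx2⟩ := abs_le.1 hxb
  obtain ⟨hy1, hy2⟩ := abs_le.1 hyb
  have hx0 : 0 < x := by linarith
  refine ⟨by rw [hVx]; positivity, ?_⟩
  rw [neg_neg, logEnergy, hVx, hWx, potential_eq (by positivity)]
  have k1 : (1 - Real.exp (2 * Real.log r)) * (z * (y + alphaP p * x)) ^ 2 / 2
      ≤ z ^ 2 * ((B * ε + alphaP p * (1 + B * ε)) ^ 2 / 2) := by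
    have h1 : (1 - Real.exp (2 * Real.log r)) * (z * (y + alphaP p * x)) ^ 2
        ≤ (z * (y + alphaP p * x)) ^ 2 := by
      have := mul_nonneg (Real.exp_pos (2 * Real.log r)).le
        (sq_nonneg (z * (y + alphaP p * x)))
      linarith
    have h2 : (y + alphaP p * x) ^ 2 ≤ (B * ε + alphaP p * (1 + B * ε)) ^ 2 := by
      have q1 : alphaP p * x ≤ alphaP p * (1 + B * ε) := by gcongr; linarith
      have q2 : 0 < alphaP p * x := by positivity
      apply sq_le_sq'
      · linarith [mul_pos hα0 (by linarith : 0 < 1 + B * ε)]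
      · linarith
    have h3 := mul_le_mul_of_nonneg_left h2 (sq_nonneg z)
    rw [mul_pow] at h1
    linarith
  have k2 : K * ((z * x) ^ 2 * ((z * x) ^ (p - 1) / (p + 1) - 1 / 2))
      ≤ z ^ 2 * (K * (z ^ (p - 1) * (1 + B * ε) ^ (p + 1) / (p + 1))
        - K * (1 - B * ε) ^ 2 / 2) := by
    have h1 : x ^ (p + 1) ≤ (1 + B * ε) ^ (p + 1) := by gcongr; linarith
    have h2 : (1 - B * ε) ^ 2 ≤ x ^ 2 := by
      have : 0 ≤ 1 - B * ε := by linarith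
      gcongr; linarith
    have e : x ^ (p + 1) = x ^ (p - 1) * x ^ 2 := by
      rw [show p + 1 = (p - 1) + 2 by ring, Real.rpow_add hx0]; norm_num
    have e2 : K * ((z * x) ^ 2 * ((z * x) ^ (p - 1) / (p + 1) - 1 / 2))
        = z ^ 2 * (K * (z ^ (p - 1) * x ^ (p + 1) / (p + 1)) - K * x ^ 2 / 2) := by
      rw [e, Real.mul_rpow hz0.le hx0.le]; ring
    rw [e2]
    gcongr
  calc _ ≤ _ := add_le_add k1 k2
    _ = z ^ 2 * φ := by rw [hφ]; ring

end Profile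

theorem div_uInf_eq_logV (N : ℕ) (p : ℝ) (u : ℝ → ℝ) {ρ : ℝ} (hρ : 0 < ρ) :
    u ρ / uInf N p ρ = logV N p u (Real.log ρ) := by
  rw [uInf, logV, Real.exp_log hρ, mul_comm (alphaP p), ← Real.rpow_def_of_pos hρ,
    Real.rpow_neg hρ.le]
  have := Real.rpow_pos_of_pos hρ (alphaP p)
  field_simp

/-- For large `c` the energy on `[σ, 1)` is close to its minimum. -/
theorem eventually_logEnergy_le {N : ℕ} {p : ℝ} (hp : 1 < p) (hα : 2 * alphaP p < N - 2)
    {σ ε : ℝ} (hσ : 0 < σ) (hσ1 : σ < 1) (hε : 0 < ε) :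
    ∃ c₁ : ℝ, ∀ c ≥ c₁, ∀ u : ℝ → ℝ, ContDiffOn ℝ 2 u (Ico 0 1) →
      IsSolOn N p u (Ioo 0 1) → u 0 = c → derivWithin u (Ici 0) 0 = 0 →
      ∀ t ∈ Ico (Real.log σ) 0, 0 < logV N p u t ∧
        logEnergy p (alphaP p * (N - 2 - alphaP p)) (logV N p u) (logW N p u) t
          ≤ alphaP p * (N - 2 - alphaP p) * potential p 1 + ε := by
  have hα0 : 0 < alphaP p := div_pos two_pos (by linarith)
  have hm : 0 < (N : ℝ) - 2 - 2 * alphaP p := by linarith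
  obtain ⟨δ, hδ, η, hη, hinit⟩ := exists_logEnergy_le_neg hp hα
  obtain ⟨L, hL, hmain⟩ := exists_forall_logEnergy_le hp hm
    (mul_pos hα0 (by linarith) : 0 < alphaP p * (N - 2 - alphaP p)) hη hε
  have hlim : Tendsto (fun c : ℝ => δ * c ^ (-((p - 1) / 2))) atTop (nhds 0) := by
    simpa using (tendsto_rpow_neg_atTop (by linarith : 0 < (p - 1) / 2)).const_mul δ
  have hev := hlim.eventually (Iio_mem_nhds (by positivity : 0 < σ * Real.exp (-L)))
  obtain ⟨c₁, hc₁⟩ := eventually_atTop.1 (hev.and (eventually_ge_atTop 1))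
  refine ⟨c₁, fun c hc u hu hsol h0 hd t ht => ?_⟩
  obtain ⟨hlt, hc1⟩ := hc₁ c hc
  have hlt : δ * c ^ (-((p - 1) / 2)) < σ * Real.exp (-L) := hlt
  obtain ⟨hV, hE⟩ := hinit u c hc1 hu hsol h0 hd
  have hc0 : 0 < c := by linarith
  have ht₀ : Real.log (δ * c ^ (-((p - 1) / 2))) + L ≤ Real.log σ := by
    have := Real.log_le_log (by positivity) hlt.le
    rw [Real.log_mul hσ.ne' (Real.exp_pos _).ne', Real.log_exp] at this
    linarith
  have hlogσ : Real.log σ < 0 := Real.log_neg hσ hσ1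
  have horb := isLogOrbit_logV hp hα hu hsol (Real.log (δ * c ^ (-((p - 1) / 2))))
  exact ⟨horb.pos hp hm hη hE hV ⟨by linarith [ht.1], ht.2⟩,
    hmain _ _ _ (by linarith) horb hV hE t ⟨by linarith [ht.1], ht.2⟩⟩

theorem stmt5 (N : ℕ) (p : ℝ) (hN : 3 ≤ N) (hp : 1 + 4 / ((N : ℝ) - 2) < p)
    (u : ℝ → ℝ → ℝ)
    (hu : ∀ c : ℝ,
      ContDiffOn ℝ 2 (u c) (Ico 0 1) ∧
      IsSolOn N p (u c) (Ioo 0 1) ∧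
      u c 0 = c ∧
      derivWithin (u c) (Ici 0) 0 = 0 ∧
      ContinuousOn (u c) (Icc 0 1))
    (σ₀ σ₁ : ℝ) (h0 : 0 < σ₀) (h01 : σ₀ < σ₁) (h1 : σ₁ < 1) :
    (∀ ε > 0, ∃ c₁ : ℝ, ∀ c ≥ c₁, ∀ ρ ∈ Icc σ₀ 1,
      |u c ρ / uInf N p ρ - 1| < ε) ∧
    (∀ ε > 0, ∃ c₁ : ℝ, ∀ c ≥ c₁, ∀ ρ ∈ Ioc σ₀ σ₁,
      |deriv (fun s => u c s / uInf N p s) ρ| < ε) ∧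
    Tendsto (fun c => u c 1) atTop (nhds (bInf N p)) := by
  have hN' : (0 : ℝ) < N - 2 := by
    have : (3 : ℝ) ≤ N := by exact_mod_cast hN
    linarith
  have hp1 : 1 < p := by
    have : 0 < 4 / ((N : ℝ) - 2) := by positivity
    linarith
  have hα : 2 * alphaP p < N - 2 := by
    have h : 4 / ((N : ℝ) - 2) < p - 1 := by linarith
    rw [div_lt_iff₀ hN'] at h
    rw [alphaP, ← mul_div_assoc, div_lt_iff₀ (by linarith)]
    linarith
  have hα0 : 0 < alphaP p := div_pos two_pos (by linarith)
  have hb := bInf_pos hp1 hα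
  have hσ01 : σ₀ < 1 := h01.trans h1
  set K := alphaP p * ((N : ℝ) - 2 - alphaP p) with hKdef
  have hK : 0 < K := mul_pos hα0 (by linarith)
  have hmem : ∀ {ρ}, ρ ∈ Ico σ₀ 1 → Real.log ρ ∈ Ico (Real.log σ₀) 0 := fun hρ =>
    ⟨Real.log_le_log h0 hρ.1, Real.log_neg (h0.trans_le hρ.1) hρ.2⟩
  have hunif : ∀ ε > 0, ∃ c₁ : ℝ, ∀ c ≥ c₁, ∀ ρ ∈ Icc σ₀ 1,
      |u c ρ / uInf N p ρ - 1| < ε := by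
    intro ε hε
    obtain ⟨δ, hδ, hstab⟩ := exists_potential_lt_imp_abs_sub_one_lt hp1 (half_pos hε)
    obtain ⟨c₁, hc₁⟩ := eventually_logEnergy_le hp1 hα h0 hσ01
      (by positivity : 0 < K * (δ / 2))
    refine ⟨c₁, fun c hc => ?_⟩
    obtain ⟨hu1, hu2, hu3, hu4, hu5⟩ := hu c
    have hin : ∀ ρ ∈ Ico σ₀ 1, |u c ρ / uInf N p ρ - 1| ≤ ε / 2 := by
      intro ρ hρ
      rw [div_uInf_eq_logV N p (u c) (h0.trans_le hρ.1)]
      obtain ⟨hV, hE⟩ := hc₁ c hc (u c) hu1 hu2 hu3 hu4 _ (hmem hρ)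
      refine (hstab _ hV ?_).le
      have hk := kinetic_nonneg (W := logW N p (u c)) (hmem hρ).2
      unfold logEnergy at hE
      have : K * potential p (logV N p (u c) (Real.log ρ))
          ≤ K * (potential p 1 + δ / 2) := by linarith
      linarith [le_of_mul_le_mul_left this hK]
    have hcont : ContinuousOn (fun ρ => |u c ρ / uInf N p ρ - 1|) (Icc σ₀ 1) := by
      have h2 : ContinuousOn (uInf N p) (Icc σ₀ 1) := by
        refine continuousOn_const.mul (continuousOn_id.rpow_const fun ρ hρ => Or.inl ?_)
        exact (h0.trans_le hρ.1).ne'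
      refine (((hu5.mono (Icc_subset_Icc_left h0.le)).div h2 fun ρ hρ => ?_).sub
        continuousOn_const).abs
      exact (mul_pos hb (Real.rpow_pos_of_pos (h0.trans_le hρ.1) _)).ne'
    intro ρ hρ
    have hcl := closure_Ico hσ01.ne
    have := le_on_closure hin (by rwa [hcl]) continuousOn_const (by rwa [hcl] : ρ ∈ closure _)
    linarith
  refine ⟨hunif, fun ε hε => ?_, ?_⟩
  · have hgap : 0 < 1 - σ₁ ^ 2 := by nlinarith
    obtain ⟨c₁, hc₁⟩ := eventually_logEnergy_le hp1 hα h0 hσ01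
      (by positivity : 0 < (1 - σ₁ ^ 2) * (ε * σ₀) ^ 2 / 4)
    refine ⟨c₁, fun c hc ρ hρ => ?_⟩
    obtain ⟨hu1, hu2, hu3, hu4, -⟩ := hu c
    have hρ0 : 0 < ρ := h0.trans hρ.1
    have hρ1 : ρ < 1 := hρ.2.trans_lt h1
    have hlog := hmem ⟨hρ.1.le, hρ1⟩
    obtain ⟨hV, hE⟩ := hc₁ c hc (u c) hu1 hu2 hu3 hu4 _ hlog
    have hd : HasDerivAt (fun s => u c s / uInf N p s) (logW N p (u c) (Real.log ρ) * ρ⁻¹) ρ := by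
      refine (((isLogOrbit_logV hp1 hα hu1 hu2 _).hasDerivAt _ hlog).comp ρ
        (Real.hasDerivAt_log hρ0.ne')).congr_of_eventuallyEq ?_
      filter_upwards [Ioi_mem_nhds hρ0] with s hs using div_uInf_eq_logV N p (u c) hs
    rw [hd.deriv]
    have hmin : potential p 1 ≤ potential p (logV N p (u c) (Real.log ρ)) := by
      by_cases h : logV N p (u c) (Real.log ρ) = 1
      · rw [h]
      · exact (potential_one_lt hp1 hV.le h).le
    have hmin' := mul_le_mul_of_nonneg_left hmin hK.le
    have hexp : Real.exp (2 * Real.log ρ) = ρ ^ 2 := by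
      rw [two_mul, Real.exp_add, Real.exp_log hρ0, sq]
    unfold logEnergy at hE
    rw [hexp] at hE
    set w := logW N p (u c) (Real.log ρ)
    have hsq : (1 - σ₁ ^ 2) * w ^ 2 ≤ (1 - ρ ^ 2) * w ^ 2 := by
      have := hρ.2
      gcongr
    have hw2 : w ^ 2 < (ε * σ₀) ^ 2 := by
      have hpos : 0 < (1 - σ₁ ^ 2) * (ε * σ₀) ^ 2 := by positivity
      exact lt_of_mul_lt_mul_left (by linarith) hgap.le
    have hw : |w| < ε * σ₀ := abs_lt_of_sq_lt_sq hw2 (by positivity)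
    rw [abs_mul, abs_inv, abs_of_pos hρ0, ← div_eq_mul_inv, div_lt_iff₀ hρ0]
    exact hw.trans (mul_lt_mul_of_pos_left hρ.1 hε)
  · rw [Metric.tendsto_atTop]
    intro ε hε
    obtain ⟨c₁, hc₁⟩ := hunif (ε / bInf N p) (by positivity)
    refine ⟨c₁, fun c hc => ?_⟩
    have h := hc₁ c hc 1 ⟨hσ01.le, le_rfl⟩
    have e : uInf N p 1 = bInf N p := by rw [uInf, Real.one_rpow, mul_one]
    rw [e, show u c 1 / bInf N p - 1 = (u c 1 - bInf N p) / bInf N p by field_simp, abs_div,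
      abs_of_pos hb, div_lt_div_iff_of_pos_right hb] at h
    rwa [Real.dist_eq]
end

section
/- Assume N ≥ 3 and p > 1 + 4/(N−2). Then for all ρ ∈ (0,1) and c ≥ 0, the pair (w(ρ,c), ρ ∂_ρ w(ρ,c)) is not (0,0), and there exists a continuous function Θ : [0,1) × [0,∞) → ℝ such that: (i) for all (ρ,c) with w(ρ,c) ≠ 0, tan Θ(ρ,c) = ρ ∂_ρ w(ρ,c) / w(ρ,c); (ii) Θ(ρ,c) ∈ π/2 + πℤ if and only if w(ρ,c) = 0; (iii) Θ(0,c) = π for all c ≥ 0 and Θ(ρ,0) = π for all ρ ∈ [0,1). -/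
open Set Filter

/-- `w(ρ,c) = u(ρ,c)/u_∞(ρ) - 1`; by Lean's division-by-zero convention this
equals `-1` at `ρ = 0`, matching the convention `w(0,c) = -1`. -/
noncomputable def wFun (N : ℕ) (p : ℝ) (u : ℝ → ℝ → ℝ) (c ρ : ℝ) : ℝ :=
  u c ρ / uInf N p ρ - 1

/-- Grönwall's inequality, requiring the derivative only in the open interval. -/
theorem le_mul_exp_of_hasDerivAt_le {E E' : ℝ → ℝ} {a b C : ℝ} (hab : a ≤ b)
    (hc : ContinuousOn E (Icc a b)) (hd : ∀ t ∈ Ioo a b, HasDerivAt E (E' t) t)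
    (hle : ∀ t ∈ Ioo a b, E' t ≤ C * E t) : E b ≤ E a * Real.exp (C * (b - a)) := by
  have hF : ∀ t ∈ Ioo a b, HasDerivAt (fun t => E t * Real.exp (-C * (t - a)))
      ((E' t - C * E t) * Real.exp (-C * (t - a))) t := by
    intro t ht
    have h1 : HasDerivAt (fun t => Real.exp (-C * (t - a))) (Real.exp (-C * (t - a)) * -C) t := by
      simpa using (((hasDerivAt_id t).sub_const a).const_mul (-C)).exp
    exact ((hd t ht).fun_mul h1).congr_deriv (by ring)
  have hanti : AntitoneOn (fun t => E t * Real.exp (-C * (t - a))) (Icc a b) := by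
    refine antitoneOn_of_deriv_nonpos (convex_Icc a b) (hc.mul (by fun_prop)) ?_ ?_
    · rw [interior_Icc]
      exact fun t ht => (hF t ht).differentiableAt.differentiableWithinAt
    · rw [interior_Icc]
      intro t ht
      rw [(hF t ht).deriv]
      exact mul_nonpos_of_nonpos_of_nonneg (by linarith [hle t ht]) (Real.exp_pos _).le
  have h := hanti (left_mem_Icc.2 hab) (right_mem_Icc.2 hab) hab
  simp only [sub_self, mul_zero, Real.exp_zero, mul_one] at h
  calc E b = E b * Real.exp (-C * (b - a)) * Real.exp (C * (b - a)) := by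
        rw [mul_assoc, ← Real.exp_add]; simp
    _ ≤ _ := by gcongr

/-- Grönwall's inequality backwards in time. -/
theorem le_mul_exp_of_neg_hasDerivAt_le {E E' : ℝ → ℝ} {a b C : ℝ} (hab : a ≤ b)
    (hc : ContinuousOn E (Icc a b)) (hd : ∀ t ∈ Ioo a b, HasDerivAt E (E' t) t)
    (hle : ∀ t ∈ Ioo a b, -E' t ≤ C * E t) : E a ≤ E b * Real.exp (C * (b - a)) := by
  have hneg : ∀ t ∈ Ioo (-b) (-a), -t ∈ Ioo a b := fun t ht =>
    ⟨by linarith [ht.2], by linarith [ht.1]⟩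
  have h := le_mul_exp_of_hasDerivAt_le (E := fun t => E (-t)) (E' := fun t => -E' (-t)) (C := C)
    (neg_le_neg hab)
    (hc.comp continuous_neg.continuousOn fun t ht => ⟨by linarith [ht.2], by linarith [ht.1]⟩)
    (fun t ht => ((hd (-t) (hneg t ht)).comp t (hasDerivAt_neg t)).congr_deriv (by ring))
    (fun t ht => hle _ (hneg t ht))
  simp only [neg_neg] at h
  convert h using 3
  ring

theorem hasDerivAt_abs_rpow_sub_one_mul {p : ℝ} (hp : 1 < p) (t : ℝ) :
    HasDerivAt (fun t : ℝ => |t| ^ (p - 1) * t) (p * |t| ^ (p - 1)) t := by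
  have hpow : Continuous fun t : ℝ => |t| ^ (p - 1) :=
    continuous_abs.rpow_const fun _ => Or.inr (by linarith)
  refine hasDerivAt_of_hasDerivAt_of_ne' (x := 0) (g := fun t => p * |t| ^ (p - 1)) (fun s hs => ?_)
    (hpow.mul continuous_id).continuousAt (continuous_const.mul hpow).continuousAt t
  have hs' : |s| ≠ 0 := abs_ne_zero.2 hs
  refine (((hasDerivAt_abs hs).rpow_const (p := p - 1) (Or.inl hs')).fun_mul
    (hasDerivAt_id s)).congr_deriv ?_
  have h1 : (SignType.sign s : ℝ) * s = |s| := sign_mul_self s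
  have h2 : |s| ^ (p - 1) = |s| ^ (p - 1 - 1) * |s| := by
    rw [← Real.rpow_add_one hs']; simp
  simp only [id, mul_one]
  linear_combination (p - 1) * |s| ^ (p - 1 - 1) * h1 - (p - 1) * h2

theorem abs_abs_rpow_mul_sub_le {p M s t : ℝ} (hp : 1 < p) (hs : |s| ≤ M) (ht : |t| ≤ M) :
    |(|s| ^ (p - 1) * s - |t| ^ (p - 1) * t)| ≤ p * M ^ (p - 1) * |s - t| := by
  refine (convex_Icc (-M) M).norm_image_sub_le_of_norm_hasDerivWithin_le
    (f := fun t : ℝ => |t| ^ (p - 1) * t)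
    (fun r _ => (hasDerivAt_abs_rpow_sub_one_mul hp r).hasDerivWithinAt)
    (fun r hr => ?_) (abs_le.1 ht) (abs_le.1 hs)
  rw [Real.norm_eq_abs, abs_of_nonneg (by positivity)]
  have hr' : |r| ≤ M := abs_le.2 hr
  gcongr

/-- A continuous choice of polar angle, prescribed on the boundary half-lines. -/
theorem exists_continuous_angle {W V : ℝ × ℝ → ℝ}
    (hW : ContinuousOn W (Ico 0 1 ×ˢ Ici 0)) (hV : ContinuousOn V (Ico 0 1 ×ˢ Ici 0))
    (hne : ∀ q ∈ Ico (0 : ℝ) 1 ×ˢ Ici (0 : ℝ), ¬(W q = 0 ∧ V q = 0))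
    (hW₀ : ∀ q ∈ Ico (0 : ℝ) 1 ×ˢ Ici (0 : ℝ), q.1 = 0 ∨ q.2 = 0 → W q = -1)
    (hV₀ : ∀ q ∈ Ico (0 : ℝ) 1 ×ˢ Ici (0 : ℝ), q.1 = 0 ∨ q.2 = 0 → V q = 0) :
    ∃ Θ : ℝ × ℝ → ℝ, ContinuousOn Θ (Ico 0 1 ×ˢ Ici 0) ∧
      (∀ q ∈ Ico (0 : ℝ) 1 ×ˢ Ici (0 : ℝ), ∃ r > 0,
        W q = r * Real.cos (Θ q) ∧ V q = r * Real.sin (Θ q)) ∧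
      ∀ q ∈ Ico (0 : ℝ) 1 ×ˢ Ici (0 : ℝ), q.1 = 0 ∨ q.2 = 0 → Θ q = Real.pi := by
  set S : Set (ℝ × ℝ) := Ico (0 : ℝ) 1 ×ˢ Ici (0 : ℝ) with hS
  set U : Set (ℝ × ℝ) := Iio (1 : ℝ) ×ˢ univ with hU
  set P : ℝ × ℝ → ℝ × ℝ := fun q => (max q.1 0, max q.2 0) with hP
  have hPU : MapsTo P U S := fun q hq =>
    ⟨⟨le_max_right _ _, max_lt hq.1 one_pos⟩, mem_Ici.2 (le_max_right _ _)⟩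
  have hPS : ∀ q ∈ S, P q = q := fun q hq =>
    Prod.ext (max_eq_left hq.1.1) (max_eq_left hq.2)
  have hSU : S ⊆ U := fun q hq => ⟨hq.1.2, mem_univ _⟩
  have hPc : Continuous P := by fun_prop
  have hUconv : Convex ℝ U := (convex_Iio 1).prod convex_univ
  have : ContractibleSpace U := hUconv.contractibleSpace ⟨0, by simp [hU]⟩
  have hUs : IsSimplyConnected U := inferInstanceAs (SimplyConnectedSpace U)
  have hgc : ContinuousOn (fun q => (W (P q) : ℂ) + (V (P q) : ℂ) * Complex.I) U :=
    (Complex.continuous_ofReal.comp_continuousOn (hW.comp hPc.continuousOn hPU)).add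
      ((Complex.continuous_ofReal.comp_continuousOn (hV.comp hPc.continuousOn hPU)).mul
        continuousOn_const)
  obtain ⟨f, hfc, hf⟩ := Complex.exists_continuousOn_eqOn_exp_comp hUs
    (isOpen_Iio.prod isOpen_univ) hgc (by
      rintro ⟨q, hq, h⟩
      refine hne (P q) (hPU hq) ⟨?_, ?_⟩
      · simpa using congrArg Complex.re h
      · simpa using congrArg Complex.im h)
  have hre : ∀ q ∈ S, W q = Real.exp (f q).re * Real.cos (f q).im := by
    intro q hq
    have h := congrArg Complex.re (hf (hSU hq))
    simpa [hPS q hq, Complex.exp_re] using h.symm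
  have him : ∀ q ∈ S, V q = Real.exp (f q).re * Real.sin (f q).im := by
    intro q hq
    have h := congrArg Complex.im (hf (hSU hq))
    simpa [hPS q hq, Complex.exp_im] using h.symm
  have hfS : ContinuousOn (fun q => (f q).im) S :=
    Complex.continuous_im.comp_continuousOn (hfc.mono hSU)
  set T : Set (ℝ × ℝ) := ({0} ×ˢ Ici (0 : ℝ)) ∪ (Ico (0 : ℝ) 1 ×ˢ {0}) with hT
  have hTpre : IsPreconnected T := by
    refine IsPreconnected.union (0, 0) (by simp) (by simp) ?_ ?_
    · exact isPreconnected_singleton.prod isPreconnected_Ici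
    · exact isPreconnected_Ico.prod isPreconnected_singleton
  have hTS : T ⊆ S := by
    rintro ⟨a, b⟩ (⟨ha, hb⟩ | ⟨ha, hb⟩)
    · simp only [mem_singleton_iff] at ha
      exact ⟨by simp [ha], hb⟩
    · simp only [mem_singleton_iff] at hb
      exact ⟨ha, by simp [hb]⟩
  have hmem : ∀ q ∈ S, q.1 = 0 ∨ q.2 = 0 → q ∈ T := by
    rintro ⟨a, b⟩ hq (h | h)
    · exact Or.inl ⟨h, hq.2⟩
    · exact Or.inr ⟨hq.1, h⟩
  have hTor : ∀ q ∈ T, q.1 = 0 ∨ q.2 = 0 := by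
    rintro ⟨a, b⟩ (⟨ha, hb⟩ | ⟨ha, hb⟩)
    · exact Or.inl ha
    · exact Or.inr hb
  have hval : ∀ q ∈ T, ∃ k : ℤ, (f q).im = Real.pi + k * (2 * Real.pi) := by
    intro q hq
    have h1 := hre q (hTS hq)
    have h2 := him q (hTS hq)
    rw [hW₀ q (hTS hq) (hTor q hq)] at h1
    rw [hV₀ q (hTS hq) (hTor q hq)] at h2
    have hsin : Real.sin (f q).im = 0 := by
      rcases mul_eq_zero.1 h2.symm with h | h
      · exact absurd h (Real.exp_pos _).ne'
      · exact h
    have hcos : Real.cos (f q).im = -1 := by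
      rcases Real.sin_eq_zero_iff_cos_eq.1 hsin with h | h
      · rw [h] at h1
        linarith [Real.exp_pos (f q).re]
      · exact h
    have h3 : Real.cos ((f q).im - Real.pi) = 1 := by rw [Real.cos_sub_pi, hcos, neg_neg]
    obtain ⟨k, hk⟩ := (Real.cos_eq_one_iff _).1 h3
    exact ⟨k, by linarith⟩
  have hconst : ∀ q ∈ T, (f q).im = (f (0, 0)).im := by
    intro q hq
    have hpi : (2 * Real.pi) ≠ 0 := by positivity
    have h := hTpre.constant_of_mapsTo (T := range ((↑) : ℤ → ℝ))
      Int.isClosedEmbedding_coe_real.isInducing.isDiscrete_range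
      (f := fun q => ((f q).im - Real.pi) / (2 * Real.pi))
      (((hfS.mono hTS).sub continuousOn_const).div_const _)
      (fun q hq => by
        obtain ⟨k, hk⟩ := hval q hq
        exact ⟨k, by simp only [hk]; field_simp; ring⟩) hq
      (show ((0, 0) : ℝ × ℝ) ∈ T by simp [hT])
    rw [div_left_inj' hpi] at h
    linarith
  obtain ⟨k, hk⟩ := hval (0, 0) (by simp [hT])
  refine ⟨fun q => (f q).im - k * (2 * Real.pi), hfS.sub continuousOn_const, ?_, ?_⟩
  · intro q hq
    refine ⟨Real.exp (f q).re, Real.exp_pos _, ?_, ?_⟩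
    · rw [Real.cos_sub_int_mul_two_pi, hre q hq]
    · rw [Real.sin_sub_int_mul_two_pi, him q hq]
  · intro q hq h
    simp only
    rw [hconst q (hmem q hq h), hk]
    ring

/-- The profile equation at `ρ`, as a first order system for `x = u` and `y = u'`. -/
def ProfileSystem (N : ℕ) (p : ℝ) (x y : ℝ → ℝ) (ρ : ℝ) : Prop :=
  HasDerivAt x (y ρ) ρ ∧ DifferentiableAt ℝ y ρ ∧
    (1 - ρ ^ 2) * deriv y ρ = -(((N : ℝ) - 1) / ρ * y ρ) + 2 * (alphaP p + 1) * ρ * y ρ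
      + alphaP p * (alphaP p + 1) * x ρ - |x ρ| ^ (p - 1) * x ρ

/-- A solution of the profile system on `(0,1)` with initial data `x 0 = c`, `y 0 = 0`. -/
structure IsProfile (N : ℕ) (p c : ℝ) (x y : ℝ → ℝ) : Prop where
  continuousOn_fst : ContinuousOn x (Ico 0 1)
  continuousOn_snd : ContinuousOn y (Ico 0 1)
  fst_zero : x 0 = c
  snd_zero : y 0 = 0
  system : ∀ ρ ∈ Ioo (0 : ℝ) 1, ProfileSystem N p x y ρ

theorem le_div_mul_of_mul_le {m m₀ q K S : ℝ} (hm₀ : 0 < m₀) (hm : m₀ ≤ m) (hK : 0 ≤ K)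
    (hS : 0 ≤ S) (h : m * q ≤ K * S) : q ≤ K / m₀ * S := by
  have h1 : q ≤ K * S / m := by
    rw [le_div_iff₀ (hm₀.trans_le hm)]
    linarith
  calc q ≤ K * S / m := h1
    _ ≤ K * S / m₀ := by gcongr
    _ = K / m₀ * S := by ring

theorem one_sub_sq_le {R ρ : ℝ} (hρ : 0 ≤ ρ) (hR : ρ ≤ R) : 1 - R ^ 2 ≤ 1 - ρ ^ 2 := by
  nlinarith

theorem IsProfile.sq_le {N : ℕ} {p c R ρ : ℝ} {x y : ℝ → ℝ} (hN : 1 ≤ N) (hp : 1 < p)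
    (h : IsProfile N p c x y) (hR : R < 1) (hρ : ρ ∈ Icc 0 R) :
    x ρ ^ 2 ≤ 2 * ((|c| ^ (p + 1) / (p + 1) + c ^ 2 / 2) *
      Real.exp ((2 * (alphaP p + 1) + alphaP p * (alphaP p + 1) + 1) / ((1 - R ^ 2) / 2))) := by
  have hR0 : 0 ≤ R := hρ.1.trans hρ.2
  have hα : 0 < alphaP p := div_pos two_pos (by linarith)
  have hN' : (0 : ℝ) ≤ (N : ℝ) - 1 := by
    have : (1 : ℝ) ≤ N := by exact_mod_cast hN
    linarith
  have hm₀ : 0 < 1 - R ^ 2 := by nlinarith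
  set K := 2 * (alphaP p + 1) + alphaP p * (alphaP p + 1) + 1 with hK
  have hK0 : 0 < K := by positivity
  have hsub : Icc 0 ρ ⊆ Ico (0 : ℝ) 1 := fun t ht => ⟨ht.1, by linarith [ht.2, hρ.2]⟩
  have hx := h.continuousOn_fst.mono hsub
  have hy := h.continuousOn_snd.mono hsub
  set E : ℝ → ℝ := fun t =>
    (1 - t ^ 2) / 2 * y t ^ 2 + |x t| ^ (p + 1) / (p + 1) + x t ^ 2 / 2 with hE
  have hE_cont : ContinuousOn E (Icc 0 ρ) := by
    refine (ContinuousOn.add (ContinuousOn.mul (by fun_prop) (hy.pow 2)) ?_).add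
      ((hx.pow 2).div_const 2)
    exact ((hx.abs).rpow_const fun _ _ => Or.inr (by linarith)).div_const _
  have hgr := le_mul_exp_of_hasDerivAt_le (C := K / ((1 - R ^ 2) / 2)) hρ.1 hE_cont
    (E' := fun t => -t * y t ^ 2 + (1 - t ^ 2) * y t * deriv y t
      + |x t| ^ (p - 1) * x t * y t + x t * y t) ?_ ?_
  · have h0 : E 0 = |c| ^ (p + 1) / (p + 1) + c ^ 2 / 2 := by
      simp [hE, h.fst_zero, h.snd_zero]
    rw [h0] at hgr
    have h1 : x ρ ^ 2 / 2 ≤ E ρ := by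
      have : 0 ≤ (1 - ρ ^ 2) / 2 * y ρ ^ 2 := by
        have := one_sub_sq_le hρ.1 hρ.2
        exact mul_nonneg (by linarith) (sq_nonneg _)
      have : 0 ≤ |x ρ| ^ (p + 1) / (p + 1) := by positivity
      simp only [hE]
      linarith
    have h2 : Real.exp (K / ((1 - R ^ 2) / 2) * (ρ - 0)) ≤ Real.exp (K / ((1 - R ^ 2) / 2)) := by
      gcongr
      exact mul_le_of_le_one_right (by positivity) (by linarith [hρ.2])
    have h3 := mul_le_mul_of_nonneg_left h2
      (show 0 ≤ |c| ^ (p + 1) / (p + 1) + c ^ 2 / 2 by positivity)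
    linarith
  · intro t ht
    obtain ⟨hxt, hyt, -⟩ := h.system t ⟨ht.1, by linarith [ht.2, hρ.2]⟩
    have h1 : HasDerivAt (fun t : ℝ => (1 - t ^ 2) / 2) (-t) t := by
      refine (((hasDerivAt_pow 2 t).const_sub 1).div_const 2).congr_deriv ?_
      norm_num
      ring
    have h2 : HasDerivAt (fun t => |x t| ^ (p + 1) / (p + 1)) (|x t| ^ (p - 1) * x t * y t) t := by
      refine (((hasDerivAt_abs_rpow (x t) (p := p + 1) (by linarith)).comp t hxt).div_const
        (p + 1)).congr_deriv ?_
      rw [show p + 1 - 2 = p - 1 by ring]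
      field_simp
    refine (((h1.fun_mul (hyt.hasDerivAt.fun_pow 2)).fun_add h2).fun_add
      ((hxt.fun_pow 2).div_const 2)).congr_deriv ?_
    push_cast
    ring
  · intro t ht
    obtain ⟨-, -, heq⟩ := h.system t ⟨ht.1, by linarith [ht.2, hρ.2]⟩
    have ht1 : t ≤ 1 := by linarith [ht.2, hρ.2]
    have hm := one_sub_sq_le ht.1.le (ht.2.le.trans hρ.2)
    have hF : -t * y t ^ 2 + (1 - t ^ 2) * y t * deriv y t
        + |x t| ^ (p - 1) * x t * y t + x t * y t = -(t * y t ^ 2) - ((N : ℝ) - 1) / t * y t ^ 2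
        + 2 * (alphaP p + 1) * t * y t ^ 2 + (alphaP p * (alphaP p + 1) + 1) * (x t * y t) := by
      linear_combination y t * heq
    have hk : 0 ≤ ((N : ℝ) - 1) / t * y t ^ 2 :=
      mul_nonneg (div_nonneg hN' ht.1.le) (sq_nonneg _)
    have hq : -t * y t ^ 2 + (1 - t ^ 2) * y t * deriv y t
        + |x t| ^ (p - 1) * x t * y t + x t * y t ≤ K * ((y t ^ 2 + x t ^ 2) / 2 + y t ^ 2 / 2) := by
      rw [hF]
      have e1 : 0 ≤ t * y t ^ 2 := mul_nonneg ht.1.le (sq_nonneg _)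
      have e2 : 2 * (alphaP p + 1) * t * y t ^ 2 ≤ 2 * (alphaP p + 1) * y t ^ 2 := by
        have : 2 * (alphaP p + 1) * t ≤ 2 * (alphaP p + 1) :=
          mul_le_of_le_one_right (by positivity) ht1
        exact mul_le_mul_of_nonneg_right this (sq_nonneg _)
      have e3 : x t * y t ≤ (y t ^ 2 + x t ^ 2) / 2 := by nlinarith [sq_nonneg (x t - y t)]
      have e4 := mul_le_mul_of_nonneg_left e3
        (show 0 ≤ alphaP p * (alphaP p + 1) + 1 by positivity)
      have e5 : 0 ≤ 2 * (alphaP p + 1) * (x t ^ 2 / 2) := by positivity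
      have e6 : 0 ≤ (alphaP p * (alphaP p + 1) + 1) * (y t ^ 2 / 2) := by positivity
      rw [hK]
      linarith
    have hE' : (1 - R ^ 2) / 2 * ((y t ^ 2 + x t ^ 2) / 2 + y t ^ 2 / 2) ≤ E t := by
      have e1 := mul_le_mul_of_nonneg_right hm (sq_nonneg (y t))
      have e2 : 0 ≤ |x t| ^ (p + 1) / (p + 1) := by positivity
      have e3 : 0 ≤ R ^ 2 * x t ^ 2 := by positivity
      have e4 : 0 ≤ x t ^ 2 := sq_nonneg _
      simp only [hE]
      linarith
    refine hq.trans ?_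
    rw [div_mul_eq_mul_div, le_div_iff₀ (by linarith), mul_assoc]
    exact mul_le_mul_of_nonneg_left (by linarith) hK0.le

/-- The derivative of the energy `(x₁ - x₂)² + (y₁ - y₂)²` of the difference of two solutions is
controlled by the energy: the singular drift only helps forward in time. -/
theorem ProfileSystem.energy_deriv_bounds {N : ℕ} {p M m₀ ρ : ℝ} {x₁ y₁ x₂ y₂ : ℝ → ℝ}
    (hN : 1 ≤ N) (hp : 1 < p) (hm₀ : 0 < m₀) (hm : m₀ ≤ 1 - ρ ^ 2) (hρ : 0 < ρ)
    (h₁ : ProfileSystem N p x₁ y₁ ρ) (h₂ : ProfileSystem N p x₂ y₂ ρ)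
    (hx₁ : |x₁ ρ| ≤ M) (hx₂ : |x₂ ρ| ≤ M) :
    (2 * (x₁ ρ - x₂ ρ) * (y₁ ρ - y₂ ρ) + 2 * (y₁ ρ - y₂ ρ) * (deriv y₁ ρ - deriv y₂ ρ) ≤
      (1 + 2 * ((2 * (alphaP p + 1) + (alphaP p * (alphaP p + 1) + p * M ^ (p - 1)) / 2) / m₀)) *
        ((x₁ ρ - x₂ ρ) ^ 2 + (y₁ ρ - y₂ ρ) ^ 2)) ∧
    ∀ k₀ : ℝ, ((N : ℝ) - 1) / ρ ≤ k₀ →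
    (-(2 * (x₁ ρ - x₂ ρ) * (y₁ ρ - y₂ ρ) + 2 * (y₁ ρ - y₂ ρ) * (deriv y₁ ρ - deriv y₂ ρ)) ≤
      (1 + 2 * ((k₀ + (2 * (alphaP p + 1) +
        (alphaP p * (alphaP p + 1) + p * M ^ (p - 1)) / 2)) / m₀)) *
        ((x₁ ρ - x₂ ρ) ^ 2 + (y₁ ρ - y₂ ρ) ^ 2)) := by
  have hα : 0 < alphaP p := div_pos two_pos (by linarith)
  have hM : 0 ≤ M := (abs_nonneg _).trans hx₁
  have hk : 0 ≤ ((N : ℝ) - 1) / ρ := by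
    have : (1 : ℝ) ≤ N := by exact_mod_cast hN
    exact div_nonneg (by linarith) hρ.le
  have hρ1 : ρ ≤ 1 := by nlinarith
  have hF := abs_abs_rpow_mul_sub_le hp hx₁ hx₂
  have e₁ := h₁.2.2
  have e₂ := h₂.2.2
  set L := p * M ^ (p - 1) with hL
  have hL0 : 0 ≤ L := by positivity
  set k := ((N : ℝ) - 1) / ρ
  set A := alphaP p
  set d := x₁ ρ - x₂ ρ
  set e := y₁ ρ - y₂ ρ
  set F := |x₁ ρ| ^ (p - 1) * x₁ ρ - |x₂ ρ| ^ (p - 1) * x₂ ρ with hFdef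
  set q := deriv y₁ ρ - deriv y₂ ρ
  have heq : (1 - ρ ^ 2) * q = -(k * e) + 2 * (A + 1) * ρ * e + A * (A + 1) * d - F := by
    linear_combination e₁ - e₂
  have hsq : 0 ≤ e ^ 2 := sq_nonneg e
  have hsd : 0 ≤ d ^ 2 := sq_nonneg d
  have hde : |d * e| ≤ (d ^ 2 + e ^ 2) / 2 := by
    rw [abs_le]
    constructor <;> nlinarith [sq_nonneg (d - e), sq_nonneg (d + e)]
  have hFe : |F * e| ≤ L * ((d ^ 2 + e ^ 2) / 2) := by
    calc |F * e| = |F| * |e| := abs_mul _ _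
      _ ≤ L * |d| * |e| := mul_le_mul_of_nonneg_right hF (abs_nonneg _)
      _ = L * |d * e| := by rw [abs_mul, mul_assoc]
      _ ≤ _ := mul_le_mul_of_nonneg_left hde hL0
  have hAde : |A * (A + 1) * (d * e)| ≤ A * (A + 1) * ((d ^ 2 + e ^ 2) / 2) := by
    rw [abs_mul, abs_of_pos (show 0 < A * (A + 1) by positivity)]
    exact mul_le_mul_of_nonneg_left hde (by positivity)
  have hdrift : 0 ≤ 2 * (A + 1) * ρ * e ^ 2 := by positivity
  have hdrift' : 2 * (A + 1) * ρ * e ^ 2 ≤ 2 * (A + 1) * e ^ 2 :=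
    mul_le_mul_of_nonneg_right (mul_le_of_le_one_right (by positivity) hρ1) hsq
  have hAd : 0 ≤ 2 * (A + 1) * d ^ 2 := by positivity
  have hAe : 0 ≤ 2 * (A + 1) * e ^ 2 := by positivity
  have hke : 0 ≤ k * e ^ 2 := by positivity
  have hmul : (1 - ρ ^ 2) * (e * q) = -(k * e ^ 2) + 2 * (A + 1) * ρ * e ^ 2
      + A * (A + 1) * (d * e) - F * e := by
    linear_combination e * heq
  rw [abs_le] at hFe hAde hde
  constructor
  · have h := le_div_mul_of_mul_le (q := e * q) (S := d ^ 2 + e ^ 2)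
      (K := 2 * (A + 1) + (A * (A + 1) + L) / 2) hm₀ hm (by positivity) (by positivity)
      (by rw [hmul]; linarith)
    linarith
  · intro k₀ hk₀
    have hk₀0 : 0 ≤ k₀ := hk.trans hk₀
    have hke' : k * e ^ 2 ≤ k₀ * e ^ 2 := mul_le_mul_of_nonneg_right hk₀ hsq
    have hkd : 0 ≤ k₀ * d ^ 2 := by positivity
    have h := le_div_mul_of_mul_le (q := -(e * q)) (S := d ^ 2 + e ^ 2)
      (K := k₀ + (2 * (A + 1) + (A * (A + 1) + L) / 2)) hm₀ hm (by positivity) (by positivity)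
      (by rw [mul_neg, hmul]; linarith)
    linarith

theorem ProfileSystem.hasDerivAt_energy {N : ℕ} {p ρ : ℝ} {x₁ y₁ x₂ y₂ : ℝ → ℝ}
    (h₁ : ProfileSystem N p x₁ y₁ ρ) (h₂ : ProfileSystem N p x₂ y₂ ρ) :
    HasDerivAt (fun t => (x₁ t - x₂ t) ^ 2 + (y₁ t - y₂ t) ^ 2)
      (2 * (x₁ ρ - x₂ ρ) * (y₁ ρ - y₂ ρ) +
        2 * (y₁ ρ - y₂ ρ) * (deriv y₁ ρ - deriv y₂ ρ)) ρ := by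
  refine (((h₁.1.fun_sub h₂.1).fun_pow 2).fun_add
    ((h₁.2.1.hasDerivAt.fun_sub h₂.2.1.hasDerivAt).fun_pow 2)).congr_deriv ?_
  push_cast
  ring

/-- Solutions depend Lipschitz continuously on `c`, uniformly on `[0, R]`. -/
theorem exists_energy_le {p R B : ℝ} (N : ℕ) (hN : 1 ≤ N) (hp : 1 < p) (hR : R < 1) :
    ∃ K : ℝ, ∀ c₁ c₂ : ℝ, |c₁| ≤ B → |c₂| ≤ B → ∀ x₁ y₁ x₂ y₂ : ℝ → ℝ,
      IsProfile N p c₁ x₁ y₁ → IsProfile N p c₂ x₂ y₂ → ∀ ρ ∈ Icc 0 R,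
      (x₁ ρ - x₂ ρ) ^ 2 + (y₁ ρ - y₂ ρ) ^ 2 ≤ (c₁ - c₂) ^ 2 * K := by
  by_cases hR0 : 0 ≤ R
  swap
  · exact ⟨0, fun _ _ _ _ _ _ _ _ _ _ ρ hρ => absurd (hρ.1.trans hρ.2) hR0⟩
  have hα : 0 < alphaP p := div_pos two_pos (by linarith)
  have hm₀ : 0 < 1 - R ^ 2 := by nlinarith
  set Q := Real.exp ((2 * (alphaP p + 1) + alphaP p * (alphaP p + 1) + 1) / ((1 - R ^ 2) / 2))
  set M := Real.sqrt (2 * ((B ^ (p + 1) / (p + 1) + B ^ 2 / 2) * Q))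
  have hbound : ∀ c, |c| ≤ B → ∀ x y, IsProfile N p c x y → ∀ ρ ∈ Icc 0 R, |x ρ| ≤ M := by
    intro c hc x y h ρ hρ
    refine Real.abs_le_sqrt ((h.sq_le hN hp hR hρ).trans ?_)
    have hc2 : c ^ 2 ≤ B ^ 2 := sq_le_sq' (abs_le.1 hc).1 (abs_le.1 hc).2
    gcongr
  set C := 1 + 2 * ((2 * (alphaP p + 1) + (alphaP p * (alphaP p + 1) + p * M ^ (p - 1)) / 2) /
    (1 - R ^ 2))
  have hC : 0 ≤ C := by positivity
  refine ⟨Real.exp C, fun c₁ c₂ hc₁ hc₂ x₁ y₁ x₂ y₂ h₁ h₂ ρ hρ => ?_⟩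
  have hsub : Icc 0 ρ ⊆ Ico (0 : ℝ) 1 := fun t ht => ⟨ht.1, by linarith [ht.2, hρ.2]⟩
  have hin : ∀ t ∈ Ioo 0 ρ, t ∈ Ioo (0 : ℝ) 1 := fun t ht => ⟨ht.1, by linarith [ht.2, hρ.2]⟩
  have hgr := le_mul_exp_of_hasDerivAt_le (C := C) hρ.1
    (E := fun t => (x₁ t - x₂ t) ^ 2 + (y₁ t - y₂ t) ^ 2)
    ((((h₁.continuousOn_fst.sub h₂.continuousOn_fst).pow 2).add
      ((h₁.continuousOn_snd.sub h₂.continuousOn_snd).pow 2)).mono hsub)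
    (fun t ht => (h₁.system t (hin t ht)).hasDerivAt_energy (h₂.system t (hin t ht)))
    (fun t ht => by
      have htR : t ∈ Icc 0 R := ⟨ht.1.le, ht.2.le.trans hρ.2⟩
      exact ((h₁.system t (hin t ht)).energy_deriv_bounds hN hp hm₀
        (one_sub_sq_le htR.1 htR.2) ht.1 (h₂.system t (hin t ht))
        (hbound c₁ hc₁ x₁ y₁ h₁ t htR) (hbound c₂ hc₂ x₂ y₂ h₂ t htR)).1)
  simp only [h₁.fst_zero, h₂.fst_zero, h₁.snd_zero, h₂.snd_zero, sub_self, ne_eq,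
    OfNat.ofNat_ne_zero, not_false_eq_true, zero_pow, add_zero, sub_zero] at hgr
  refine hgr.trans (mul_le_mul_of_nonneg_left ?_ (sq_nonneg _))
  exact Real.exp_le_exp.2 (mul_le_of_le_one_right hC (by linarith [hρ.2]))

/-- Backward uniqueness away from the singular point. -/
theorem ProfileSystem.eq_of_eq {N : ℕ} {p a b : ℝ} {x₁ y₁ x₂ y₂ : ℝ → ℝ} (hN : 1 ≤ N)
    (hp : 1 < p) (ha : 0 < a) (hab : a ≤ b) (hb : b < 1)
    (h₁ : ∀ t ∈ Icc a b, ProfileSystem N p x₁ y₁ t)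
    (h₂ : ∀ t ∈ Icc a b, ProfileSystem N p x₂ y₂ t)
    (hx : x₁ b = x₂ b) (hy : y₁ b = y₂ b) : x₁ a = x₂ a := by
  have hc₁ : ContinuousOn x₁ (Icc a b) :=
    fun t ht => (h₁ t ht).1.continuousAt.continuousWithinAt
  have hc₂ : ContinuousOn x₂ (Icc a b) :=
    fun t ht => (h₂ t ht).1.continuousAt.continuousWithinAt
  obtain ⟨M₁, hM₁⟩ := isCompact_Icc.exists_bound_of_continuousOn hc₁
  obtain ⟨M₂, hM₂⟩ := isCompact_Icc.exists_bound_of_continuousOn hc₂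
  have hgr := le_mul_exp_of_neg_hasDerivAt_le hab
    (E := fun t => (x₁ t - x₂ t) ^ 2 + (y₁ t - y₂ t) ^ 2)
    (fun t ht => ((h₁ t ht).hasDerivAt_energy (h₂ t ht)).continuousAt.continuousWithinAt)
    (fun t ht => (h₁ t (Ioo_subset_Icc_self ht)).hasDerivAt_energy
      (h₂ t (Ioo_subset_Icc_self ht)))
    (fun t ht => by
      have ht' := Ioo_subset_Icc_self ht
      have hN' : (1 : ℝ) ≤ N := by exact_mod_cast hN
      exact ((h₁ t ht').energy_deriv_bounds (M := max M₁ M₂) (m₀ := 1 - b ^ 2) hN hp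
        (by nlinarith) (one_sub_sq_le (by linarith [ht.1]) ht.2.le) (by linarith [ht.1]) (h₂ t ht')
        ((hM₁ t ht').trans (le_max_left _ _)) ((hM₂ t ht').trans (le_max_right _ _))).2
        (((N : ℝ) - 1) / a) (div_le_div_of_nonneg_left (by linarith) ha ht.1.le))
  simp only [hx, hy, sub_self, ne_eq, OfNat.ofNat_ne_zero, not_false_eq_true, zero_pow, add_zero,
    zero_mul] at hgr
  have : (x₁ a - x₂ a) ^ 2 = 0 := le_antisymm (by linarith [sq_nonneg (y₁ a - y₂ a)]) (sq_nonneg _)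
  exact sub_eq_zero.1 (pow_eq_zero_iff two_ne_zero |>.1 this)

/-- The singular solution solves the profile system. -/
theorem profileSystem_uInf {N : ℕ} {p ρ : ℝ} (hp : 1 < p) (hα : alphaP p < (N : ℝ) - 2)
    (hρ : 0 < ρ) :
    ProfileSystem N p (uInf N p) (fun t => -(alphaP p) * bInf N p * t ^ (-(alphaP p) - 1)) ρ := by
  have hα0 : 0 < alphaP p := div_pos two_pos (by linarith)
  have hbase : 0 < alphaP p * ((N : ℝ) - 2 - alphaP p) := mul_pos hα0 (by linarith)
  have hb : 0 < bInf N p := Real.rpow_pos_of_pos hbase _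
  have hαp : alphaP p * (p - 1) = 2 := div_mul_cancel₀ _ (by linarith)
  have hbp : bInf N p ^ (p - 1) = alphaP p * ((N : ℝ) - 2 - alphaP p) := by
    rw [bInf, ← Real.rpow_mul hbase.le, div_mul_eq_mul_div, hαp]
    norm_num
  have hy : HasDerivAt (fun t => -(alphaP p) * bInf N p * t ^ (-(alphaP p) - 1))
      (-(alphaP p) * bInf N p * ((-(alphaP p) - 1) * ρ ^ (-(alphaP p) - 1 - 1))) ρ :=
    (Real.hasDerivAt_rpow_const (Or.inl hρ.ne')).const_mul _
  refine ⟨?_, hy.differentiableAt, ?_⟩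
  · exact ((Real.hasDerivAt_rpow_const (p := -(alphaP p)) (Or.inl hρ.ne')).const_mul
      (bInf N p)).congr_deriv (by ring)
  rw [hy.deriv]
  have hu : 0 < uInf N p ρ := mul_pos hb (Real.rpow_pos_of_pos hρ _)
  have hnl : |uInf N p ρ| ^ (p - 1) = alphaP p * ((N : ℝ) - 2 - alphaP p) / ρ ^ 2 := by
    rw [abs_of_pos hu, uInf, Real.mul_rpow hb.le (Real.rpow_pos_of_pos hρ _).le, hbp,
      ← Real.rpow_mul hρ.le, neg_mul, hαp, Real.rpow_neg hρ.le, Real.rpow_two, div_eq_mul_inv]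
  rw [hnl]
  simp only [uInf, Real.rpow_sub_one hρ.ne']
  field_simp
  ring

theorem isProfile_of_contDiffOn {N : ℕ} {p c : ℝ} {v : ℝ → ℝ} (hv : ContDiffOn ℝ 2 v (Ico 0 1))
    (hsol : IsSolOn N p v (Ioo 0 1)) (h0 : v 0 = c) (h0' : derivWithin v (Ici 0) 0 = 0) :
    IsProfile N p c v (derivWithin v (Ico 0 1)) := by
  have hd : ∀ ρ ∈ Ioo (0 : ℝ) 1, derivWithin v (Ico 0 1) =ᶠ[nhds ρ] deriv v := fun ρ hρ => by
    filter_upwards [isOpen_Ioo.mem_nhds hρ] with t ht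
    exact derivWithin_of_mem_nhds (Ico_mem_nhds ht.1 ht.2)
  have hv' : ContDiffOn ℝ 1 (derivWithin v (Ico 0 1)) (Ico 0 1) :=
    hv.derivWithin (uniqueDiffOn_Ico 0 1) (by norm_num)
  refine ⟨hv.continuousOn, hv'.continuousOn, h0, ?_, fun ρ hρ => ⟨?_, ?_, ?_⟩⟩
  · refine (derivWithin_congr_set ?_).trans h0'
    filter_upwards [Iio_mem_nhds one_pos] with t ht
    exact propext ⟨fun h => h.1, fun h => ⟨h, ht⟩⟩
  · rw [(hd ρ hρ).eq_of_nhds]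
    exact ((hv.differentiableOn (by norm_num)).differentiableAt
      (Ico_mem_nhds hρ.1 hρ.2)).hasDerivAt
  · exact (hv'.differentiableOn (by norm_num)).differentiableAt (Ico_mem_nhds hρ.1 hρ.2)
  · rw [(hd ρ hρ).deriv_eq, (hd ρ hρ).eq_of_nhds]
    linear_combination hsol ρ hρ

theorem continuousOn_prod_of_locally_lipschitz {f : ℝ → ℝ → ℝ}
    (hf : ∀ c, ContinuousOn (f c) (Ico 0 1))
    (hlip : ∀ R < 1, ∀ B, ∃ K : ℝ, ∀ c₁ c₂ : ℝ, |c₁| ≤ B → |c₂| ≤ B → ∀ ρ ∈ Icc 0 R,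
      (f c₁ ρ - f c₂ ρ) ^ 2 ≤ (c₁ - c₂) ^ 2 * K) :
    ContinuousOn (fun q : ℝ × ℝ => f q.2 q.1) (Ico 0 1 ×ˢ Ici 0) := by
  rintro ⟨ρ₀, c₀⟩ ⟨hρ₀, -⟩
  obtain ⟨K, hK⟩ := hlip ((1 + ρ₀) / 2) (by linarith [hρ₀.2]) (|c₀| + 1)
  have hcont : ContinuousWithinAt (fun q : ℝ × ℝ => f c₀ q.1) (Ico 0 1 ×ˢ Ici 0) (ρ₀, c₀) :=
    (hf c₀ ρ₀ hρ₀).comp continuous_fst.continuousWithinAt fun q hq => hq.1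
  have hlim : Tendsto (fun q : ℝ × ℝ => |q.2 - c₀| * √K)
      (nhdsWithin (ρ₀, c₀) (Ico 0 1 ×ˢ Ici 0)) (nhds 0) := by
    have h : Continuous fun q : ℝ × ℝ => |q.2 - c₀| * √K := by fun_prop
    simpa using (h.tendsto (ρ₀, c₀)).mono_left nhdsWithin_le_nhds
  have hdiff : Tendsto (fun q : ℝ × ℝ => f q.2 q.1 - f c₀ q.1)
      (nhdsWithin (ρ₀, c₀) (Ico 0 1 ×ˢ Ici 0)) (nhds 0) := by
    refine squeeze_zero_norm' ?_ hlim
    have h1 : ∀ᶠ q : ℝ × ℝ in nhds (ρ₀, c₀), q.1 < (1 + ρ₀) / 2 :=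
      continuous_fst.continuousAt.eventually_lt_const (by linarith [hρ₀.2])
    have h2 : ∀ᶠ q : ℝ × ℝ in nhds (ρ₀, c₀), |q.2| < |c₀| + 1 :=
      continuous_snd.abs.continuousAt.eventually_lt_const (by simp)
    filter_upwards [nhdsWithin_le_nhds h1, nhdsWithin_le_nhds h2, self_mem_nhdsWithin]
      with q hq1 hq2 hq
    rw [Real.norm_eq_abs, ← Real.sqrt_sq_eq_abs, ← Real.sqrt_sq_eq_abs (q.2 - c₀),
      ← Real.sqrt_mul (sq_nonneg _)]
    exact Real.sqrt_le_sqrt (hK q.2 c₀ hq2.le (by linarith) q.1 ⟨hq.1.1, hq1.le⟩)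
  simpa using! hdiff.add hcont

theorem stmt6 (N : ℕ) (p : ℝ) (hN : 3 ≤ N) (hp : 1 + 4 / ((N : ℝ) - 2) < p)
    (u : ℝ → ℝ → ℝ)
    (hu : ∀ c : ℝ,
      ContDiffOn ℝ 2 (u c) (Ico 0 1) ∧
      IsSolOn N p (u c) (Ioo 0 1) ∧
      u c 0 = c ∧
      derivWithin (u c) (Ici 0) 0 = 0) :
    (∀ ρ ∈ Ioo (0 : ℝ) 1, ∀ c : ℝ, 0 ≤ c →
      ¬(wFun N p u c ρ = 0 ∧ ρ * deriv (wFun N p u c) ρ = 0)) ∧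
    ∃ Θ : ℝ → ℝ → ℝ,
      ContinuousOn (fun q : ℝ × ℝ => Θ q.1 q.2) (Ico 0 1 ×ˢ Ici 0) ∧
      (∀ ρ ∈ Ico (0 : ℝ) 1, ∀ c : ℝ, 0 ≤ c → wFun N p u c ρ ≠ 0 →
        Real.tan (Θ ρ c) = ρ * deriv (wFun N p u c) ρ / wFun N p u c ρ) ∧
      (∀ ρ ∈ Ico (0 : ℝ) 1, ∀ c : ℝ, 0 ≤ c →
        ((∃ k : ℤ, Θ ρ c = Real.pi / 2 + (k : ℝ) * Real.pi) ↔
          wFun N p u c ρ = 0)) ∧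
      (∀ c : ℝ, 0 ≤ c → Θ 0 c = Real.pi) ∧
      (∀ ρ ∈ Ico (0 : ℝ) 1, Θ ρ 0 = Real.pi) := by
  have hN2 : (1 : ℝ) ≤ (N : ℝ) - 2 := by
    have : (3 : ℝ) ≤ N := by exact_mod_cast hN
    linarith
  have hdiv : 0 < 4 / ((N : ℝ) - 2) := by positivity
  have hp1 : 1 < p := by linarith
  have hα : alphaP p < (N : ℝ) - 2 := by
    have h4 : 4 < (p - 1) * ((N : ℝ) - 2) := by
      rw [← div_lt_iff₀ (by linarith)]
      linarith
    rw [alphaP, div_lt_iff₀ (by linarith)]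
    linarith
  have hα0 : 0 < alphaP p := div_pos two_pos (by linarith)
  have hb : 0 < bInf N p := Real.rpow_pos_of_pos (mul_pos hα0 (by linarith)) _
  have hN1 : 1 ≤ N := by omega
  set Y : ℝ → ℝ → ℝ := fun c => derivWithin (u c) (Ico 0 1) with hY
  have hprof : ∀ c, IsProfile N p c (u c) (Y c) := fun c =>
    isProfile_of_contDiffOn (hu c).1 (hu c).2.1 (hu c).2.2.1 (hu c).2.2.2
  set W : ℝ × ℝ → ℝ := fun q => u q.2 q.1 * q.1 ^ alphaP p / bInf N p - 1 with hW
  set V : ℝ × ℝ → ℝ := fun q =>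
    (q.1 * Y q.2 q.1 + alphaP p * u q.2 q.1) * q.1 ^ alphaP p / bInf N p with hV
  have hwW : ∀ c, ∀ ρ : ℝ, 0 ≤ ρ → wFun N p u c ρ = W (ρ, c) := by
    intro c ρ hρ
    simp only [wFun, uInf, hW, Real.rpow_neg hρ]
    field_simp
  have hdV : ∀ c, ∀ ρ ∈ Ico (0 : ℝ) 1, ρ * deriv (wFun N p u c) ρ = V (ρ, c) := by
    intro c ρ hρ
    rcases hρ.1.eq_or_lt with rfl | h0
    · simp [hV, Real.zero_rpow hα0.ne']
    · have hd := (((((hprof c).system ρ ⟨h0, hρ.2⟩).1.fun_mul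
        (Real.hasDerivAt_rpow_const (p := alphaP p) (Or.inl h0.ne'))).div_const
        (bInf N p)).sub_const 1)
      have heq : wFun N p u c =ᶠ[nhds ρ]
          fun t => u c t * t ^ alphaP p / bInf N p - 1 := by
        filter_upwards [Ioi_mem_nhds h0] with t ht
        exact hwW c t (le_of_lt ht)
      rw [heq.deriv_eq, hd.deriv, Real.rpow_sub_one h0.ne']
      simp only [hV]
      field_simp
  have hu_cont : ContinuousOn (fun q : ℝ × ℝ => u q.2 q.1) (Ico 0 1 ×ˢ Ici 0) := by
    refine continuousOn_prod_of_locally_lipschitz (fun c => (hprof c).continuousOn_fst) ?_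
    intro R hR B
    obtain ⟨K, hK⟩ := exists_energy_le (B := B) N hN1 hp1 hR
    exact ⟨K, fun c₁ c₂ h₁ h₂ ρ hρ => le_trans (le_add_of_nonneg_right (sq_nonneg _))
      (hK c₁ c₂ h₁ h₂ _ _ _ _ (hprof c₁) (hprof c₂) ρ hρ)⟩
  have hY_cont : ContinuousOn (fun q : ℝ × ℝ => Y q.2 q.1) (Ico 0 1 ×ˢ Ici 0) := by
    refine continuousOn_prod_of_locally_lipschitz (fun c => (hprof c).continuousOn_snd) ?_
    intro R hR B
    obtain ⟨K, hK⟩ := exists_energy_le (B := B) N hN1 hp1 hR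
    exact ⟨K, fun c₁ c₂ h₁ h₂ ρ hρ => le_trans (le_add_of_nonneg_left (sq_nonneg _))
      (hK c₁ c₂ h₁ h₂ _ _ _ _ (hprof c₁) (hprof c₂) ρ hρ)⟩
  have hpow : Continuous fun q : ℝ × ℝ => q.1 ^ alphaP p :=
    continuous_fst.rpow_const fun _ => Or.inr hα0.le
  have hWc : ContinuousOn W (Ico 0 1 ×ˢ Ici 0) :=
    ((hu_cont.mul hpow.continuousOn).div_const _).sub continuousOn_const
  have hVc : ContinuousOn V (Ico 0 1 ×ˢ Ici 0) :=
    (((continuousOn_fst.mul hY_cont).add (continuousOn_const.mul hu_cont)).mul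
      hpow.continuousOn).div_const _
  have hzero : ∀ ρ ∈ Ico (0 : ℝ) 1, u 0 ρ = 0 ∧ Y 0 ρ = 0 := by
    have hsys : ProfileSystem N p (fun _ => 0) (fun _ => 0) = fun _ => True := by
      funext t
      simp only [ProfileSystem, eq_iff_iff, iff_true]
      exact ⟨hasDerivAt_const _ _, differentiableAt_const _, by simp⟩
    have hz : IsProfile N p 0 (fun _ => 0) (fun _ => 0) :=
      ⟨continuousOn_const, continuousOn_const, rfl, rfl, fun t _ => by rw [hsys]; trivial⟩
    intro ρ hρ
    obtain ⟨K, hK⟩ := exists_energy_le (B := 0) N hN1 hp1 hρ.2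
    have h := hK 0 0 (by simp) (by simp) _ _ _ _ (hprof 0) hz ρ ⟨hρ.1, le_rfl⟩
    simp only [sub_zero, ne_eq, OfNat.ofNat_ne_zero, not_false_eq_true, zero_pow, zero_mul] at h
    exact ⟨by nlinarith [sq_nonneg (Y 0 ρ), sq_nonneg (u 0 ρ)],
      by nlinarith [sq_nonneg (Y 0 ρ), sq_nonneg (u 0 ρ)]⟩
  have hW₀ : ∀ q ∈ Ico (0 : ℝ) 1 ×ˢ Ici (0 : ℝ), q.1 = 0 ∨ q.2 = 0 → W q = -1 := by
    rintro ⟨ρ, c⟩ hq (rfl | rfl)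
    · simp [hW, Real.zero_rpow hα0.ne']
    · simp [hW, (hzero ρ hq.1).1]
  have hV₀ : ∀ q ∈ Ico (0 : ℝ) 1 ×ˢ Ici (0 : ℝ), q.1 = 0 ∨ q.2 = 0 → V q = 0 := by
    rintro ⟨ρ, c⟩ hq (rfl | rfl)
    · simp [hV, Real.zero_rpow hα0.ne']
    · simp [hV, hzero ρ hq.1]
  have hne : ∀ q ∈ Ico (0 : ℝ) 1 ×ˢ Ici (0 : ℝ), ¬(W q = 0 ∧ V q = 0) := by
    rintro ⟨ρ, c⟩ ⟨hρ, hc⟩ ⟨hw, hv⟩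
    rcases hρ.1.eq_or_lt with rfl | h0
    · have := hW₀ (0, c) ⟨hρ, hc⟩ (Or.inl rfl)
      linarith
    have hpos : 0 < ρ ^ alphaP p := Real.rpow_pos_of_pos h0 _
    have hux : u c ρ = uInf N p ρ := by
      simp only [hW] at hw
      rw [uInf, Real.rpow_neg h0.le]
      field_simp at hw ⊢
      linarith
    have huy : Y c ρ = -(alphaP p) * bInf N p * ρ ^ (-(alphaP p) - 1) := by
      simp only [hV, div_eq_zero_iff, mul_eq_zero, hpos.ne', hb.ne', or_false] at hv
      rw [hux, uInf] at hv
      rw [Real.rpow_sub_one h0.ne']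
      field_simp
      linarith
    have hWa : ∀ a ∈ Ioc 0 ρ, W (a, c) = 0 := by
      intro a ha
      have h := ProfileSystem.eq_of_eq hN1 hp1 ha.1 ha.2 hρ.2
        (fun t ht => (hprof c).system t ⟨by linarith [ha.1, ht.1], by linarith [ht.2, hρ.2]⟩)
        (fun t ht => profileSystem_uInf hp1 hα (by linarith [ha.1, ht.1])) hux huy
      have hapos : 0 < a ^ alphaP p := Real.rpow_pos_of_pos ha.1 _
      simp only [hW, h, uInf, Real.rpow_neg ha.1.le]
      field_simp
      ring
    have hWc0 : ContinuousWithinAt (fun a => W (a, c)) (Ioc 0 ρ) 0 := by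
      have hmaps : MapsTo (fun a : ℝ => (a, c)) (Ioc 0 ρ) (Ico 0 1 ×ˢ Ici 0) :=
        fun a ha => ⟨⟨ha.1.le, ha.2.trans_lt hρ.2⟩, hc⟩
      exact (hWc (0, c) ⟨⟨le_rfl, one_pos⟩, hc⟩).comp (f := fun a : ℝ => (a, c))
        (by fun_prop) hmaps
    have hcl : (0 : ℝ) ∈ closure (Ioc 0 ρ) := by
      rw [closure_Ioc h0.ne]
      exact ⟨le_rfl, h0.le⟩
    have h00 := hWc0.mem_closure (t := {0}) hcl fun a ha => hWa a ha
    rw [closure_singleton, mem_singleton_iff, hW₀ (0, c) ⟨⟨le_rfl, one_pos⟩, hc⟩ (Or.inl rfl)] at h00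
    norm_num at h00
  obtain ⟨Θ, hΘc, hΘ, hΘ₀⟩ := exists_continuous_angle hWc hVc hne hW₀ hV₀
  refine ⟨fun ρ hρ c hc h => ?_, fun ρ c => Θ (ρ, c), hΘc, ?_, ?_, ?_, ?_⟩
  · rw [hwW c ρ hρ.1.le, hdV c ρ ⟨hρ.1.le, hρ.2⟩] at h
    exact hne (ρ, c) ⟨⟨hρ.1.le, hρ.2⟩, hc⟩ h
  · intro ρ hρ c hc hw
    obtain ⟨r, hr, h1, h2⟩ := hΘ (ρ, c) ⟨hρ, hc⟩
    rw [hdV c ρ hρ, hwW c ρ hρ.1, h1, h2, Real.tan_eq_sin_div_cos, mul_div_mul_left _ _ hr.ne']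
  · intro ρ hρ c hc
    obtain ⟨r, hr, h1, -⟩ := hΘ (ρ, c) ⟨hρ, hc⟩
    rw [hwW c ρ hρ.1, h1, mul_eq_zero, or_iff_right hr.ne', Real.cos_eq_zero_iff]
    refine exists_congr fun k => ?_
    rw [show (2 * (k : ℝ) + 1) * Real.pi / 2 = Real.pi / 2 + k * Real.pi by ring]
  · exact fun c hc => hΘ₀ (0, c) ⟨⟨le_rfl, one_pos⟩, hc⟩ (Or.inl rfl)
  · exact fun ρ hρ => hΘ₀ (ρ, 0) ⟨hρ, self_mem_Ici⟩ (Or.inr rfl)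
end
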